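/- arXiv:1802.06419 — 5 statements merged into one kernel-verified Lean document; each statement's English description precedes it below -/
import Mathlib

section
/- Edge-flip lemma at d = 3, single parallel edge case: Let G = (σ_0, σ_1, σ_2, σ_3) be a connected colored graph on 2n vertices, and let v_1 ≠ v_2 be white vertices such that for some color c ∈ {1,2,3} either σ_c v_1 = σ_0 v_2 or σ_c v_2 = σ_0 v_1 (the two color-0 edges at v_1 and v_2 are incident to vertices joined by an edge of color c). If the flipped graph G' = (σ_0 ∘ swap(v_1, v_2), σ_1, σ_2, σ_3) is connected, then C_0(G') ≥ C_0(G) − 1. -/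
/-- The setoid on `α` whose classes are the cycles (orbits) of the permutation `π`. -/
def permSetoid {α : Type*} (π : Equiv.Perm α) : Setoid α :=
  ⟨π.SameCycle, ⟨fun _ => ⟨0, by simp⟩, fun h => h.symm, fun h h' => h.trans h'⟩⟩

/-- The number of cycles (orbits) of a permutation. -/
noncomputable def numCycles {α : Type*} (π : Equiv.Perm α) : ℕ :=
  Nat.card (Quotient (permSetoid π))

/-- Connectivity of the colored graph `(σ 0, σ 1, σ 2, σ 3)` (case `d = 3`). -/
def ColoredConnected {n : ℕ} (σ : Fin 4 → Equiv.Perm (Fin n)) : Prop :=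
  ∀ x y : Fin n,
    ∃ g ∈ Subgroup.closure {g : Equiv.Perm (Fin n) | ∃ a b : Fin 4, g = (σ a)⁻¹ * σ b},
      g x = y

/-- `C_0(G) = Σ_{c=1}^{3} C_{0c}(G)` at `d = 3`. -/
noncomputable def C0 {n : ℕ} (σ : Fin 4 → Equiv.Perm (Fin n)) : ℕ :=
  numCycles ((σ 1)⁻¹ * σ 0) + numCycles ((σ 2)⁻¹ * σ 0) + numCycles ((σ 3)⁻¹ * σ 0)

open Equiv in
lemma sameCycle_induct {α : Type*} {β : Sort*} (π : Perm α) (f : α → β)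
    (hf : ∀ z, f (π z) = f z) {x y : α} (h : π.SameCycle x y) : f x = f y := by
  obtain ⟨k, rfl⟩ := h
  induction k using Int.induction_on with
  | zero => simp
  | succ i ih => rw [add_comm, zpow_add, zpow_one, Perm.mul_apply, hf]; exact ih
  | pred i ih =>
    rw [ih, ← hf ((π ^ (-(i : ℤ) - 1)) x), ← Perm.mul_apply, ← zpow_one_add]
    congr 3
    ring

open Equiv in
lemma numCycles_le_flip {n : ℕ} (π : Perm (Fin n)) (a b : Fin n) :
    numCycles π ≤ numCycles (π * swap a b) + 1 := by
  classical
  unfold numCycles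
  rw [← Finite.card_option]
  let g : Option (Quotient (permSetoid (π * swap a b))) → Quotient (permSetoid π) := fun o =>
    o.elim (Quotient.mk _ a) (fun D => if D = Quotient.mk _ a then Quotient.mk _ b
      else Quotient.mk _ D.out)
  refine Nat.card_le_card_of_surjective g ?_
  intro q
  induction q using Quotient.inductionOn with
  | h x =>
  by_cases ha : π.SameCycle x a
  · exact ⟨none, Quotient.sound ha.symm⟩
  by_cases hb : π.SameCycle x b
  · refine ⟨some (Quotient.mk _ a), ?_⟩
    simp only [g, Option.elim, if_true]
    exact Quotient.sound hb.symm
  have key : ∀ y, (π * swap a b).SameCycle x y → π.SameCycle x y := by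
    intro y hy
    have := sameCycle_induct (π * swap a b) (fun z => π.SameCycle x z) (by
      intro z
      simp only [Perm.mul_apply, Perm.sameCycle_apply_right, eq_iff_iff]
      rcases eq_or_ne z a with rfl | h1
      · simp [ha, hb]
      rcases eq_or_ne z b with rfl | h2
      · simp [ha, hb]
      rw [swap_apply_of_ne_of_ne h1 h2]) hy
    simp only [eq_iff_iff] at this
    exact this.1 (Perm.SameCycle.refl _ _)
  refine ⟨some (Quotient.mk _ x), ?_⟩
  have hne : (Quotient.mk (permSetoid (π * swap a b)) x) ≠ Quotient.mk _ a := by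
    intro h
    exact ha (key a (Quotient.exact h))
  simp only [g, Option.elim, if_neg hne]
  refine Quotient.sound (Perm.SameCycle.symm (key _ ?_))
  exact Perm.SameCycle.symm (Quotient.mk_out (s := permSetoid (π * swap a b)) x)

open Equiv in
lemma numCycles_flip_split {n : ℕ} (π : Perm (Fin n)) (a b : Fin n) (hab : a ≠ b)
    (h : π b = a) : numCycles π + 1 ≤ numCycles (π * swap a b) := by
  classical
  unfold numCycles
  rw [← Finite.card_option]
  have hba : π.SameCycle b a := ⟨1, by simpa using h⟩
  let f : Fin n → Option (Quotient (permSetoid π)) := fun x =>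
    if x = a then none else some (Quotient.mk _ x)
  have hf : ∀ z, f ((π * swap a b) z) = f z := by
    intro z
    rcases eq_or_ne z a with rfl | h1
    · simp [h]
    have h3 : (π * swap a b) z ≠ a := by
      intro h4
      apply h1
      have h5 : swap a b z = b := π.injective (by rw [h]; exact h4)
      exact (swap a b).injective (h5.trans (swap_apply_left a b).symm)
    simp only [f, if_neg h1, if_neg h3]
    congr 1
    apply Quotient.sound
    change π.SameCycle _ _
    rw [Perm.mul_apply, Perm.sameCycle_apply_left]
    rcases eq_or_ne z b with rfl | h2
    · rw [swap_apply_right]; exact hba.symm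
    · rw [swap_apply_of_ne_of_ne h1 h2]
  refine Nat.card_le_card_of_surjective
    (Quotient.lift (s := permSetoid (π * swap a b)) f
      (fun x y hxy => sameCycle_induct _ f hf hxy)) ?_
  rintro (_ | q)
  · exact ⟨Quotient.mk _ a, by simp [f]⟩
  induction q using Quotient.inductionOn with
  | h x =>
  rcases eq_or_ne x a with rfl | h1
  · refine ⟨Quotient.mk _ b, ?_⟩
    simp only [Quotient.lift_mk, f, if_neg hab.symm]
    congr 1
    exact Quotient.sound hba
  · exact ⟨Quotient.mk _ x, by simp [f, h1]⟩

/-- **Edge-flip lemma at `d = 3`, single parallel edge case**: if the two color-0 edges at the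
distinct white vertices `v₁, v₂` are incident to vertices joined by an edge of some color
`c ∈ {1,2,3}`, and the flipped graph is connected, then `C₀(G') ≥ C₀(G) − 1`. -/
theorem flip_single_parallel_edge {n : ℕ} (σ : Fin 4 → Equiv.Perm (Fin n))
    (hconn : ColoredConnected σ) (v₁ v₂ : Fin n) (hne : v₁ ≠ v₂)
    (hc : ∃ c ∈ ({1, 2, 3} : Finset (Fin 4)), σ c v₁ = σ 0 v₂ ∨ σ c v₂ = σ 0 v₁)
    (hconn' : ColoredConnected (Function.update σ 0 (σ 0 * Equiv.swap v₁ v₂))) :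
    C0 (Function.update σ 0 (σ 0 * Equiv.swap v₁ v₂)) + 1 ≥ C0 σ := by
  have A : ∀ c, numCycles ((σ c)⁻¹ * σ 0) ≤
      numCycles ((σ c)⁻¹ * (σ 0 * Equiv.swap v₁ v₂)) + 1 := fun c => by
    rw [← mul_assoc]; exact numCycles_le_flip _ _ _
  have B : ∀ c, (σ c v₁ = σ 0 v₂ ∨ σ c v₂ = σ 0 v₁) → numCycles ((σ c)⁻¹ * σ 0) + 1 ≤
      numCycles ((σ c)⁻¹ * (σ 0 * Equiv.swap v₁ v₂)) := fun c h => by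
    rw [← mul_assoc]
    rcases h with h | h
    · exact numCycles_flip_split _ _ _ hne (by rw [Equiv.Perm.mul_apply, ← h]; simp)
    · rw [Equiv.swap_comm]
      exact numCycles_flip_split _ _ _ hne.symm (by rw [Equiv.Perm.mul_apply, ← h]; simp)
  obtain ⟨c, hc, h⟩ := hc
  have h0 := B c h
  have h1 := A 1
  have h2 := A 2
  have h3 := A 3
  have e1 : (1 : Fin 4) ≠ 0 := by decide
  have e2 : (2 : Fin 4) ≠ 0 := by decide
  have e3 : (3 : Fin 4) ≠ 0 := by decide
  simp only [C0, Function.update_self, Function.update_of_ne e1, Function.update_of_ne e2,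
    Function.update_of_ne e3]
  simp only [Finset.mem_insert, Finset.mem_singleton] at hc
  rcases hc with rfl | rfl | rfl <;> omega
end

section
/- Edge-flip lemma at d = 3, 2-dipole case: Let G = (σ_0, σ_1, σ_2, σ_3) be a connected colored graph on 2n vertices, and let v_1 ≠ v_2 be white vertices such that for two distinct colors c ≠ c' in {1,2,3} one has σ_c v_1 = σ_0 v_2 and σ_{c'} v_1 = σ_0 v_2 (the two color-0 edges at v_1 and v_2 are incident to two vertices joined by two parallel edges, a 2-dipole). If the flipped graph G' = (σ_0 ∘ swap(v_1, v_2), σ_1, σ_2, σ_3) is connected, then C_0(G') ≥ C_0(G) + 1. -/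
theorem inv_sameCycle {α β : Type*} (π : Equiv.Perm α) (f : α → β)
    (hf : ∀ x, f (π x) = f x) {x y : α} (h : π.SameCycle x y) : f x = f y := by
  obtain ⟨k, rfl⟩ := h
  induction k using Int.induction_on with
  | zero => simp
  | succ k ih => rw [add_comm, zpow_add, zpow_one, Equiv.Perm.mul_apply, hf, ih]
  | pred k ih =>
    rw [ih, ← hf ((π ^ (-(k : ℤ) - 1)) x), ← Equiv.Perm.mul_apply]
    congr 2
    rw [← zpow_one_add]
    congr 1
    ring

theorem permSetoid_apply {α : Type*} (π : Equiv.Perm α) (x : α) :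
    Quotient.mk (permSetoid π) (π x) = Quotient.mk (permSetoid π) x :=
  Quotient.sound (s := permSetoid π) (show π.SameCycle (π x) x from ⟨-1, by simp⟩)

theorem numCycles_swap_ge {α : Type*} [Finite α] [DecidableEq α] (π : Equiv.Perm α) (a b : α) :
    numCycles π ≤ numCycles (π * Equiv.swap a b) + 1 := by
  classical
  let q : α → Quotient (permSetoid π) := Quotient.mk (permSetoid π)
  let f : α → Quotient (permSetoid π) := fun x => if q x = q b then q a else q x
  have hq : ∀ x, q (π x) = q x := permSetoid_apply π
  have hab : f a = f b := by simp [f]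
  have hf : ∀ x, f ((π * Equiv.swap a b) x) = f x := by
    intro x
    have h1 : ∀ y, f (π y) = f y := fun y => by simp only [f, hq]
    rw [Equiv.Perm.mul_apply, h1]
    rcases eq_or_ne x a with rfl | h
    · rw [Equiv.swap_apply_left, hab]
    rcases eq_or_ne x b with rfl | h'
    · rw [Equiv.swap_apply_right, hab]
    rw [Equiv.swap_apply_of_ne_of_ne h h']
  let F : Option (Quotient (permSetoid (π * Equiv.swap a b))) → Quotient (permSetoid π) :=
    fun o => o.elim (q b) (fun z => Quotient.lift f (fun _ _ h => inv_sameCycle _ f hf h) z)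
  have hF : Function.Surjective F := by
    intro z
    induction z using Quotient.inductionOn with
    | h x =>
      by_cases hx : q x = q b
      · exact ⟨none, hx.symm⟩
      · refine ⟨some (Quotient.mk _ x), ?_⟩
        change f x = q x
        simp [f, hx]
  have := Nat.card_le_card_of_surjective F hF
  rwa [Finite.card_option] at this

theorem numCycles_swap_fixed {α : Type*} [Finite α] [DecidableEq α] (π : Equiv.Perm α) (a b : α)
    (hab : a ≠ b) (hπ : π b = a) :
    numCycles π + 1 ≤ numCycles (π * Equiv.swap a b) := by
  classical
  let q : α → Quotient (permSetoid π) := Quotient.mk (permSetoid π)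
  let f : α → Option (Quotient (permSetoid π)) := fun x => if x = a then none else some (q x)
  have hq : ∀ x, q (π x) = q x := permSetoid_apply π
  have hqab : q a = q b := by rw [← hπ, hq]
  have hf : ∀ x, f ((π * Equiv.swap a b) x) = f x := by
    intro x
    rw [Equiv.Perm.mul_apply]
    rcases eq_or_ne x a with rfl | h
    · rw [Equiv.swap_apply_left, hπ]
    have h2 : ∀ y, y ≠ b → π y ≠ a := fun y hy h => hy (π.injective (h.trans hπ.symm))
    rcases eq_or_ne x b with rfl | h'
    · rw [Equiv.swap_apply_right]
      simp only [f, h, h2 a hab, if_false, hq, hqab]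
    rw [Equiv.swap_apply_of_ne_of_ne h h']
    simp only [f, h, h2 x h', if_false, hq]
  let F : Quotient (permSetoid (π * Equiv.swap a b)) → Option (Quotient (permSetoid π)) :=
    fun z => Quotient.lift f (fun _ _ h => inv_sameCycle _ f hf h) z
  have hF : Function.Surjective F := by
    rintro (_ | z)
    · refine ⟨Quotient.mk _ a, ?_⟩
      change f a = none
      simp [f]
    · induction z using Quotient.inductionOn with
      | h x =>
        by_cases hx : x = a
        · refine ⟨Quotient.mk _ b, ?_⟩
          change f b = some (q x)
          simp only [f, hab.symm, if_false, hx, hqab]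
        · refine ⟨Quotient.mk _ x, ?_⟩
          change f x = some (q x)
          simp only [f, hx, if_false]
  have := Nat.card_le_card_of_surjective F hF
  rwa [Finite.card_option] at this

/-- **Edge-flip lemma at `d = 3`, 2-dipole case**: if the two color-0 edges at the distinct
white vertices `v₁, v₂` are incident to two vertices joined by two parallel edges of distinct
colors `c ≠ c'` in `{1,2,3}` (a 2-dipole), and the flipped graph is connected, then
`C₀(G') ≥ C₀(G) + 1`. -/
theorem flip_two_dipole {n : ℕ} (σ : Fin 4 → Equiv.Perm (Fin n))
    (hconn : ColoredConnected σ) (v₁ v₂ : Fin n) (hne : v₁ ≠ v₂)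
    (hc : ∃ c ∈ ({1, 2, 3} : Finset (Fin 4)), ∃ c' ∈ ({1, 2, 3} : Finset (Fin 4)),
      c ≠ c' ∧ σ c v₁ = σ 0 v₂ ∧ σ c' v₁ = σ 0 v₂)
    (hconn' : ColoredConnected (Function.update σ 0 (σ 0 * Equiv.swap v₁ v₂))) :
    C0 (Function.update σ 0 (σ 0 * Equiv.swap v₁ v₂)) ≥ C0 σ + 1 := by
  have hB := fun c => numCycles_swap_ge ((σ c)⁻¹ * σ 0) v₁ v₂
  have hA : ∀ c, σ c v₁ = σ 0 v₂ → _ := fun c h =>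
    numCycles_swap_fixed ((σ c)⁻¹ * σ 0) v₁ v₂ hne
      (by rw [Equiv.Perm.mul_apply, ← h]; simp)
  have e : ∀ c : Fin 4, c ≠ 0 → Function.update σ 0 (σ 0 * Equiv.swap v₁ v₂) c = σ c :=
    fun c h => Function.update_of_ne h _ _
  unfold C0
  rw [e 1 (by decide), e 2 (by decide), e 3 (by decide), Function.update_self]
  simp only [← mul_assoc]
  have b1 := hB 1
  have b2 := hB 2
  have b3 := hB 3
  obtain ⟨c, hc1, c', hc2, hcc, h1, h2⟩ := hc
  have a1 := hA c h1
  have a2 := hA c' h2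
  simp only [Finset.mem_insert, Finset.mem_singleton] at hc1 hc2
  rcases hc1 with rfl | rfl | rfl <;> rcases hc2 with rfl | rfl | rfl <;>
    first
    | exact absurd rfl hcc
    | omega
end

section
/- Planar bubbles without digons have at least six faces of degree 4: Let (σ_1, σ_2, σ_3) be a connected bubble on 2n vertices which is planar, i.e. C_{12} + C_{13} + C_{23} = n + 2 where C_{ab} is the number of orbits of σ_a⁻¹ * σ_b on Fin n. Suppose none of the permutations σ_1⁻¹σ_2, σ_1⁻¹σ_3, σ_2⁻¹σ_3 has a fixed point (the bubble has no bicolored cycle of length 2). Then the total number of orbits of cardinality 2 of these three permutations is at least 6 (the bubble has at least six bicolored cycles of length 4). -/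
/-- The number of orbits of cardinality `k` of a permutation. -/
noncomputable def orbitsOfCard {α : Type*} (π : Equiv.Perm α) (k : ℕ) : ℕ :=
  Nat.card {q : Quotient (permSetoid π) //
    Nat.card {x : α // Quotient.mk (permSetoid π) x = q} = k}

/-- Connectivity of the bubble `(σ 0, σ 1, σ 2)` with three colors. -/
def BubbleConnected {n : ℕ} (σ : Fin 3 → Equiv.Perm (Fin n)) : Prop :=
  ∀ x y : Fin n,
    ∃ g ∈ Subgroup.closure {g : Equiv.Perm (Fin n) | ∃ a b : Fin 3, g = (σ a)⁻¹ * σ b},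
      g x = y

/-- Without fixed points every orbit has at least two elements, so three times the number of
orbits is at most the number of points plus the number of orbits of size two. -/
theorem three_mul_numCycles_le {n : ℕ} (π : Equiv.Perm (Fin n)) (h : ∀ x, π x ≠ x) :
    3 * numCycles π ≤ n + orbitsOfCard π 2 := by
  classical
  have key : ∀ q : Quotient (permSetoid π),
      3 ≤ Nat.card {x : Fin n // Quotient.mk (permSetoid π) x = q} +
        (if Nat.card {x : Fin n // Quotient.mk (permSetoid π) x = q} = 2 then 1 else 0) := by
    intro q
    have h2 : 1 < Nat.card {x : Fin n // Quotient.mk (permSetoid π) x = q} := by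
      induction q using Quotient.inductionOn with
      | h x =>
        rw [Finite.one_lt_card_iff_nontrivial]
        refine ⟨⟨x, rfl⟩, ⟨π x, Quotient.sound ?_⟩, ?_⟩
        · exact (⟨-1, by simp⟩ : π.SameCycle (π x) x)
        · intro e
          exact h x (congrArg Subtype.val e).symm
    split_ifs <;> omega
  have hn : ∑ q : Quotient (permSetoid π),
      Nat.card {x : Fin n // Quotient.mk (permSetoid π) x = q} = n := by
    rw [← Nat.card_sigma, Nat.card_congr (Equiv.sigmaFiberEquiv (Quotient.mk (permSetoid π)))]
    simp
  have ho : orbitsOfCard π 2 = ∑ q : Quotient (permSetoid π),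
      (if Nat.card {x : Fin n // Quotient.mk (permSetoid π) x = q} = 2 then 1 else 0) := by
    rw [orbitsOfCard, Nat.card_eq_fintype_card, Fintype.card_subtype, Finset.card_filter]
  have hs := Finset.sum_le_sum (fun q (_ : q ∈ Finset.univ) => key q)
  rw [Finset.sum_add_distrib, hn, ← ho] at hs
  simp only [Finset.sum_const, Finset.card_univ, smul_eq_mul] at hs
  rw [numCycles, Nat.card_eq_fintype_card]
  omega

/-- **Planar bubbles without digons have at least six faces of degree 4**: a connected planar
bubble (i.e. `C₁₂ + C₁₃ + C₂₃ = n + 2`) none of whose three bicolored permutations has a fixed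
point (no bicolored cycle of length 2) has at least six bicolored cycles of length 4, i.e. the
three bicolored permutations have at least six orbits of cardinality 2 in total. -/
theorem planar_bubble_has_degree_four_faces {n : ℕ}
    (σ : Fin 3 → Equiv.Perm (Fin n)) (hconn : BubbleConnected σ)
    (hplanar : numCycles ((σ 0)⁻¹ * σ 1) + numCycles ((σ 0)⁻¹ * σ 2) +
      numCycles ((σ 1)⁻¹ * σ 2) = n + 2)
    (h12 : ∀ x : Fin n, ((σ 0)⁻¹ * σ 1) x ≠ x)
    (h13 : ∀ x : Fin n, ((σ 0)⁻¹ * σ 2) x ≠ x)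
    (h23 : ∀ x : Fin n, ((σ 1)⁻¹ * σ 2) x ≠ x) :
    6 ≤ orbitsOfCard ((σ 0)⁻¹ * σ 1) 2 + orbitsOfCard ((σ 0)⁻¹ * σ 2) 2 +
      orbitsOfCard ((σ 1)⁻¹ * σ 2) 2 := by
  have a := three_mul_numCycles_le _ h12
  have b := three_mul_numCycles_le _ h13
  have c := three_mul_numCycles_le _ h23
  omega
end

section
/- 1-dipole contraction preserves the topology of a bubble: Let (σ_1, σ_2, σ_3) be a connected bubble on 2n vertices with n ≥ 2, let c ∈ {1,2,3} and let {c_1, c_2} = {1,2,3} ∖ {c}. Let v be a white vertex, v̄ := σ_c v, and assume v and σ_{c_1}⁻¹ v̄ lie in different orbits of σ_{c_2}⁻¹ * σ_{c_1} (the two faces of colors {c_1, c_2} incident to v and to v̄ are distinct). Define the contracted bubble B' on 2(n−1) vertices with white set Fin n ∖ {v} and black set Fin n ∖ {v̄} by: σ'_c is the restriction of σ_c, and for i ∈ {1,2}, σ'_{c_i} x = σ_{c_i} x if σ_{c_i} x ≠ v̄ and σ'_{c_i} x = σ_{c_i} v if σ_{c_i} x = v̄. Then B' is a connected bubble and its Euler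 deficiency equals that of B: (n + 2) − (C_{12}(B) + C_{13}(B) + C_{23}(B)) = ((n−1) + 2) − (C_{12}(B') + C_{13}(B') + C_{23}(B')); in particular B is planar if and only if B' is planar. -/
/-- A relation that is an equivalence and contains all steps `z ~ π z` contains `SameCycle`. -/
theorem sameCycle_rel {α : Type*} (π : Equiv.Perm α) (r : α → α → Prop) (hr : Equivalence r)
    (h : ∀ z, r (π z) z) {x y : α} (hxy : π.SameCycle x y) : r x y := by
  obtain ⟨k, rfl⟩ := hxy
  apply hr.symm
  induction k using Int.induction_on with
  | zero => exact hr.refl _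
  | succ k ih =>
    rw [add_comm, zpow_add, zpow_one, Equiv.Perm.mul_apply]
    exact hr.trans (h _) ih
  | pred k ih =>
    have h1 := h ((π ^ (-(k : ℤ) - 1)) x)
    rw [← Equiv.Perm.mul_apply, ← zpow_one_add] at h1
    have h2 : (1 + (-(k : ℤ) - 1)) = -k := by ring
    rw [h2] at h1
    exact hr.trans (hr.symm h1) ih

theorem sameCycle_equivalence {α : Type*} (π : Equiv.Perm α) : Equivalence π.SameCycle :=
  ⟨fun _ => ⟨0, by simp⟩, fun h => h.symm, fun h h' => h.trans h'⟩

theorem sameCycle_step {α : Type*} (π : Equiv.Perm α) (x : α) : π.SameCycle (π x) x :=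
  ⟨-1, by simp⟩

/-- Removing a non-fixed point from a permutation does not change the cycle relation. -/
theorem removal_sameCycle {α : Type*} [DecidableEq α] (π : Equiv.Perm α) (v : α) (hv : π v ≠ v)
    (π' : Equiv.Perm {x : α // x ≠ v})
    (h : ∀ x : {x : α // x ≠ v}, (π' x : α) = if π x = v then π v else π x)
    (x y : {x : α // x ≠ v}) : π'.SameCycle x y ↔ π.SameCycle (x : α) y := by
  constructor
  · intro hxy
    refine sameCycle_rel π' (fun a b => π.SameCycle (a : α) b)
      ⟨fun a => (sameCycle_equivalence π).refl _, fun h => h.symm, fun h h' => h.trans h'⟩ ?_ hxy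
    intro z
    change π.SameCycle (π' z : α) z
    rw [h z]
    split_ifs with hz
    · have := (sameCycle_step π (π z)).trans (sameCycle_step π z)
      rwa [hz] at this
    · exact sameCycle_step π z
  · intro hxy
    let f : α → {x : α // x ≠ v} := fun x => if hx : x = v then ⟨π v, hv⟩ else ⟨x, hx⟩
    have hf : ∀ x : {x : α // x ≠ v}, f x = x := fun x => by simp [f, x.2]
    have key := sameCycle_rel π (fun a b => π'.SameCycle (f a) (f b))
      ⟨fun a => (sameCycle_equivalence π').refl _, fun h => h.symm, fun h h' => h.trans h'⟩ ?_ hxy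
    · simpa only [hf] using key
    intro z
    change π'.SameCycle (f (π z)) (f z)
    by_cases hz : z = v
    · subst hz
      have : f (π z) = f z := by simp [f, hv]
      rw [this]
    · have e1 : f (π z) = π' (f z) := by
        apply Subtype.ext
        have e2 : f z = ⟨z, hz⟩ := by simp [f, hz]
        rw [e2, h]
        by_cases hz2 : π z = v <;> simp [f, hz2]
      rw [e1]
      exact sameCycle_step π' _

theorem removal_numCycles {α : Type*} [DecidableEq α] (π : Equiv.Perm α) (v : α) (hv : π v ≠ v)
    (π' : Equiv.Perm {x : α // x ≠ v})
    (h : ∀ x : {x : α // x ≠ v}, (π' x : α) = if π x = v then π v else π x) :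
    numCycles π' = numCycles π := by
  have H := removal_sameCycle π v hv π' h
  let F : Quotient (permSetoid π') → Quotient (permSetoid π) :=
    Quotient.map (fun x => (x : α)) (fun a b hab => (H a b).1 hab)
  apply Nat.card_eq_of_bijective F
  constructor
  · intro p q
    induction p using Quotient.inductionOn with | _ a
    induction q using Quotient.inductionOn with | _ b
    intro hab
    exact Quotient.sound ((H a b).2 (Quotient.exact hab))
  · intro p
    induction p using Quotient.inductionOn with | _ a
    by_cases ha : a = v
    · refine ⟨Quotient.mk _ ⟨π v, hv⟩, ?_⟩
      subst ha
      exact Quotient.sound (sameCycle_step π a)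
    · exact ⟨Quotient.mk _ ⟨a, ha⟩, rfl⟩

/-- Multiplying by a transposition joining distinct cycles: the new relation contains the old. -/
theorem merge_sameCycle {α : Type*} [DecidableEq α] [Finite α] (π : Equiv.Perm α) (a v : α)
    (hav : ¬ π.SameCycle a v) :
    (π * Equiv.swap a v).SameCycle a v ∧
      ∀ x y, π.SameCycle x y → (π * Equiv.swap a v).SameCycle x y := by
  set π' := π * Equiv.swap a v with hπ'
  have h1 : π' a = π v := by simp [hπ']
  have h2 : π' v = π a := by simp [hπ']
  have h3 : ∀ x, x ≠ a → x ≠ v → π' x = π x := fun x hx hy => by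
    simp [hπ', Equiv.swap_apply_of_ne_of_ne hx hy]
  have claim : ∀ k : ℕ, π'.SameCycle ((π⁻¹ ^ k) v) v := by
    intro k
    induction k with
    | zero => exact (sameCycle_equivalence π').refl _
    | succ k ih =>
      set y := (π⁻¹ ^ (k + 1)) v with hy
      have hy2 : π y = (π⁻¹ ^ k) v := by
        rw [hy, pow_succ', Equiv.Perm.mul_apply]; simp
      by_cases hyv : y = v
      · rw [hyv]
      · have hya : y ≠ a := by
          intro hya
          apply hav
          have : π⁻¹.SameCycle v a := ⟨(k + 1 : ℕ), by rw [zpow_natCast, ← hy, hya]⟩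
          exact (Equiv.Perm.sameCycle_inv.1 this).symm
        have := sameCycle_step π' y
        rw [h3 y hya hyv, hy2] at this
        exact this.symm.trans ih
  have main : π'.SameCycle a v := by
    have : π⁻¹.SameCycle v (π v) :=
      Equiv.Perm.sameCycle_inv.2 (sameCycle_step π v).symm
    obtain ⟨k, hk⟩ := this.exists_nat_pow_eq
    have hc := claim k
    rw [hk, ← h1] at hc
    exact (sameCycle_step π' a).symm.trans hc
  refine ⟨main, fun x y hxy => ?_⟩
  refine sameCycle_rel π _ (sameCycle_equivalence π') ?_ hxy
  intro z
  by_cases hza : z = a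
  · subst hza
    rw [← h2]
    exact (sameCycle_step π' v).trans main.symm
  by_cases hzv : z = v
  · subst hzv
    rw [← h1]
    exact (sameCycle_step π' a).trans main
  rw [← h3 z hza hzv]
  exact sameCycle_step π' z

theorem merge_numCycles {α : Type*} [DecidableEq α] [Finite α] (π : Equiv.Perm α) (a v : α)
    (hav : ¬ π.SameCycle a v) :
    numCycles (π * Equiv.swap a v) + 1 = numCycles π := by
  classical
  obtain ⟨main, H⟩ := merge_sameCycle π a v hav
  set π' := π * Equiv.swap a v with hπ'
  have h1 : π' a = π v := by simp [hπ']
  have h2 : π' v = π a := by simp [hπ']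
  have h3 : ∀ x, x ≠ a → x ≠ v → π' x = π x := fun x hx hy => by
    simp [hπ', Equiv.swap_apply_of_ne_of_ne hx hy]
  let Q : α → Quotient (permSetoid π) := fun x => Quotient.mk _ x
  let F : Quotient (permSetoid π) → Quotient (permSetoid π') :=
    Quotient.map (fun x => x) (fun a b hab => H a b hab)
  let f : Quotient (permSetoid π) → Quotient (permSetoid π) := fun q => if q = Q v then Q a else q
  have hQ : ∀ x, Q (π x) = Q x := fun x => Quotient.sound (sameCycle_step π x)
  have hstep : ∀ x y, π'.SameCycle x y → f (Q x) = f (Q y) := by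
    intro x y hxy
    refine sameCycle_rel π' (fun x y => f (Q x) = f (Q y))
      ⟨fun _ => rfl, fun h => h.symm, fun h h' => h.trans h'⟩ ?_ hxy
    intro z
    change f (Q (π' z)) = f (Q z)
    have hfa : f (Q a) = Q a := by simp [f]
    have hfv : f (Q v) = Q a := by simp [f]
    by_cases hza : z = a
    · rw [hza, h1, hQ, hfa, hfv]
    by_cases hzv : z = v
    · rw [hzv, h2, hQ, hfa, hfv]
    rw [h3 z hza hzv, hQ]
  have hbij : Function.Bijective (fun q : {q // q ≠ Q v} => F q) := by
    constructor
    · rintro ⟨p, hp⟩ ⟨q, hq⟩ hpq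
      apply Subtype.ext
      induction p using Quotient.inductionOn with | _ x
      induction q using Quotient.inductionOn with | _ y
      have := hstep x y (Quotient.exact hpq)
      have e1 : f (Q x) = Q x := if_neg hp
      have e2 : f (Q y) = Q y := if_neg hq
      rw [e1, e2] at this
      exact this
    · intro p
      induction p using Quotient.inductionOn with | _ x
      by_cases hx : Q x = Q v
      · refine ⟨⟨Q a, fun h => hav (Quotient.exact h)⟩, ?_⟩
        have hxv : π.SameCycle x v := Quotient.exact hx
        exact Quotient.sound (main.trans (H _ _ hxv).symm)
      · exact ⟨⟨Q x, hx⟩, rfl⟩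
  have hc := Nat.card_eq_of_bijective _ hbij
  unfold numCycles
  rw [← hc]
  have : Fintype (Quotient (permSetoid π)) := Fintype.ofFinite _
  have hpos : 0 < Fintype.card (Quotient (permSetoid π)) := Fintype.card_pos_iff.2 ⟨Q v⟩
  rw [Nat.card_eq_fintype_card, Nat.card_eq_fintype_card, Fintype.card_subtype_compl,
    Fintype.card_subtype_eq]
  omega

theorem fin3_cases : ∀ c c₁ c₂ d : Fin 3, c ≠ c₁ → c ≠ c₂ → c₁ ≠ c₂ → d = c ∨ d = c₁ ∨ d = c₂ := by
  decide

/-- **1-dipole contraction preserves the topology of a bubble**: let `B` be a connected bubble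
on `2n` vertices, `v` a white vertex, `vb := σ c v`, and assume `v` and `(σ c₁)⁻¹ vb` lie in
different bicolored cycles of colors `{c₁, c₂}` (distinct incident faces). The contracted
bubble `B'` on white set `{x ≠ v}` and black set `{y ≠ vb}` — given by equivs `e a`
restricting `σ c` and redirecting `σ c₁, σ c₂` through the contracted pair — is a connected
bubble with the same Euler deficiency as `B`; in particular `B` is planar iff `B'` is planar. -/
theorem one_dipole_contraction {n : ℕ} (hn : 2 ≤ n)
    (σ : Fin 3 → Equiv.Perm (Fin n)) (hconn : BubbleConnected σ)
    (c c₁ c₂ : Fin 3) (hcc1 : c ≠ c₁) (hcc2 : c ≠ c₂) (hc12 : c₁ ≠ c₂)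
    (v vb : Fin n) (hvb : vb = σ c v)
    (hfaces : ¬ ((σ c₂)⁻¹ * σ c₁).SameCycle v ((σ c₁)⁻¹ vb))
    (e : Fin 3 → ({x : Fin n // x ≠ v} ≃ {y : Fin n // y ≠ vb}))
    (hec : ∀ x : {x : Fin n // x ≠ v}, (e c x : Fin n) = σ c (x : Fin n))
    (he1 : ∀ x : {x : Fin n // x ≠ v}, (e c₁ x : Fin n) =
      if σ c₁ (x : Fin n) = vb then σ c₁ v else σ c₁ (x : Fin n))
    (he2 : ∀ x : {x : Fin n // x ≠ v}, (e c₂ x : Fin n) =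
      if σ c₂ (x : Fin n) = vb then σ c₂ v else σ c₂ (x : Fin n)) :
    (∀ x y : {x : Fin n // x ≠ v},
      ∃ g ∈ Subgroup.closure {g : Equiv.Perm {x : Fin n // x ≠ v} |
        ∃ a b : Fin 3, g = (e b).trans (e a).symm}, g x = y) ∧
    ((n : ℤ) + 2) - (numCycles ((σ c)⁻¹ * σ c₁) + numCycles ((σ c)⁻¹ * σ c₂) +
        numCycles ((σ c₁)⁻¹ * σ c₂) : ℕ) =
      (((n : ℤ) - 1) + 2) - (numCycles ((e c₁).trans (e c).symm) +
        numCycles ((e c₂).trans (e c).symm) + numCycles ((e c₂).trans (e c₁).symm) : ℕ) ∧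
    (numCycles ((σ c)⁻¹ * σ c₁) + numCycles ((σ c)⁻¹ * σ c₂) +
        numCycles ((σ c₁)⁻¹ * σ c₂) = n + 2 ↔
      numCycles ((e c₁).trans (e c).symm) + numCycles ((e c₂).trans (e c).symm) +
        numCycles ((e c₂).trans (e c₁).symm) = (n - 1) + 2) := by
  have a1v : (σ c₁)⁻¹ vb ≠ v := fun h => hfaces (by rw [h])
  have a12 : ((σ c₁)⁻¹ * σ c₂) ((σ c₂)⁻¹ vb) = (σ c₁)⁻¹ vb := by simp
  have hf3 : ¬ ((σ c₁)⁻¹ * σ c₂).SameCycle ((σ c₂)⁻¹ vb) v := by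
    intro h
    apply hfaces
    have h' := (sameCycle_step ((σ c₁)⁻¹ * σ c₂) ((σ c₂)⁻¹ vb)).trans h
    rw [a12] at h'
    have e0 : (σ c₂)⁻¹ * σ c₁ = ((σ c₁)⁻¹ * σ c₂)⁻¹ := by simp
    rw [e0]
    exact Equiv.Perm.sameCycle_inv.2 h'.symm
  have a2v : (σ c₂)⁻¹ vb ≠ v := fun h => hf3 (by rw [h])
  set a1 := (σ c₁)⁻¹ vb with ha1
  set a2 := (σ c₂)⁻¹ vb with ha2
  have s1 : σ c₁ a1 = vb := by simp [ha1]
  have s2 : σ c₂ a2 = vb := by simp [ha2]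
  have t1 : σ c₁ v ≠ vb := fun h => a1v (by rw [ha1, ← h]; simp)
  have t2 : σ c₂ v ≠ vb := fun h => a2v (by rw [ha2, ← h]; simp)
  -- the first two permutations are obtained by removing `v`
  have rem : ∀ d, σ d v ≠ vb → (∀ x : {x : Fin n // x ≠ v}, (e d x : Fin n) =
      if σ d (x : Fin n) = vb then σ d v else σ d (x : Fin n)) →
      ((σ c)⁻¹ * σ d) v ≠ v ∧ ∀ x : {x : Fin n // x ≠ v}, (((e d).trans (e c).symm) x : Fin n) =
        if ((σ c)⁻¹ * σ d) x = v then ((σ c)⁻¹ * σ d) v else ((σ c)⁻¹ * σ d) x := by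
    intro d hd hed
    have q : ∀ x, ((σ c)⁻¹ * σ d) x = v ↔ σ d x = vb := by
      intro x
      rw [Equiv.Perm.mul_apply, Equiv.Perm.inv_eq_iff_eq, hvb]
    refine ⟨fun h => hd ((q v).1 h), fun x => ?_⟩
    apply (σ c).injective
    rw [← hec]
    simp only [Equiv.trans_apply, Equiv.apply_symm_apply]
    rw [hed]
    simp only [q]
    split_ifs <;> simp
  obtain ⟨n1, r1⟩ := rem c₁ t1 he1
  obtain ⟨n2, r2⟩ := rem c₂ t2 he2
  set ρ := (σ c₁)⁻¹ * σ c₂ with hρ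
  set ρ' := ρ * Equiv.swap a2 v with hρ'
  have p1 : ρ' a2 = ρ v := by simp [hρ']
  have p2 : ρ' v = a1 := by simp [hρ', ← a12]
  have p3 : ∀ x, x ≠ a2 → x ≠ v → ρ' x = ρ x := fun x hx hy => by
    simp [hρ', Equiv.swap_apply_of_ne_of_ne hx hy]
  have sρ : ∀ x, σ c₁ (ρ x) = σ c₂ x := fun x => by simp [hρ]
  have n3 : ρ' v ≠ v := by rw [p2]; exact a1v
  have r3 : ∀ x : {x : Fin n // x ≠ v}, (((e c₂).trans (e c₁).symm) x : Fin n) =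
      if ρ' x = v then ρ' v else ρ' x := by
    intro x
    have hne : (if ρ' x = v then ρ' v else ρ' x) ≠ v := by
      split_ifs with h
      · exact n3
      · exact h
    suffices hs : ((e c₂).trans (e c₁).symm) x = ⟨_, hne⟩ by rw [hs]
    rw [Equiv.trans_apply, Equiv.symm_apply_eq]
    apply Subtype.ext
    rw [he1, he2]
    have hxa : σ c₂ x = vb ↔ (x : Fin n) = a2 := by
      rw [← s2, (σ c₂).injective.eq_iff]
    by_cases hx : (x : Fin n) = a2
    · rw [if_pos (hxa.2 hx)]
      simp only [hx, p1, p2]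
      by_cases hv : ρ v = v
      · simp only [hv, if_true, s1]
        rw [← sρ, hv]
      · simp only [hv, if_false, sρ, if_neg t2]
    · have hx' : σ c₂ x ≠ vb := fun h => hx (hxa.1 h)
      rw [if_neg hx']
      simp only [p3 x hx x.2, p2]
      by_cases hv : ρ x = v
      · simp only [hv, if_true, s1]
        rw [← sρ, hv]
      · simp only [hv, if_false, sρ, if_neg hx']
  have N1 := removal_numCycles _ v n1 _ r1
  have N2 := removal_numCycles _ v n2 _ r2
  have N3 := removal_numCycles _ v n3 _ r3
  have N4 := merge_numCycles ρ a2 v hf3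
  rw [← hρ'] at N4
  refine ⟨?_, by rw [N1, N2, N3]; push_cast; omega, by rw [N1, N2, N3]; omega⟩
  -- connectivity
  set G := Subgroup.closure {g : Equiv.Perm {x : Fin n // x ≠ v} |
        ∃ a b : Fin 3, g = (e b).trans (e a).symm} with hG
  let R : {x : Fin n // x ≠ v} → {x : Fin n // x ≠ v} → Prop := fun x y => ∃ g ∈ G, g x = y
  have hR : Equivalence R := by
    refine ⟨fun x => ⟨1, G.one_mem, rfl⟩, ?_, ?_⟩
    · rintro x y ⟨g, hg, rfl⟩
      exact ⟨g⁻¹, G.inv_mem hg, by simp⟩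
    · rintro x y z ⟨g, hg, rfl⟩ ⟨k, hk, rfl⟩
      exact ⟨k * g, G.mul_mem hk hg, rfl⟩
  have gen : ∀ a b x, R (((e b).trans (e a).symm) x) x := fun a b x =>
    hR.symm ⟨_, Subgroup.subset_closure ⟨a, b, rfl⟩, rfl⟩
  have hRS : ∀ a b x y, Equiv.Perm.SameCycle ((e b).trans (e a).symm) x y → R x y := fun a b x y h =>
    sameCycle_rel _ R hR (gen a b) h
  have R12 : R ⟨a1, a1v⟩ ⟨a2, a2v⟩ := by
    apply hRS c₁ c₂
    rw [removal_sameCycle ρ' v n3 _ r3]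
    apply (merge_sameCycle ρ a2 v hf3).2
    have := sameCycle_step ρ a2
    rwa [a12] at this
  let f : Fin n → {x : Fin n // x ≠ v} := fun x => if hx : x = v then ⟨a1, a1v⟩ else ⟨x, hx⟩
  have hfn : ∀ x (hx : x ≠ v), f x = ⟨x, hx⟩ := fun x hx => by simp [f, hx]
  have hfv : f v = ⟨a1, a1v⟩ := by simp [f]
  have step : ∀ d, ∀ ad (hadv : ad ≠ v), σ d ad = vb → R ⟨a1, a1v⟩ ⟨ad, hadv⟩ →
      ((σ c)⁻¹ * σ d) v ≠ v → (∀ x : {x : Fin n // x ≠ v}, (((e d).trans (e c).symm) x : Fin n) =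
        if ((σ c)⁻¹ * σ d) x = v then ((σ c)⁻¹ * σ d) v else ((σ c)⁻¹ * σ d) x) →
      ∀ x, R (f (((σ c)⁻¹ * σ d) x)) (f x) := by
    intro d ad hadv had hRd hnv hrem x
    have pad : ((σ c)⁻¹ * σ d) ad = v := by
      rw [Equiv.Perm.mul_apply, Equiv.Perm.inv_eq_iff_eq, had, hvb]
    by_cases hx : x = v
    · rw [hx, hfv, hfn _ hnv]
      refine hR.trans ?_ (hR.symm hRd)
      have := gen c d ⟨ad, hadv⟩
      convert this using 1
      apply Subtype.ext
      rw [hrem]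
      simp only [pad, if_true]
    · by_cases hx2 : ((σ c)⁻¹ * σ d) x = v
      · have : x = ad := ((σ c)⁻¹ * σ d).injective (hx2.trans pad.symm)
        rw [hx2, hfv, hfn x hx]
        simpa only [this] using hRd
      · rw [hfn _ hx2, hfn x hx]
        have := gen c d ⟨x, hx⟩
        convert this using 1
        apply Subtype.ext
        rw [hrem]
        simp only [hx2, if_false]
  have stepAll : ∀ d x, R (f (((σ c)⁻¹ * σ d) x)) (f x) := by
    intro d x
    have hd : d = c ∨ d = c₁ ∨ d = c₂ := fin3_cases c c₁ c₂ d hcc1 hcc2 hc12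
    rcases hd with rfl | rfl | rfl
    · simpa using hR.refl (f x)
    · exact step _ a1 a1v s1 (hR.refl _) n1 r1 x
    · exact step _ a2 a2v s2 R12 n2 r2 x
  have all : ∀ g ∈ Subgroup.closure {g : Equiv.Perm (Fin n) | ∃ a b : Fin 3, g = (σ a)⁻¹ * σ b},
      ∀ x, R (f (g x)) (f x) := by
    intro g hg
    induction hg using Subgroup.closure_induction with
    | mem g hg =>
      obtain ⟨a, b, rfl⟩ := hg
      intro x
      have h1 := stepAll a (((σ a)⁻¹ * σ b) x)
      have h2 := stepAll b x
      have h3 : ((σ c)⁻¹ * σ a) (((σ a)⁻¹ * σ b) x) = ((σ c)⁻¹ * σ b) x := by simp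
      rw [h3] at h1
      exact hR.trans (hR.symm h1) h2
    | one => exact fun x => hR.refl _
    | mul g k _ _ hg hk => exact fun x => hR.trans (hg (k x)) (hk x)
    | inv g _ hg =>
      intro x
      have := hg (g⁻¹ x)
      have hgx : g (g⁻¹ x) = x := by simp
      rw [hgx] at this
      exact hR.symm this
  intro x y
  obtain ⟨g, hg, hgx⟩ := hconn x y
  have := all g hg x
  rw [hgx, hfn _ x.2, hfn _ y.2] at this
  exact hR.symm this
end

section
/- Maximal 2-cut property of planar bubbles (main theorem): Let G = (σ_0, σ_1, σ_2, σ_3) be a connected colored graph on 2n vertices (d = 3) that maximizes C_0 among all connected colored graphs (τ_0, σ_1, σ_2, σ_3) with the same bubbles (τ_0 ranging over all permutations of Fin n making the graph connected). Let W ⊆ Fin n be a bubble of G, i.e. an orbit of the subgroup generated by {σ_a⁻¹ * σ_b : 1 ≤ a, b ≤ 3}, with black set BW := σ_1(W) (= σ_2(W) = σ_3(W)), and suppose the restricted bubble B = (σ_1|_W, σ_2|_W, σ_3|_W) is planar, i.e. the number of orbits of σ_a⁻¹σ_b contained in W, summed over the three pairs a < b, equals |W| + 2. Then B ⊆ G satisfies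 the maximal 2-cut property: there exists a bijection π : W ≃ BW maximizing Σ_{c=1}^{3} (number of orbits on W of (σ_c|_W)⁻¹ ∘ π) among all bijections W ≃ BW, such that for every w ∈ W, either σ_0 w = π w, or the two color-0 edges (w, σ_0 w) and (σ_0⁻¹(π w), π w) form a 2-edge-cut of G. -/
/-- The subgroup generated by the bicolored permutations of the colors `1, 2, 3`:
its orbits are the (white vertex sets of the) bubbles of the graph. -/
def bubbleSubgroup {n : ℕ} (σ : Fin 4 → Equiv.Perm (Fin n)) :
    Subgroup (Equiv.Perm (Fin n)) :=
  Subgroup.closure {g : Equiv.Perm (Fin n) | ∃ a b : Fin 4, a ≠ 0 ∧ b ≠ 0 ∧ g = (σ a)⁻¹ * σ b}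

/-- The number of orbits (cycles) of the permutation `π` entirely contained in `W`. -/
noncomputable def orbitsIn {n : ℕ} (π : Equiv.Perm (Fin n)) (W : Set (Fin n)) : ℕ :=
  Nat.card {q : Quotient (permSetoid π) //
    ∀ x : Fin n, Quotient.mk (permSetoid π) x = q → x ∈ W}

/-- An edge of the colored graph `G = (σ 0, …, σ 3)` is encoded as a pair `(i, c)`: the edge of
color `c` joining white `i` to black `σ c i`. `G` minus a set `E` of edges is connected if the
equivalence relation on whites ⊕ blacks generated by the remaining edges has a single class. -/
def minusConnected {n : ℕ} (σ : Fin 4 → Equiv.Perm (Fin n))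
    (E : Set (Fin n × Fin 4)) : Prop :=
  ∀ x y : Fin n ⊕ Fin n,
    Relation.EqvGen
      (fun p q => ∃ (i : Fin n) (c : Fin 4),
        (i, c) ∉ E ∧ p = Sum.inl i ∧ q = Sum.inr (σ c i)) x y

/-- A set `E` of edges of a connected colored graph is an edge-cut if removing it disconnects
the graph while removing any proper subset does not. -/
def IsEdgeCut {n : ℕ} (σ : Fin 4 → Equiv.Perm (Fin n)) (E : Set (Fin n × Fin 4)) : Prop :=
  ¬ minusConnected σ E ∧
    ∀ E' : Set (Fin n × Fin 4), E' ⊂ E → minusConnected σ E'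

/-- The bubble with white set `W` and black set `BW` (with restricted colored permutations
`r i : W ≃ BW`, `i = 0,1,2` standing for the colors `1,2,3`) satisfies the **maximal 2-cut
property** in `G`: there is a pairing `π : W ≃ BW` maximizing the number of bicolored cycles
`Σ_c #orbits((σ_c|_W)⁻¹ ∘ π)` among all pairings, such that each pair `{w, π w}` is either
joined by an edge of color 0 of `G`, or incident to two color-0 edges forming a 2-edge-cut. -/
def MaxTwoCut {n : ℕ} (σ : Fin 4 → Equiv.Perm (Fin n)) (W BW : Set (Fin n))
    (r : Fin 3 → (W ≃ BW)) : Prop :=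
  ∃ π : W ≃ BW,
    (∀ π' : W ≃ BW, (∑ i : Fin 3, numCycles (π'.trans (r i).symm)) ≤
      ∑ i : Fin 3, numCycles (π.trans (r i).symm)) ∧
    ∀ w : W, σ 0 (w : Fin n) = (π w : Fin n) ∨
      ((({((w : Fin n), (0 : Fin 4)), ((σ 0)⁻¹ (π w : Fin n), (0 : Fin 4))} :
          Set (Fin n × Fin 4)).ncard = 2) ∧
        IsEdgeCut σ {((w : Fin n), (0 : Fin 4)), ((σ 0)⁻¹ (π w : Fin n), (0 : Fin 4))})

namespace PB
open Equiv

/-- The relation not separated by any set of the family `I`. -/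
def Rl {V : Type*} (I : Set V → Prop) (x y : V) : Prop := ∀ S, I S → (x ∈ S ↔ y ∈ S)

/-- Number of classes of `Rl I` met by `W`. -/
noncomputable def cls {V : Type*} (I : Set V → Prop) (W : Set V) : ℕ :=
  ((fun x => {y | Rl I x y}) '' W).ncard

/-- A family of sets is good if it contains all the sets saturated for its relation. -/
def Good {V : Type*} (I : Set V → Prop) : Prop :=
  ∀ S, (∀ u v, Rl I u v → (u ∈ S ↔ v ∈ S)) → I S

theorem Rl.refl {V : Type*} (I : Set V → Prop) (x : V) : Rl I x x := fun _ _ => Iff.rfl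
theorem Rl.symm {V : Type*} {I : Set V → Prop} {x y : V} (h : Rl I x y) : Rl I y x :=
  fun S hS => (h S hS).symm
theorem Rl.trans {V : Type*} {I : Set V → Prop} {x y z : V} (h : Rl I x y) (h' : Rl I y z) :
    Rl I x z := fun S hS => (h S hS).trans (h' S hS)

/-- The class of a point. -/
def cl {V : Type*} (I : Set V → Prop) (x : V) : Set V := {y | Rl I x y}

theorem mem_cl {V : Type*} {I : Set V → Prop} {x y : V} : y ∈ cl I x ↔ Rl I x y := Iff.rfl

theorem Good.cl {V : Type*} {I : Set V → Prop} (h : Good I) (x : V) : I (cl I x) :=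
  h _ fun _ _ huv => ⟨fun a => Rl.trans a huv, fun a => Rl.trans a huv.symm⟩

theorem cl_eq_iff {V : Type*} {I : Set V → Prop} {x y : V} : cl I x = cl I y ↔ Rl I x y := by
  constructor
  · intro h
    have : y ∈ cl I x := by rw [h]; exact Rl.refl _ _
    exact this
  · intro h
    ext z
    exact ⟨fun a => h.symm.trans a, fun a => h.trans a⟩

theorem cls_eq {V : Type*} (I : Set V → Prop) (W : Set V) : cls I W = (cl I '' W).ncard := rfl

theorem cls_congr {V : Type*} {I J : Set V → Prop} {W : Set V}
    (h : ∀ x ∈ W, ∀ y, Rl I x y ↔ Rl J x y) : cls I W = cls J W := by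
  rw [cls_eq, cls_eq]
  congr 1
  apply Set.image_congr
  intro x hx
  ext y
  exact h x hx y

theorem cls_congr' {V : Type*} {I J : Set V → Prop} (W : Set V)
    (h : ∀ S, I S ↔ J S) : cls I W = cls J W := by
  have : I = J := by ext S; exact h S
  rw [this]

theorem cls_union {V : Type*} [Finite V] {I : Set V → Prop} {A B : Set V}
    (h : ∀ x ∈ A, ∀ y ∈ B, ¬ Rl I x y) : cls I (A ∪ B) = cls I A + cls I B := by
  rw [cls_eq, cls_eq, cls_eq, Set.image_union, Set.ncard_union_eq _ (Set.toFinite _) (Set.toFinite _)]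
  rw [Set.disjoint_left]
  rintro _ ⟨x, hx, rfl⟩ ⟨y, hy, hxy⟩
  exact h x hx y hy (cl_eq_iff.1 hxy.symm)

theorem cls_singleton {V : Type*} (I : Set V → Prop) (x : V) : cls I {x} = 1 := by
  rw [cls_eq]; simp

theorem cls_pair {V : Type*} {I : Set V → Prop} {x y : V} (h : Rl I x y) : cls I {x, y} = 1 := by
  rw [cls_eq, Set.image_pair, cl_eq_iff.2 h]; simp

theorem cls_pair' {V : Type*} {I : Set V → Prop} {x y : V} (h : ¬ Rl I x y) :
    cls I {x, y} = 2 := by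
  rw [cls_eq, Set.image_pair, Set.ncard_pair]
  exact fun e => h (cl_eq_iff.1 e)

theorem cls_one {V : Type*} {I : Set V → Prop} {W : Set V} {x : V} (hx : x ∈ W)
    (h : ∀ y ∈ W, Rl I x y) : cls I W = 1 := by
  rw [cls_eq, Set.ncard_eq_one]
  refine ⟨cl I x, ?_⟩
  ext C
  constructor
  · rintro ⟨y, hy, rfl⟩
    exact cl_eq_iff.2 (h y hy).symm
  · rintro rfl
    exact ⟨x, hx, rfl⟩

/-- Merging two classes decreases the number of classes by one. -/
theorem cls_merge {V : Type*} [Finite V] {I J : Set V → Prop} {W : Set V} {x y : V}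
    (hx : x ∈ W) (hy : y ∈ W) (hJ : Good J) (h : ∀ S, I S ↔ J S ∧ (x ∈ S ↔ y ∈ S))
    (hxy : ¬ Rl J x y) : cls J W = cls I W + 1 := by
  classical
  have key : ∀ u, cl I u = if Rl J x u ∨ Rl J y u then cl J x ∪ cl J y else cl J u := by
    intro u
    have hIJ : ∀ {a b}, Rl J a b → Rl I a b := fun hab S hS => hab S ((h S).1 hS).1
    have hIxy : Rl I x y := fun S hS => ((h S).1 hS).2
    have hun : I (cl J x ∪ cl J y) := by
      rw [h]
      refine ⟨hJ _ ?_, ?_⟩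
      · intro a b hab
        constructor
        · rintro (ha | ha)
          · exact Or.inl (Rl.trans ha hab)
          · exact Or.inr (Rl.trans ha hab)
        · rintro (ha | ha)
          · exact Or.inl (Rl.trans ha hab.symm)
          · exact Or.inr (Rl.trans ha hab.symm)
      · exact ⟨fun _ => Or.inr (Rl.refl _ _), fun _ => Or.inl (Rl.refl _ _)⟩
    split_ifs with hu
    · ext v
      constructor
      · intro hv
        exact (hv _ hun).1 hu
      · intro hv
        have h1 : ∀ w, (Rl J x w ∨ Rl J y w) → Rl I x w := by
          rintro w (hw | hw)
          · exact hIJ hw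
          · exact hIxy.trans (hIJ hw)
        exact (h1 u hu).symm.trans (h1 v hv)
    · ext v
      constructor
      · intro hv
        have hI : I (cl J u) := by
          rw [h]
          refine ⟨hJ.cl u, ?_⟩
          constructor
          · intro hh; exact absurd (Or.inl (Rl.symm hh)) hu
          · intro hh; exact absurd (Or.inr (Rl.symm hh)) hu
        exact (hv _ hI).1 (Rl.refl _ _)
      · intro hv; exact hIJ hv
  set g : Set V → Set V := fun C => if C = cl J x ∨ C = cl J y then cl J x ∪ cl J y else C with hg
  have hIg : ∀ u, cl I u = g (cl J u) := by
    intro u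
    rw [key u, hg]
    simp only [cl_eq_iff]
    have e1 : Rl J u x ↔ Rl J x u := ⟨Rl.symm, Rl.symm⟩
    have e2 : Rl J u y ↔ Rl J y u := ⟨Rl.symm, Rl.symm⟩
    rw [e1, e2]
  have himg : cl I '' W = g '' (cl J '' W \ {cl J y}) := by
    ext C
    constructor
    · rintro ⟨u, hu, rfl⟩
      by_cases hc : cl J u = cl J y
      · refine ⟨cl J x, ⟨⟨x, hx, rfl⟩, ?_⟩, ?_⟩
        · simp only [Set.mem_singleton_iff, cl_eq_iff]; exact hxy
        · rw [hIg u, hc, hg]; simp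
      · exact ⟨cl J u, ⟨⟨u, hu, rfl⟩, hc⟩, (hIg u).symm⟩
    · rintro ⟨_, ⟨⟨u, hu, rfl⟩, _⟩, rfl⟩
      exact ⟨u, hu, hIg u⟩
  have hinj : Set.InjOn g (cl J '' W \ {cl J y}) := by
    rintro _ ⟨⟨u, hu, rfl⟩, huy⟩ _ ⟨⟨v, hv, rfl⟩, hvy⟩ huv
    have huy' : ¬ Rl J u y := fun e => huy (cl_eq_iff.2 e)
    have hvy' : ¬ Rl J v y := fun e => hvy (cl_eq_iff.2 e)
    simp only [hg, cl_eq_iff, huy', hvy', or_false] at huv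
    split_ifs at huv with h1 h2 h2
    · exact cl_eq_iff.2 (h1.trans h2.symm)
    · have : y ∈ cl J v := by rw [← huv]; exact Or.inr (Rl.refl _ _)
      exact absurd this hvy'
    · have : y ∈ cl J u := by rw [huv]; exact Or.inr (Rl.refl _ _)
      exact absurd this huy'
    · exact huv
  rw [cls_eq, cls_eq, himg, hinj.ncard_image]
  have hmem : cl J y ∈ cl J '' W := ⟨y, hy, rfl⟩
  rw [Set.ncard_sdiff_singleton_add_one hmem (Set.toFinite _)]

/-- invariant sets of a permutation -/
def I1 {V : Type*} (ρ : Perm V) (S : Set V) : Prop := ∀ z, ρ z ∈ S ↔ z ∈ S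

/-- same cycle -/
abbrev sc {V : Type*} (ρ : Perm V) (x y : V) : Prop := Rl (I1 ρ) x y

/-- number of cycles met by `W` -/
noncomputable abbrev cyc {V : Type*} (ρ : Perm V) (W : Set V) : ℕ := cls (I1 ρ) W

theorem sc_apply {V : Type*} (ρ : Perm V) (x : V) : sc ρ x (ρ x) := fun _ hS => (hS x).symm

theorem sc_of_eq {V : Type*} {ρ : Perm V} {x y : V} (h : ρ x = y) : sc ρ x y := h ▸ sc_apply ρ x

theorem good_I1 {V : Type*} (ρ : Perm V) : Good (I1 ρ) := fun _ h z => (h _ _ (sc_apply ρ z)).symm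

theorem mem_of_maps {V : Type*} [Finite V] {ρ : Perm V} {S : Set V}
    (h : ∀ z ∈ S, ρ z ∈ S) : I1 ρ S := by
  intro z
  refine ⟨fun hz => ?_, h z⟩
  have himg : ρ '' S = S := by
    apply Set.eq_of_subset_of_ncard_le
    · rintro _ ⟨z, hz, rfl⟩; exact h z hz
    · rw [Set.ncard_image_of_injective _ ρ.injective]
    · exact Set.toFinite _
  rw [← himg] at hz
  obtain ⟨t, ht, e⟩ := hz
  rw [← ρ.injective e]; exact ht

theorem sc_sameCycle {V : Type*} [Finite V] {ρ : Perm V} {x y : V} :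
    sc ρ x y ↔ ρ.SameCycle x y := by
  constructor
  · intro h
    have hS : I1 ρ {z | ρ.SameCycle x z} := by
      intro z; exact Perm.sameCycle_apply_right
    exact (h _ hS).1 (Perm.SameCycle.refl _ _)
  · intro h S hS
    obtain ⟨k, rfl⟩ := h.exists_nat_pow_eq
    clear h
    induction k with
    | zero => simp
    | succ k ih => rw [ih, pow_succ', Perm.mul_apply]; exact (hS _).symm

theorem swap_mem {V : Type*} [DecidableEq V] {x y : V} {S : Set V} (h : x ∈ S ↔ y ∈ S) (z : V) :
    swap x y z ∈ S ↔ z ∈ S := by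
  rw [swap_apply_def]; split_ifs with h1 h2
  · rw [h1, h]
  · rw [h2, h]
  · rfl

theorem I1_mul_swap {V : Type*} [DecidableEq V] {ρ : Perm V} {x y : V} {S : Set V}
    (h : x ∈ S ↔ y ∈ S) : I1 (ρ * swap x y) S ↔ I1 ρ S := by
  constructor
  · intro hS z
    have := hS (swap x y z)
    rw [Perm.mul_apply, swap_apply_self, swap_mem h] at this
    exact this
  · intro hS z
    rw [Perm.mul_apply, hS, swap_mem h]

theorem sc_swap_of_not {V : Type*} [Finite V] [DecidableEq V] {ρ : Perm V} {x y : V}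
    (h : ¬ sc ρ x y) : sc (ρ * swap x y) x y := by
  by_contra hn
  set ρ' := ρ * swap x y with hρ'
  have hT : I1 ρ (cl (I1 ρ') x ∩ cl (I1 ρ) y) := by
    apply mem_of_maps
    rintro z ⟨hz1, hz2⟩
    have hzx : z ≠ x := by rintro rfl; exact h (Rl.symm hz2)
    have hzy : z ≠ y := by rintro rfl; exact hn hz1
    refine ⟨?_, Rl.trans hz2 (sc_apply _ _)⟩
    have : ρ z = ρ' z := by rw [hρ', Perm.mul_apply, swap_apply_of_ne_of_ne hzx hzy]
    rw [this]
    exact Rl.trans hz1 (sc_apply _ _)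
  have h1 : ρ y ∈ cl (I1 ρ') x ∩ cl (I1 ρ) y := by
    refine ⟨?_, sc_apply _ _⟩
    have : ρ y = ρ' x := by rw [hρ', Perm.mul_apply, swap_apply_left]
    rw [this]; exact sc_apply _ _
  exact hn ((hT y).1 h1).1

theorem not_sc_swap {V : Type*} [Finite V] [DecidableEq V] {ρ : Perm V} {x y : V} (hxy : x ≠ y)
    (h : sc ρ x y) : ¬ sc (ρ * swap x y) x y := by
  classical
  have hex : ∃ k : ℕ, (ρ ^ k) x = y := (sc_sameCycle.1 h).exists_nat_pow_eq
  set K := Nat.find hex with hK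
  have hKy : (ρ ^ K) x = y := Nat.find_spec hex
  have hmin : ∀ m < K, (ρ ^ m) x ≠ y := fun m hm => Nat.find_min hex hm
  have hK0 : 0 < K := by
    rcases Nat.eq_zero_or_pos K with h0 | h0
    · rw [h0] at hKy; exact absurd hKy (by simpa using hxy)
    · exact h0
  have hnx : ∀ m, 0 < m → m ≤ K → (ρ ^ m) x ≠ x := by
    intro m hm hmK e
    apply hmin (K - m) (by omega)
    have : (ρ ^ (K - m)) ((ρ ^ m) x) = y := by
      rw [← Perm.mul_apply, ← pow_add, Nat.sub_add_cancel hmK, hKy]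
    rwa [e] at this
  intro hs
  have hS : I1 (ρ * swap x y) {z | ∃ m, 0 < m ∧ m ≤ K ∧ (ρ ^ m) x = z} := by
    apply mem_of_maps
    rintro z ⟨m, hm, hmK, rfl⟩
    rcases eq_or_lt_of_le hmK with e | hlt
    · subst e
      refine ⟨1, one_pos, hK0, ?_⟩
      rw [hKy, Perm.mul_apply, swap_apply_right, pow_one]
    · refine ⟨m + 1, by omega, hlt, ?_⟩
      rw [Perm.mul_apply, swap_apply_of_ne_of_ne (hnx m hm hmK) (hmin m hlt), pow_succ',
        Perm.mul_apply]
  obtain ⟨m, hm, hmK, e⟩ := (hs _ hS).2 ⟨K, hK0, le_rfl, hKy⟩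
  exact hnx m hm hmK e

theorem sc_swap_iff {V : Type*} [Finite V] [DecidableEq V] {ρ : Perm V} {x y : V} (hxy : x ≠ y) :
    sc (ρ * swap x y) x y ↔ ¬ sc ρ x y :=
  ⟨fun h h' => not_sc_swap hxy h' h, sc_swap_of_not⟩

theorem cyc_swap_not {V : Type*} [Finite V] [DecidableEq V] {ρ : Perm V} {x y : V} {W : Set V}
    (hx : x ∈ W) (hy : y ∈ W) (h : ¬ sc ρ x y) :
    cyc ρ W = cyc (ρ * swap x y) W + 1 := by
  refine cls_merge hx hy (good_I1 ρ) ?_ h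
  intro S
  have hs := sc_swap_of_not h
  constructor
  · intro hS
    have hxy := hs S hS
    exact ⟨(I1_mul_swap hxy).1 hS, hxy⟩
  · rintro ⟨hS, hxy⟩
    exact (I1_mul_swap hxy).2 hS

theorem cyc_swap {V : Type*} [Finite V] [DecidableEq V] {ρ : Perm V} {x y : V} {W : Set V}
    (hxy : x ≠ y) (hx : x ∈ W) (hy : y ∈ W) (h : sc ρ x y) :
    cyc (ρ * swap x y) W = cyc ρ W + 1 := by
  have := cyc_swap_not hx hy (not_sc_swap hxy h)
  rwa [mul_assoc, swap_mul_self, mul_one] at this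

theorem cyc_swap_le {V : Type*} [Finite V] [DecidableEq V] {ρ : Perm V} {x y : V} {W : Set V}
    (hxy : x ≠ y) (hx : x ∈ W) (hy : y ∈ W) :
    cyc ρ W ≤ cyc (ρ * swap x y) W + 1 := by
  by_cases h : sc ρ x y
  · rw [cyc_swap hxy hx hy h]; omega
  · rw [cyc_swap_not hx hy h]

theorem sc_inv {V : Type*} {ρ : Perm V} {x y : V} : sc ρ⁻¹ x y ↔ sc ρ x y := by
  have : I1 ρ⁻¹ = I1 ρ := by
    ext S
    constructor
    · intro h z
      have := h (ρ z)
      rw [Equiv.Perm.inv_def, Equiv.symm_apply_apply] at this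
      exact this.symm
    · intro h z
      have := h (ρ⁻¹ z)
      rw [Equiv.Perm.inv_def, Equiv.apply_symm_apply] at this
      exact this.symm
  unfold sc; rw [this]

theorem cyc_inv {V : Type*} {ρ : Perm V} {W : Set V} : cyc ρ⁻¹ W = cyc ρ W :=
  cls_congr fun _ _ _ => sc_inv

/-- left multiplication by a swap, splitting case -/
theorem cyc_swap_mul {V : Type*} [Finite V] [DecidableEq V] {ρ : Perm V} {x y : V}
    (hxy : x ≠ y) (h : sc ρ x y) :
    cyc (swap x y * ρ) Set.univ = cyc ρ Set.univ + 1 := by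
  rw [Equiv.swap_mul_eq_mul_swap]
  apply cyc_swap _ (Set.mem_univ _) (Set.mem_univ _)
  · have h1 : sc ρ (ρ⁻¹ x) x := sc_of_eq (by simp)
    have h2 : sc ρ (ρ⁻¹ y) y := sc_of_eq (by simp)
    exact h1.trans (h.trans h2.symm)
  · exact fun e => hxy (ρ⁻¹.injective e)

theorem sum3 {i j k : Fin 3} (hij : i ≠ j) (hik : i ≠ k) (hjk : j ≠ k) (f : Fin 3 → ℤ) :
    ∑ a, f a = f i + f j + f k := by
  have : (Finset.univ : Finset (Fin 3)) = {i, j, k} := by revert i j k; decide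
  rw [this, Finset.sum_insert (by simp [hij, hik]), Finset.sum_pair hjk, add_assoc]

theorem all3 {i j k : Fin 3} (hij : i ≠ j) (hik : i ≠ k) (hjk : j ≠ k) (a : Fin 3) :
    a = i ∨ a = j ∨ a = k := by revert i j k a; decide

end PB

namespace PB
open Equiv

/-- closed sets of white vertices in the graph with colors `s` and color 0 given by `τ` -/
def CI {V : Type*} (s : Fin 3 → Perm V) (τ : Perm V) (S : Set V) : Prop :=
  ∀ a z t, s a z = τ t → (z ∈ S ↔ t ∈ S)

/-- closed sets of white vertices in the bubble graph -/
def BI {V : Type*} (s : Fin 3 → Perm V) (S : Set V) : Prop :=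
  ∀ a b z t, s a z = s b t → (z ∈ S ↔ t ∈ S)

/-- bicolored permutation -/
abbrev rho {V : Type*} (s : Fin 3 → Perm V) (τ : Perm V) (a : Fin 3) : Perm V := (s a)⁻¹ * τ

theorem rho_eq {V : Type*} {s : Fin 3 → Perm V} {τ : Perm V} {a : Fin 3} {z t : V}
    (h : s a z = τ t) : rho s τ a t = z := by
  rw [Perm.mul_apply, ← h]; simp

theorem s_rho {V : Type*} (s : Fin 3 → Perm V) (τ : Perm V) (a : Fin 3) (t : V) :
    s a (rho s τ a t) = τ t := by
  rw [Perm.mul_apply]; simp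

theorem CI_iff {V : Type*} {s : Fin 3 → Perm V} {τ : Perm V} {S : Set V} :
    CI s τ S ↔ ∀ a, I1 (rho s τ a) S := by
  constructor
  · intro h a z
    exact h a _ _ (s_rho s τ a z)
  · intro h a z t e
    rw [← rho_eq e]; exact h a t

theorem good_CI {V : Type*} (s : Fin 3 → Perm V) (τ : Perm V) : Good (CI s τ) := by
  intro S h a z t e
  apply h
  intro T hT
  exact hT a z t e

theorem good_BI {V : Type*} (s : Fin 3 → Perm V) : Good (BI s) := by
  intro S h a b z t e
  apply h
  intro T hT
  exact hT a b z t e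

theorem CI.BI {V : Type*} {s : Fin 3 → Perm V} {τ : Perm V} {S : Set V} (h : CI s τ S) :
    BI s S := by
  intro a b z t e
  have h1 := h a z (τ⁻¹ (s a z)) (by simp)
  have h2 := h b t (τ⁻¹ (s a z)) (by simp [e])
  rw [h1, h2]

theorem BI_conn {V : Type*} {s : Fin 3 → Perm V} (τ : Perm V) {x y : V} (h : Rl (BI s) x y) :
    Rl (CI s τ) x y := fun S hS => h S hS.BI

theorem sc_conn {V : Type*} {s : Fin 3 → Perm V} {τ : Perm V} {a : Fin 3} {x y : V}
    (h : sc (rho s τ a) x y) : Rl (CI s τ) x y :=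
  fun S hS => h S (CI_iff.1 hS a)

theorem rho_swap {V : Type*} [DecidableEq V] (s : Fin 3 → Perm V) (τ : Perm V) (a : Fin 3)
    (x y : V) : rho s (τ * swap x y) a = rho s τ a * swap x y := by
  simp only [rho, mul_assoc]

theorem CI_swap {V : Type*} [DecidableEq V] {s : Fin 3 → Perm V} {τ : Perm V} {x y : V}
    {S : Set V} (h : x ∈ S ↔ y ∈ S) : CI s (τ * swap x y) S ↔ CI s τ S := by
  rw [CI_iff, CI_iff]
  refine forall_congr' fun a => ?_
  rw [rho_swap, I1_mul_swap h]

/-- number of bicolored cycles -/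
noncomputable def F {V : Type*} (s : Fin 3 → Perm V) (τ : Perm V) : ℤ :=
  ∑ a, (cyc (rho s τ a) Set.univ : ℤ)

/-- number of connected components -/
noncomputable def N {V : Type*} (s : Fin 3 → Perm V) (τ : Perm V) : ℤ :=
  (cls (CI s τ) Set.univ : ℤ)

/-- the functional to be maximized -/
noncomputable def Ph {V : Type*} (s : Fin 3 → Perm V) (τ : Perm V) : ℤ := F s τ - 3 * N s τ

/-- maximality -/
def Mx {V : Type*} (s : Fin 3 → Perm V) (τ : Perm V) : Prop := ∀ τ', Ph s τ' ≤ Ph s τ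

section
variable {V : Type*} [Finite V] [DecidableEq V] {s : Fin 3 → Perm V} {τ : Perm V} {x y : V}

theorem rho_cyc_same (hxy : x ≠ y) {a : Fin 3} (h : sc (rho s τ a) x y) :
    (cyc (rho s (τ * swap x y) a) Set.univ : ℤ) = cyc (rho s τ a) Set.univ + 1 := by
  rw [rho_swap, cyc_swap hxy (Set.mem_univ _) (Set.mem_univ _) h]; push_cast; rfl

theorem rho_cyc_diff {a : Fin 3} (h : ¬ sc (rho s τ a) x y) :
    (cyc (rho s (τ * swap x y) a) Set.univ : ℤ) = cyc (rho s τ a) Set.univ - 1 := by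
  rw [rho_swap]
  have := cyc_swap_not (Set.mem_univ x) (Set.mem_univ y) h
  rw [this]; push_cast; ring

theorem rho_cyc_ge (hxy : x ≠ y) (a : Fin 3) :
    (cyc (rho s τ a) Set.univ : ℤ) - 1 ≤ (cyc (rho s (τ * swap x y) a) Set.univ : ℤ) := by
  by_cases h : sc (rho s τ a) x y
  · rw [rho_cyc_same hxy h]; omega
  · rw [rho_cyc_diff h]

theorem conn_swap_of_not (h : ¬ Rl (CI s τ) x y) : Rl (CI s (τ * swap x y)) x y := by
  have h0 : ¬ sc (rho s τ 0) x y := fun h' => h (sc_conn h')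
  have := sc_swap_of_not h0
  rw [← rho_swap] at this
  exact sc_conn this

theorem sc_of_split (h : ¬ Rl (CI s (τ * swap x y)) x y) (a : Fin 3) : sc (rho s τ a) x y := by
  by_contra h0
  have := sc_swap_of_not h0
  rw [← rho_swap] at this
  exact h (sc_conn this)

theorem N_join (h : ¬ Rl (CI s τ) x y) : N s τ = N s (τ * swap x y) + 1 := by
  have := cls_merge (W := Set.univ) (I := CI s (τ * swap x y)) (Set.mem_univ x) (Set.mem_univ y)
    (good_CI s τ) ?_ h
  · unfold N; rw [this]; push_cast; rfl
  · intro S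
    constructor
    · intro hS
      have := conn_swap_of_not h S hS
      exact ⟨(CI_swap this).1 hS, this⟩
    · rintro ⟨hS, h'⟩
      exact (CI_swap h').2 hS

theorem N_same (h : Rl (CI s τ) x y) (h' : Rl (CI s (τ * swap x y)) x y) :
    N s (τ * swap x y) = N s τ := by
  unfold N
  congr 1
  apply cls_congr'
  intro S
  exact ⟨fun hS => (CI_swap (h' S hS)).1 hS, fun hS => (CI_swap (h S hS)).2 hS⟩

theorem F_eq (i j k : Fin 3) (hij : i ≠ j) (hik : i ≠ k) (hjk : j ≠ k) (τ : Perm V) :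
    F s τ = cyc (rho s τ i) Set.univ + cyc (rho s τ j) Set.univ + cyc (rho s τ k) Set.univ :=
  sum3 hij hik hjk (fun a => (cyc (rho s τ a) Set.univ : ℤ))

theorem swap_swap_cancel (τ : Perm V) (x y : V) : τ * swap x y * swap x y = τ := by
  rw [mul_assoc, swap_mul_self, mul_one]

theorem Ph_join (h : ¬ Rl (CI s τ) x y) : Ph s (τ * swap x y) = Ph s τ := by
  have h0 : ∀ a, ¬ sc (rho s τ a) x y := fun a h' => h (sc_conn h')
  have hN := N_join h
  unfold Ph
  rw [F_eq 0 1 2 (by decide) (by decide) (by decide),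
    F_eq 0 1 2 (by decide) (by decide) (by decide), rho_cyc_diff (h0 0), rho_cyc_diff (h0 1),
    rho_cyc_diff (h0 2), hN]
  ring

theorem Ph_split (h : ¬ Rl (CI s (τ * swap x y)) x y) : Ph s (τ * swap x y) = Ph s τ := by
  have := Ph_join h
  rw [swap_swap_cancel] at this
  exact this.symm

theorem N_split (h : ¬ Rl (CI s (τ * swap x y)) x y) : N s (τ * swap x y) = N s τ + 1 := by
  have := N_join h
  rwa [swap_swap_cancel] at this

theorem other3 {i j : Fin 3} (hij : i ≠ j) : ∃ k, i ≠ k ∧ j ≠ k := by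
  revert i j; decide

theorem Ph_two (hxy : x ≠ y) {i j : Fin 3} (hij : i ≠ j) (hi : sc (rho s τ i) x y)
    (hj : sc (rho s τ j) x y) :
    (¬ Rl (CI s (τ * swap x y)) x y ∧ Ph s (τ * swap x y) = Ph s τ) ∨
      (Rl (CI s (τ * swap x y)) x y ∧ Ph s τ < Ph s (τ * swap x y)) := by
  by_cases h : Rl (CI s (τ * swap x y)) x y
  · refine Or.inr ⟨h, ?_⟩
    obtain ⟨k, hik, hjk⟩ := other3 hij
    unfold Ph
    rw [N_same (sc_conn hi) h, F_eq i j k hij hik hjk, F_eq i j k hij hik hjk,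
      rho_cyc_same hxy hi, rho_cyc_same hxy hj]
    have := rho_cyc_ge (s := s) (τ := τ) hxy k
    omega
  · exact Or.inl ⟨h, Ph_split h⟩

theorem Ph_two_le (hxy : x ≠ y) {i j : Fin 3} (hij : i ≠ j) (hi : sc (rho s τ i) x y)
    (hj : sc (rho s τ j) x y) : Ph s τ ≤ Ph s (τ * swap x y) := by
  rcases Ph_two hxy hij hi hj with h | h
  · exact h.2.ge
  · exact h.2.le

theorem Mx.congr {τ' : Perm V} (h : Mx s τ) (e : Ph s τ' = Ph s τ) : Mx s τ' := by
  intro t; rw [e]; exact h t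

theorem Mx.two (hM : Mx s τ) (hxy : x ≠ y) {i j : Fin 3} (hij : i ≠ j)
    (hi : sc (rho s τ i) x y) (hj : sc (rho s τ j) x y) :
    ¬ Rl (CI s (τ * swap x y)) x y ∧ Mx s (τ * swap x y) := by
  rcases Ph_two hxy hij hi hj with h | h
  · exact ⟨h.1, hM.congr h.2⟩
  · exact absurd (hM (τ * swap x y)) (not_le.2 h.2)

theorem Mx.one (hM : Mx s τ) (hxy : x ≠ y) {i j k : Fin 3} (hij : i ≠ j) (hik : i ≠ k)
    (hjk : j ≠ k) (hi : sc (rho s τ i) x y) (hc : Rl (CI s (τ * swap x y)) x y) :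
    ¬ sc (rho s τ j) x y ∧ ¬ sc (rho s τ k) x y ∧ Ph s (τ * swap x y) = Ph s τ - 1 := by
  have hj : ¬ sc (rho s τ j) x y := fun h => (hM.two hxy hij hi h).1 hc
  have hk : ¬ sc (rho s τ k) x y := fun h => (hM.two hxy hik hi h).1 hc
  refine ⟨hj, hk, ?_⟩
  unfold Ph
  rw [N_same (sc_conn hi) hc, F_eq i j k hij hik hjk, F_eq i j k hij hik hjk,
      rho_cyc_same hxy hi, rho_cyc_diff hj, rho_cyc_diff hk]
  ring

end

/-- The labelling form of the 2-cut property. -/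
def PP {V : Type*} (s : Fin 3 → Perm V) (τ : Perm V) (W : Set V) : Prop :=
  ∃ lab : V → V, (∀ x, x ∉ W → ∀ a, lab (s a x) = lab (τ x)) ∧ ∀ w ∈ W, lab (τ w) = w

/-- `W` is the white set of a bubble -/
def Bub {V : Type*} (s : Fin 3 → Perm V) (W : Set V) : Prop :=
  W.Nonempty ∧ BI s W ∧ ∀ S, BI s S → (∃ x ∈ S, x ∈ W) → W ⊆ S

theorem Bub.rel {V : Type*} {s : Fin 3 → Perm V} {W : Set V} (h : Bub s W) {x y : V}
    (hx : x ∈ W) (hy : y ∈ W) : Rl (BI s) x y :=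
  fun S hS => ⟨fun a => h.2.2 S hS ⟨x, a, hx⟩ hy, fun a => h.2.2 S hS ⟨y, a, hy⟩ hx⟩

theorem Bub.conn {V : Type*} {s : Fin 3 → Perm V} {W : Set V} (h : Bub s W) (τ : Perm V) {x y : V}
    (hx : x ∈ W) (hy : y ∈ W) : Rl (CI s τ) x y := BI_conn τ (h.rel hx hy)

theorem CI_inv {V : Type*} {s : Fin 3 → Perm V} {τ : Perm V} {S : Set V} (h : CI s τ S)
    (a : Fin 3) (x : V) : τ⁻¹ (s a x) ∈ S ↔ x ∈ S := (h a x _ (by simp)).symm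

section
variable {V : Type*} [Finite V] [DecidableEq V] {s : Fin 3 → Perm V} {τ : Perm V} {W : Set V}

theorem unflip {w α : V} (hW : Bub s W) (hw : w ∈ W)
    (hc : ¬ Rl (CI s (τ * swap w α)) w α) (hP : PP s (τ * swap w α) W) : PP s τ W := by
  classical
  obtain ⟨lab, h1, h2⟩ := hP
  set τ' := τ * swap w α with hτ'
  set S := cl (CI s τ') α with hS
  have hSC : CI s τ' S := (good_CI s τ').cl α
  have hwS : ∀ v ∈ W, v ∉ S := fun v hv hvS => hc (((hW.conn τ' hw hv)).trans (Rl.symm hvS))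
  have hαS : α ∈ S := Rl.refl _ _
  have hαW : α ∉ W := fun h => hwS α h hαS
  have hwα : w ≠ α := by rintro rfl; exact hαW hw
  have e1 : τ w = τ' α := by rw [hτ', Perm.mul_apply, swap_apply_right]
  have e2 : τ α = τ' w := by rw [hτ', Perm.mul_apply, swap_apply_left]
  have e3 : ∀ x, x ≠ w → x ≠ α → τ x = τ' x := fun x hx hx' => by
    rw [hτ', Perm.mul_apply, swap_apply_of_ne_of_ne hx hx']
  refine ⟨fun u => if τ'⁻¹ u ∈ S then w else lab u, ?_, ?_⟩
  · intro x hx a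
    have hxw : x ≠ w := by rintro rfl; exact hx hw
    simp only [CI_inv hSC]
    by_cases hxα : x = α
    · subst hxα
      have : τ'⁻¹ (τ x) ∉ S := by rw [e2]; simpa using hwS w hw
      rw [if_pos hαS, if_neg this, e2, h2 w hw]
    · rw [e3 x hxw hxα, h1 x hx a]
      simp
  · intro v hv
    by_cases hvw : v = w
    · subst hvw
      have : τ'⁻¹ (τ v) ∈ S := by rw [e1]; simpa using hαS
      simp only [if_pos this]
    · have hvα : v ≠ α := by rintro rfl; exact hαW hv
      have : τ'⁻¹ (τ v) ∉ S := by rw [e3 v hvw hvα]; simpa using hwS v hv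
      simp only [if_neg this]
      rw [e3 v hvw hvα, h2 v hv]

end
end PB

namespace PB
open Equiv

section
variable {V : Type*} [Finite V] [DecidableEq V] {s : Fin 3 → Perm V} {τ : Perm V} {W : Set V}

/-- black vertices of a bubble -/
def Bk {V : Type*} (s : Fin 3 → Perm V) (W : Set V) : Set V := {u | (s 0)⁻¹ u ∈ W}

theorem mem_Bk (hW : BI s W) (a : Fin 3) (x : V) : s a x ∈ Bk s W ↔ x ∈ W :=
  (hW a 0 x _ (by simp)).symm

theorem lab_unique (hW : BI s W) {lab : V → V} (h1 : ∀ x, x ∉ W → ∀ a, lab (s a x) = lab (τ x))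
    (h2 : ∀ w ∈ W, lab (τ w) = w) {w : V} (hw : w ∈ W) :
    ∃ b, b ∈ Bk s W ∧ lab b = w ∧ ∀ u ∈ Bk s W, lab u = w → u = b := by
  set A : Set V := {u | lab u = w} with hA
  set B : Set V := {x | x ∉ W ∧ lab (τ x) = w} with hB
  have e1 : τ ⁻¹' A = insert w B := by
    ext x
    simp only [hA, hB, Set.mem_preimage, Set.mem_ofPred_eq, Set.mem_insert_iff]
    constructor
    · intro hx
      by_cases hxW : x ∈ W
      · left; rw [← h2 x hxW, hx]
      · exact Or.inr ⟨hxW, hx⟩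
    · rintro (rfl | hx)
      · exact h2 _ hw
      · exact hx.2
  have e2 : s 0 '' B = A \ Bk s W := by
    ext u
    constructor
    · rintro ⟨x, ⟨hx, hx'⟩, rfl⟩
      exact ⟨(h1 x hx 0).trans hx', fun h => hx ((mem_Bk hW 0 x).1 h)⟩
    · rintro ⟨hu, hu'⟩
      refine ⟨(s 0)⁻¹ u, ⟨hu', ?_⟩, by simp⟩
      have h3 : lab u = w := hu
      have h4 : s 0 ((s 0)⁻¹ u) = u := by simp
      rw [← h1 _ hu' 0, h4]; exact h3
  have c1 : A.ncard = B.ncard + 1 := by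
    rw [← Set.ncard_insert_of_notMem (a := w) (s := B) (fun h => h.1 hw) (Set.toFinite _), ← e1,
      Set.ncard_preimage_of_injective_subset_range τ.injective]
    rw [τ.surjective.range_eq]; exact Set.subset_univ _
  have c2 : B.ncard = (A \ Bk s W).ncard := by
    rw [← e2, Set.ncard_image_of_injective _ (s 0).injective]
  have c3 : (A ∩ Bk s W).ncard = 1 := by
    have := Set.ncard_inter_add_ncard_sdiff_eq_ncard A (Bk s W) (Set.toFinite _)
    omega
  obtain ⟨b, hb⟩ := Set.ncard_eq_one.1 c3
  have hbm : b ∈ A ∩ Bk s W := by rw [hb]; rfl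
  refine ⟨b, hbm.2, hbm.1, fun u hu hu' => ?_⟩
  have : u ∈ A ∩ Bk s W := ⟨hu', hu⟩
  rw [hb] at this; exact this

theorem closing (hW : Bub s W) {lab : V → V} {π : V → V}
    (hπ : ∀ w ∈ W, π w ∈ Bk s W ∧ lab (π w) = w ∧ ∀ u ∈ Bk s W, lab u = w → u = π w) :
    ∀ (m : ℕ) (τ : Perm V), {w | w ∈ W ∧ τ w ≠ π w}.ncard = m →
      (∀ x, x ∉ W → ∀ a, lab (s a x) = lab (τ x)) → (∀ w ∈ W, lab (τ w) = w) → Mx s τ →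
      ∃ τ', Mx s τ' ∧ ∀ w ∈ W, τ' w = π w := by
  intro m
  induction m with
  | zero =>
    intro τ hm _ _ hM
    rw [Set.ncard_eq_zero (Set.toFinite _)] at hm
    refine ⟨τ, hM, fun w hw => ?_⟩
    by_contra h
    have : w ∈ {w | w ∈ W ∧ τ w ≠ π w} := ⟨hw, h⟩
    rw [hm] at this; exact this
  | succ m ih =>
    intro τ hm h1 h2 hM
    have hne : {w | w ∈ W ∧ τ w ≠ π w}.Nonempty := by
      rw [← Set.ncard_pos (Set.toFinite _)]; omega
    obtain ⟨w, hw, hwπ⟩ := hne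
    obtain ⟨hb, hlb, hub⟩ := hπ w hw
    set α := τ⁻¹ (π w) with hα
    have hτα : τ α = π w := by simp [hα]
    have hwα : w ≠ α := by intro e; apply hwπ; rw [e, hτα, ← e]
    have hαW : α ∉ W := by
      intro h
      have := h2 α h
      rw [hτα, hlb] at this; exact hwα this
    set τ' := τ * swap w α with hτ'
    have e1 : τ' α = τ w := by rw [hτ', Perm.mul_apply, swap_apply_right]
    have e2 : τ' w = π w := by rw [hτ', Perm.mul_apply, swap_apply_left, hτα]
    have e3 : ∀ x, x ≠ w → x ≠ α → τ' x = τ x := fun x hx hx' => by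
      rw [hτ', Perm.mul_apply, swap_apply_of_ne_of_ne hx hx']
    have h1' : ∀ x, x ∉ W → ∀ a, lab (s a x) = lab (τ' x) := by
      intro x hx a
      rw [h1 x hx a]
      by_cases hxα : x = α
      · subst hxα; rw [hτα, e1, hlb, h2 w hw]
      · rw [e3 x (by rintro rfl; exact hx hw) hxα]
    have h2' : ∀ v ∈ W, lab (τ' v) = v := by
      intro v hv
      by_cases hvw : v = w
      · subst hvw; rw [e2, hlb]
      · rw [e3 v hvw (by rintro rfl; exact hαW hv), h2 v hv]
    have hsep : ¬ Rl (CI s τ') w α := by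
      intro hr
      have hS : CI s τ' {x | x ∉ W ∧ lab (τ' x) = w} := by
        intro a z t e
        simp only [Set.mem_ofPred_eq]
        by_cases ht : t ∈ W
        · refine ⟨fun hz => ?_, fun h => absurd ht h.1⟩
          exfalso
          have h3 := h2' t ht
          rw [← e, h1' z hz.1 a, hz.2] at h3
          subst h3
          rw [e2] at e
          apply hz.1
          rw [← mem_Bk hW.2.1 a, e]; exact hb
        · by_cases hz : z ∈ W
          · refine ⟨fun h => absurd hz h.1, fun h => ?_⟩
            exfalso
            have h3 : τ' t ∈ Bk s W := by rw [← e, mem_Bk hW.2.1]; exact hz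
            have h4 := hub _ h3 h.2
            rw [← e2] at h4
            apply ht; rw [τ'.injective h4]; exact hw
          · rw [← h1' z hz a, e]; tauto
      exact ((hr _ hS).2 ⟨hαW, by rw [e1, h2 w hw]⟩).1 hw
    have hPh := Ph_split hsep
    apply ih τ' _ h1' h2' (hM.congr hPh)
    have hset : {v | v ∈ W ∧ τ v ≠ π v} = insert w {v | v ∈ W ∧ τ' v ≠ π v} := by
      ext v
      simp only [Set.mem_ofPred_eq, Set.mem_insert_iff]
      by_cases hvw : v = w
      · subst hvw; simp [hw, hwπ]
      · constructor
        · rintro ⟨hv, hv'⟩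
          right; rw [e3 v hvw (by rintro rfl; exact hαW hv)]; exact ⟨hv, hv'⟩
        · rintro (h | ⟨hv, hv'⟩)
          · exact absurd h hvw
          · rw [e3 v hvw (by rintro rfl; exact hαW hv)] at hv'; exact ⟨hv, hv'⟩
    rw [hset, Set.ncard_insert_of_notMem (by simp [e2]) (Set.toFinite _)] at hm
    omega

theorem exists_closed (hW : Bub s W) (hM : Mx s τ) (hP : PP s τ W) :
    ∃ τ', Mx s τ' ∧ ∀ w ∈ W, τ' w ∈ Bk s W := by
  classical
  obtain ⟨lab, h1, h2⟩ := hP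
  have : ∀ w, ∃ b, w ∈ W → (b ∈ Bk s W ∧ lab b = w ∧ ∀ u ∈ Bk s W, lab u = w → u = b) := by
    intro w
    by_cases hw : w ∈ W
    · obtain ⟨b, hb⟩ := lab_unique hW.2.1 h1 h2 hw
      exact ⟨b, fun _ => hb⟩
    · exact ⟨w, fun h => absurd h hw⟩
  choose π hπ using this
  obtain ⟨τ', hM', hc⟩ := closing hW hπ _ τ rfl h1 h2 hM
  exact ⟨τ', hM', fun w hw => by rw [hc w hw]; exact (hπ w hw).1⟩

/-- modify color `k` by a transposition -/
def upd {V : Type*} [DecidableEq V] (s : Fin 3 → Perm V) (k : Fin 3) (w y : V) :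
    Fin 3 → Perm V := Function.update s k (s k * swap w y)

variable {k : Fin 3} {w y : V}

theorem upd_ne {a : Fin 3} (h : a ≠ k) : upd s k w y a = s a := by
  simp [upd, h]

theorem upd_same : upd s k w y k = s k * swap w y := by simp [upd]

theorem upd_left : upd s k w y k w = s k y := by rw [upd_same, Perm.mul_apply, swap_apply_left]
theorem upd_right : upd s k w y k y = s k w := by rw [upd_same, Perm.mul_apply, swap_apply_right]
theorem upd_of_ne {x : V} (a : Fin 3) (h : x ≠ w) (h' : x ≠ y) : upd s k w y a x = s a x := by
  by_cases ha : a = k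
  · subst ha; rw [upd_same, Perm.mul_apply, swap_apply_of_ne_of_ne h h']
  · rw [upd_ne ha]

theorem upd_upd : upd (upd s k w y) k w y = s := by
  funext a
  by_cases ha : a = k
  · subst ha; rw [upd_same, upd_same, mul_assoc, swap_mul_self, mul_one]
  · rw [upd_ne ha, upd_ne ha]

/-- pre-image under `upd` -/
theorem upd_swap {S : Set V} (h : w ∈ S ↔ y ∈ S) (a : Fin 3) (z : V) :
    ∃ z', upd s k w y a z = s a z' ∧ (z ∈ S ↔ z' ∈ S) := by
  by_cases ha : a = k
  · subst ha; exact ⟨swap w y z, by rw [upd_same, Perm.mul_apply], (swap_mem h z).symm⟩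
  · exact ⟨z, by rw [upd_ne ha], Iff.rfl⟩

theorem BI_upd' {S : Set V} (h : w ∈ S ↔ y ∈ S) (hS : BI s S) : BI (upd s k w y) S := by
  intro a b z t e
  obtain ⟨z', hz, hz'⟩ := upd_swap (s := s) (k := k) h a z
  obtain ⟨t', ht, ht'⟩ := upd_swap (s := s) (k := k) h b t
  rw [hz, ht] at e
  rw [hz', ht']; exact hS a b z' t' e

theorem BI_upd {S : Set V} (h : w ∈ S ↔ y ∈ S) : BI (upd s k w y) S ↔ BI s S :=
  ⟨fun hS => by have := BI_upd' (k := k) h hS; rwa [upd_upd] at this, BI_upd' h⟩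

theorem CI_upd' {S : Set V} (h : w ∈ S ↔ y ∈ S) (hS : CI s τ S) : CI (upd s k w y) τ S := by
  intro a z t e
  obtain ⟨z', hz, hz'⟩ := upd_swap (s := s) (k := k) h a z
  rw [hz] at e
  rw [hz']; exact hS a z' t e

theorem CI_upd {S : Set V} (h : w ∈ S ↔ y ∈ S) : CI (upd s k w y) τ S ↔ CI s τ S :=
  ⟨fun hS => by have := CI_upd' (k := k) h hS; rwa [upd_upd] at this, CI_upd' h⟩

theorem two_others (k : Fin 3) : ∃ i j : Fin 3, i ≠ j ∧ i ≠ k ∧ j ≠ k := by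
  revert k; decide

theorem F_ctr (hwy : w ≠ y) (ht : τ w = s k y) : F (upd s k w y) τ = F s τ + 1 := by
  have hk : (cyc (rho (upd s k w y) τ k) Set.univ : ℤ) = cyc (rho s τ k) Set.univ + 1 := by
    have e : rho (upd s k w y) τ k = swap w y * rho s τ k := by
      simp only [rho, upd_same, mul_inv_rev, swap_inv, mul_assoc]
    rw [e, cyc_swap_mul hwy (sc_of_eq (rho_eq ht.symm))]
    push_cast; rfl
  obtain ⟨i, j, hij, hik, hjk⟩ := two_others k
  rw [F_eq i j k hij hik hjk, F_eq i j k hij hik hjk, hk]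
  simp only [rho, upd_ne hik, upd_ne hjk]
  ring

theorem CI_ctr (ht : τ w = s k y) (S : Set V) :
    CI s τ S ↔ CI (upd s k w y) τ S ∧ (w ∈ S ↔ y ∈ S) := by
  constructor
  · intro h
    have := (h k y w ht.symm).symm
    exact ⟨(CI_upd this).2 h, this⟩
  · rintro ⟨h, h'⟩
    exact (CI_upd h').1 h

theorem N_ctr (ht : τ w = s k y) (h : ¬ Rl (CI (upd s k w y) τ) w y) :
    N (upd s k w y) τ = N s τ + 1 := by
  unfold N
  rw [cls_merge (Set.mem_univ w) (Set.mem_univ y) (good_CI _ _) (CI_ctr ht) h]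
  push_cast; rfl

theorem N_ctr' (ht : τ w = s k y) (h : Rl (CI (upd s k w y) τ) w y) :
    N (upd s k w y) τ = N s τ := by
  unfold N
  congr 1
  apply cls_congr'
  intro S
  rw [CI_ctr ht]
  exact ⟨fun hS => ⟨hS, h S hS⟩, fun hS => hS.1⟩

/-- flipping so that `w` is joined to `b`, not decreasing the functional -/
theorem make_good {i j : Fin 3} (hij : i ≠ j) {w b : V} (hi : s i w = b) (hj : s j w = b)
    (t : Perm V) : ∃ t', t' w = b ∧ Ph s t ≤ Ph s t' ∧ ∀ x, x ≠ w → t x ≠ b → t' x = t x := by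
  by_cases h : t w = b
  · exact ⟨t, h, le_rfl, fun _ _ _ => rfl⟩
  · set α := t⁻¹ b with hα
    have htα : t α = b := by simp [hα]
    have hwα : w ≠ α := by intro e; apply h; rw [e, htα]
    refine ⟨t * swap w α, by rw [Perm.mul_apply, swap_apply_left, htα], ?_, ?_⟩
    · apply Ph_two_le hwα hij
      · exact (sc_of_eq (rho_eq (hi.trans htα.symm))).symm
      · exact (sc_of_eq (rho_eq (hj.trans htα.symm))).symm
    · intro x hx hxb
      rw [Perm.mul_apply, swap_apply_of_ne_of_ne hx]
      rintro rfl; exact hxb htα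

theorem make_good_M {i j : Fin 3} (hij : i ≠ j) {w b : V} (hW : Bub s W) (hw : w ∈ W)
    (hi : s i w = b) (hj : s j w = b) (hM : Mx s τ)
    (hG : ∀ t, Mx s t → t w = b → PP s t W) : PP s τ W := by
  by_cases h : τ w = b
  · exact hG τ hM h
  · set α := τ⁻¹ b with hα
    have htα : τ α = b := by simp [hα]
    have hwα : w ≠ α := by intro e; apply h; rw [e, htα]
    obtain ⟨h1, h2⟩ := hM.two hwα hij (sc_of_eq (rho_eq (hi.trans htα.symm))).symm
      (sc_of_eq (rho_eq (hj.trans htα.symm))).symm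
    exact unflip hW hw h1 (hG _ h2 (by rw [Perm.mul_apply, swap_apply_left, htα]))

end
end PB

namespace PB
open Equiv

section
variable {V : Type*} [Finite V] [DecidableEq V] {s : Fin 3 → Perm V} {τ : Perm V} {W : Set V}

/-- number of bicolored cycles of colors `i, j` in `W` -/
noncomputable def bc {V : Type*} (s : Fin 3 → Perm V) (i j : Fin 3) (W : Set V) : ℕ :=
  cyc ((s i)⁻¹ * s j) W

/-- total number of faces of the bubble graph in `W` -/
noncomputable def pl {V : Type*} (s : Fin 3 → Perm V) (W : Set V) : ℕ :=
  bc s 0 1 W + bc s 0 2 W + bc s 1 2 W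

theorem bc_symm (i j : Fin 3) : bc s i j W = bc s j i W := by
  unfold bc
  rw [← cyc_inv, mul_inv_rev, inv_inv]

theorem pl_eq {i j k : Fin 3} (hij : i ≠ j) (hik : i ≠ k) (hjk : j ≠ k) :
    pl s W = bc s i j W + bc s i k W + bc s j k W := by
  unfold pl
  have h1 := bc_symm (s := s) (W := W) 0 1
  have h2 := bc_symm (s := s) (W := W) 0 2
  have h3 := bc_symm (s := s) (W := W) 1 2
  fin_cases i <;> fin_cases j <;> fin_cases k <;> simp at hij hik hjk ⊢ <;> omega

theorem sc_congr {ρ ρ' : Perm V} (hW : I1 ρ W) (h : ∀ x ∈ W, ρ x = ρ' x) {x : V} (hx : x ∈ W)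
    (y : V) : sc ρ x y ↔ sc ρ' x y := by
  have hW' : I1 ρ' W := mem_of_maps fun z hz => by rw [← h z hz]; exact (hW z).2 hz
  have key : ∀ S, S ⊆ W → (I1 ρ S ↔ I1 ρ' S) := by
    intro S hS
    constructor
    · intro h1
      exact mem_of_maps fun z hz => by rw [← h z (hS hz)]; exact (h1 z).2 hz
    · intro h1
      exact mem_of_maps fun z hz => by rw [h z (hS hz)]; exact (h1 z).2 hz
  constructor
  · intro hr
    have h1 : cl (I1 ρ') x ⊆ W := fun z hz => (hz W hW').1 hx
    exact (hr _ ((key _ h1).2 ((good_I1 ρ').cl x))).1 (Rl.refl _ _)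
  · intro hr
    have h1 : cl (I1 ρ) x ⊆ W := fun z hz => (hz W hW).1 hx
    exact (hr _ ((key _ h1).1 ((good_I1 ρ).cl x))).1 (Rl.refl _ _)

theorem cyc_congr {ρ ρ' : Perm V} (hW : I1 ρ W) (h : ∀ x ∈ W, ρ x = ρ' x) :
    cyc ρ W = cyc ρ' W := cls_congr fun _ hx y => sc_congr hW h hx y

theorem cyc_fixed {ρ : Perm V} (h : ∀ x ∈ W, ρ x = x) : cyc ρ W = W.ncard := by
  unfold cyc
  rw [cls_eq]
  apply Set.InjOn.ncard_image
  intro x hx y hy e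
  have hr : sc ρ x y := cl_eq_iff.1 e
  have : I1 ρ {x} := mem_of_maps (by rintro z rfl; exact h z hx)
  exact ((hr _ this).1 rfl).symm

theorem BI.I1 (hW : BI s W) (i j : Fin 3) : I1 ((s i)⁻¹ * s j) W := fun z =>
  hW i j _ z (by simp)

theorem bc_rel {i j : Fin 3} {x y : V} (h : sc ((s i)⁻¹ * s j) x y) : Rl (BI s) x y :=
  fun S hS => h S (hS.I1 i j)

theorem bc_conn_iff {i j k : Fin 3} (hij : i ≠ j) (hik : i ≠ k) (hjk : j ≠ k) (hW : BI s W)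
    (h : ∀ x ∈ W, s i x = s k x) {x : V} (hx : x ∈ W) (y : V) :
    sc ((s i)⁻¹ * s j) x y ↔ Rl (BI s) x y := by
  refine ⟨bc_rel, fun hr => ?_⟩
  set C := cl (PB.I1 ((s i)⁻¹ * s j)) x with hC
  have hI : PB.I1 ((s i)⁻¹ * s j) C := (good_I1 _).cl x
  have hCW : C ⊆ W := fun z hz => (hz W (hW.I1 i j)).1 hx
  have key : ∀ a z, z ∈ W → ∃ c, (c = i ∨ c = j) ∧ s a z = s c z := by
    intro a z hz
    rcases all3 hij hik hjk a with rfl | rfl | rfl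
    · exact ⟨_, Or.inl rfl, rfl⟩
    · exact ⟨_, Or.inr rfl, rfl⟩
    · exact ⟨i, Or.inl rfl, (h z hz).symm⟩
  have h2 : ∀ z t, s i z = s j t → (z ∈ C ↔ t ∈ C) := by
    intro z t e
    have e' : ((s i)⁻¹ * s j) t = z := by rw [Perm.mul_apply, ← e]; simp
    rw [← e']; exact hI t
  have hB : BI s C := by
    intro a b z t e
    by_cases hz : z ∈ W
    · have ht : t ∈ W := (hW a b z t e).1 hz
      obtain ⟨c, hc, hc'⟩ := key a z hz
      obtain ⟨d, hd, hd'⟩ := key b t ht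
      rw [hc', hd'] at e
      rcases hc with rfl | rfl <;> rcases hd with rfl | rfl
      · rw [(s _).injective e]
      · exact h2 _ _ e
      · exact (h2 _ _ e.symm).symm
      · rw [(s _).injective e]
    · have ht : t ∉ W := fun h => hz ((hW a b z t e).2 h)
      exact ⟨fun h => absurd (hCW h) hz, fun h => absurd (hCW h) ht⟩
  exact (hr C hB).1 (Rl.refl _ _)

theorem pl_union {A B : Set V} (hA : BI s A) (hd : ∀ x ∈ B, x ∉ A) :
    pl s (A ∪ B) = pl s A + pl s B := by
  have : ∀ i j, bc s i j (A ∪ B) = bc s i j A + bc s i j B := by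
    intro i j
    exact cls_union fun x hx y hy hr => hd y hy ((hr A (hA.I1 i j)).1 hx)
  unfold pl
  rw [this, this, this]; ring

variable {i j k : Fin 3} {x y : V}

theorem upd_bc (hik : i ≠ k) : (upd s k x y i)⁻¹ * upd s k x y k = (s i)⁻¹ * s k * swap x y := by
  rw [upd_ne hik, upd_same, mul_assoc]

theorem bc_upd_same (hik : i ≠ k) (hxy : x ≠ y) (hx : x ∈ W) (hy : y ∈ W)
    (h : sc ((s i)⁻¹ * s k) x y) : bc (upd s k x y) i k W = bc s i k W + 1 := by
  unfold bc
  rw [upd_bc hik, cyc_swap hxy hx hy h]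

theorem bc_upd_not (hik : i ≠ k) (hx : x ∈ W) (hy : y ∈ W)
    (h : ¬ sc ((s i)⁻¹ * s k) x y) : bc s i k W = bc (upd s k x y) i k W + 1 := by
  unfold bc
  rw [upd_bc hik, cyc_swap_not hx hy h]

theorem bc_upd_other (hik : i ≠ k) (hjk : j ≠ k) : bc (upd s k x y) i j W = bc s i j W := by
  unfold bc
  rw [upd_ne hik, upd_ne hjk]

theorem BI_ctr (h : s i x = s k y) (S : Set V) :
    BI s S ↔ BI (upd s k x y) S ∧ (x ∈ S ↔ y ∈ S) := by
  constructor
  · intro hS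
    have := hS i k x y h
    exact ⟨(BI_upd this).2 hS, this⟩
  · rintro ⟨hS, h'⟩
    exact (BI_upd h').1 hS

theorem sc_bc (h : s i x = s k y) : sc ((s i)⁻¹ * s k) x y := by
  apply Rl.symm
  apply sc_of_eq
  rw [Perm.mul_apply, ← h]; simp

theorem euler : ∀ (m : ℕ) (s : Fin 3 → Perm V), {x | x ∈ W ∧ s 0 x ≠ s 2 x}.ncard = m → BI s W →
    pl s W ≤ W.ncard + 2 * cls (BI s) W := by
  intro m
  induction m using Nat.strong_induction_on with
  | _ m ih =>
  intro s hm hW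
  by_cases hag : ∀ x ∈ W, s 0 x = s 2 x
  · have h1 : bc s 0 2 W = W.ncard := cyc_fixed fun x hx => by
      rw [Perm.mul_apply, ← hag x hx]; simp
    have h2 : bc s 0 1 W = cls (BI s) W := cls_congr fun x hx y =>
      bc_conn_iff (by decide) (by decide) (by decide) hW hag hx y
    have h3 : bc s 2 1 W = cls (BI s) W := cls_congr fun x hx y =>
      bc_conn_iff (by decide) (by decide) (by decide) hW (fun x hx => (hag x hx).symm) hx y
    have h4 := bc_symm (s := s) (W := W) 2 1
    unfold pl; omega
  · push Not at hag
    obtain ⟨x, hx, hne⟩ := hag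
    set y := (s 2)⁻¹ (s 0 x) with hy
    have e : s 0 x = s 2 y := by simp [hy]
    have hxy : x ≠ y := by rintro h; rw [← h] at e; exact hne e
    have hyW : y ∈ W := (hW 0 2 x y e).1 hx
    have hW' : BI (upd s 2 x y) W := ((BI_ctr e W).1 hW).1
    have hlt : {z | z ∈ W ∧ upd s 2 x y 0 z ≠ upd s 2 x y 2 z}.ncard < m := by
      rw [← hm]
      apply Set.ncard_lt_ncard _ (Set.toFinite _)
      constructor
      · rintro z ⟨hz, hz'⟩
        refine ⟨hz, ?_⟩
        by_cases h1 : z = x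
        · rw [h1]; exact hne
        by_cases h2 : z = y
        · rw [h2, ← e]
          exact fun h => hxy ((s 0).injective h).symm
        rwa [upd_of_ne _ h1 h2, upd_of_ne _ h1 h2] at hz'
      · intro h
        have := h (⟨hx, hne⟩ : x ∈ {x | x ∈ W ∧ s 0 x ≠ s 2 x})
        apply this.2
        rw [upd_ne (by decide), upd_left, e]
    have h := ih _ hlt (upd s 2 x y) rfl hW'
    have b1 := bc_upd_other (s := s) (W := W) (i := 0) (j := 1) (k := 2) (x := x) (y := y)
      (by decide) (by decide)
    have b2 := bc_upd_same (s := s) (W := W) (i := 0) (k := 2) (by decide) hxy hx hyW (sc_bc e)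
    have b3 : bc s 1 2 W ≤ bc (upd s 2 x y) 1 2 W + 1 := by
      by_cases h1 : sc ((s 1)⁻¹ * s 2) x y
      · have := bc_upd_same (s := s) (W := W) (i := 1) (k := 2) (by decide) hxy hx hyW h1; omega
      · have := bc_upd_not (s := s) (W := W) (i := 1) (k := 2) (by decide) hx hyW h1; omega
    by_cases hr : Rl (BI (upd s 2 x y)) x y
    · have : cls (BI (upd s 2 x y)) W = cls (BI s) W := by
        apply cls_congr'
        intro S
        rw [BI_ctr e]
        exact ⟨fun h => ⟨h, hr S h⟩, fun h => h.1⟩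
      unfold pl at h ⊢; omega
    · have hc := cls_merge hx hyW (good_BI _) (BI_ctr e) hr
      have h1 : sc ((s 1)⁻¹ * s 2) x y := by
        by_contra h1
        have := sc_swap_of_not h1
        rw [← upd_bc (by decide)] at this
        exact hr (bc_rel this)
      have := bc_upd_same (s := s) (W := W) (i := 1) (k := 2) (by decide) hxy hx hyW h1
      unfold pl at h ⊢; omega

theorem Bub.cls (hW : Bub s W) : cls (BI s) W = 1 := by
  obtain ⟨x, hx⟩ := hW.1
  exact cls_one hx fun y hy => hW.rel hx hy

theorem Bub.euler (hW : Bub s W) : pl s W ≤ W.ncard + 2 := by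
  have := PB.euler (W := W) _ s rfl hW.2.1
  rw [hW.cls] at this; omega

/-- existence of a bicolored cycle of length at most two -/
theorem exists_short (hW : Bub s W) (hp : pl s W = W.ncard + 2) :
    ∃ i j : Fin 3, i ≠ j ∧ ∃ w ∈ W, ((s i)⁻¹ * s j) (((s i)⁻¹ * s j) w) = w := by
  by_contra hcon
  push Not at hcon
  have key : ∀ i j : Fin 3, i ≠ j → 3 * bc s i j W ≤ W.ncard := by
    intro i j hij
    have hcon := hcon i j hij
    set ρ := (s i)⁻¹ * s j with hρ
    have hI : PB.I1 ρ W := hW.2.1.I1 i j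
    unfold bc cyc
    rw [cls_eq]
    have hfin : (cl (PB.I1 ρ) '' W).Finite := Set.toFinite _
    have hWfin : W.Finite := Set.toFinite _
    rw [Set.ncard_eq_toFinset_card _ hfin, Set.ncard_eq_toFinset_card _ hWfin]
    classical
    refine Finset.mul_card_image_le_card_of_maps_to (f := cl (PB.I1 ρ)) ?_ 3 ?_
    · intro a ha
      rw [Set.Finite.mem_toFinset] at ha ⊢
      exact ⟨a, ha, rfl⟩
    · intro C hC
      rw [Set.Finite.mem_toFinset] at hC
      obtain ⟨x, hx, rfl⟩ := hC
      have hx1 : ρ x ∈ W := (hI x).2 hx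
      have hx2 : ρ (ρ x) ∈ W := (hI _).2 hx1
      have hsub : ({x, ρ x, ρ (ρ x)} : Finset V) ⊆
          {a ∈ hWfin.toFinset | cl (PB.I1 ρ) a = cl (PB.I1 ρ) x} := by
        intro z hz
        simp only [Finset.mem_insert, Finset.mem_singleton] at hz
        rw [Finset.mem_filter, Set.Finite.mem_toFinset, cl_eq_iff]
        rcases hz with rfl | rfl | rfl
        · exact ⟨hx, Rl.refl _ _⟩
        · exact ⟨hx1, (sc_apply ρ x).symm⟩
        · exact ⟨hx2, ((sc_apply ρ x).trans (sc_apply ρ _)).symm⟩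
      refine le_trans (le_of_eq ?_) (Finset.card_le_card hsub)
      have hne2 : ρ (ρ x) ≠ x := hcon x hx
      have hne1 : ρ x ≠ x := fun h => hne2 (by rw [h, h])
      have hne3 : ρ (ρ x) ≠ ρ x := fun h => hne1 (ρ.injective h)
      rw [Finset.card_insert_of_notMem, Finset.card_pair hne3.symm]
      simp [hne1.symm, hne2.symm]
  have h1 := key 0 1 (by decide)
  have h2 := key 0 2 (by decide)
  have h3 := key 1 2 (by decide)
  unfold pl at hp; omega

end
end PB

namespace PB
open Equiv

section
variable {V : Type*} [Finite V] [DecidableEq V] {s : Fin 3 → Perm V} {τ : Perm V} {W : Set V}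
variable {i j k : Fin 3} {w y b : V}

theorem PP_single (hW : W = {w}) : PP s τ W :=
  ⟨fun _ => w, fun _ _ _ => rfl, fun v hv => by rw [hW] at hv; exact hv.symm⟩

theorem BI.diff {A B : Set V} (hA : BI s A) (hB : BI s B) : BI s (A \ B) := by
  intro a b z t e
  have := hA a b z t e
  have := hB a b z t e
  simp only [Set.mem_sdiff]; tauto

theorem BI.union {A B : Set V} (hA : BI s A) (hB : BI s B) : BI s (A ∪ B) := by
  intro a b z t e
  have := hA a b z t e
  have := hB a b z t e
  simp only [Set.mem_union]; tauto

theorem BI.inter {A B : Set V} (hA : BI s A) (hB : BI s B) : BI s (A ∩ B) := by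
  intro a b z t e
  have := hA a b z t e
  have := hB a b z t e
  simp only [Set.mem_inter_iff]; tauto

theorem BI_single (h : ∀ a, s a w = b) : BI s {w} := by
  intro a c z t e
  simp only [Set.mem_singleton_iff]
  constructor
  · rintro rfl
    rw [h, ← h c] at e; exact ((s c).injective e).symm
  · rintro rfl
    rw [h, ← h a] at e; exact (s a).injective e

theorem CI_single (h : ∀ a, s a w = b) (ht : τ w = b) : CI s τ {w} := by
  intro a z t e
  simp only [Set.mem_singleton_iff]
  constructor
  · rintro rfl
    rw [h, ← ht] at e; exact (τ.injective e).symm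
  · rintro rfl
    rw [ht, ← h a] at e; exact (s a).injective e

/-- the induction hypothesis -/
def IHP {V : Type*} [Finite V] [DecidableEq V] (n : ℕ) : Prop :=
  ∀ (s : Fin 3 → Perm V) (τ : Perm V) (W : Set V), W.ncard < n → Bub s W →
    pl s W = W.ncard + 2 → Mx s τ → PP s τ W

theorem dipole (hW : Bub s W) (hp : pl s W = W.ncard + 2) (hM : Mx s τ)
    (hij : i ≠ j) (hik : i ≠ k) (hjk : j ≠ k) (hw : w ∈ W) (hi : s i w = b) (hj : s j w = b)
    (IH : IHP (V := V) W.ncard) : PP s τ W := by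
  by_cases hk : s k w = b
  · apply PP_single (w := w)
    apply le_antisymm
    · apply hW.2.2 {w} _ ⟨w, rfl, hw⟩
      apply BI_single (b := b)
      intro a
      rcases all3 hij hik hjk a with rfl | rfl | rfl <;> assumption
    · intro x hx; rw [Set.mem_singleton_iff] at hx; rw [hx]; exact hw
  apply make_good_M hij hW hw hi hj hM
  clear! τ
  intro τ hM hτ
  set y := (s k)⁻¹ b with hy
  have hky : s k y = b := by simp [hy]
  have hwy : w ≠ y := by rintro h; rw [← h] at hky; exact hk hky
  have hyW : y ∈ W := (hW.2.1 i k w y (hi.trans hky.symm)).1 hw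
  set s' := upd s k w y with hs'
  have hall : ∀ a, s' a w = b := by
    intro a
    rcases all3 hij hik hjk a with rfl | rfl | rfl
    · rw [hs', upd_ne hik]; exact hi
    · rw [hs', upd_ne hjk]; exact hj
    · rw [hs', upd_left, hky]
  have hPh : ∀ t : Perm V, t w = b → Ph s' t = Ph s t - 2 := by
    intro t ht
    have h1 : F s' t = F s t + 1 := F_ctr hwy (ht.trans hky.symm)
    have h2 : N s' t = N s t + 1 := N_ctr (ht.trans hky.symm) (fun hr =>
      hwy ((hr {w} (CI_single hall ht)).1 rfl).symm)
    unfold Ph; rw [h1, h2]; ring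
  have hM' : Mx s' τ := by
    intro t
    obtain ⟨t', ht', hle, -⟩ := make_good (s := s') hij (hall i) (hall j) t
    have h1 := hPh t' ht'
    have h2 := hPh τ hτ
    have h3 := hM t'
    omega
  have hsB : BI s' {w} := BI_single hall
  have hWs' : BI s' W := (BI_upd ⟨fun _ => hyW, fun _ => hw⟩).2 hW.2.1
  have hW' : Bub s' (W \ {w}) := by
    refine ⟨⟨y, hyW, hwy.symm⟩, hWs'.diff hsB, ?_⟩
    rintro S hS ⟨x, hxS, hxW⟩
    by_cases hyS : y ∈ S
    · have h1 : BI s (S ∪ {w}) := by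
        rw [← BI_upd (k := k) (w := w) (y := y) ⟨fun _ => Or.inl hyS, fun _ => Or.inr rfl⟩]
        exact hS.union hsB
      have h2 := hW.2.2 _ h1 ⟨y, Or.inl hyS, hyW⟩
      rintro z ⟨hz, hz'⟩
      exact (h2 hz).resolve_right hz'
    · have h1 : BI s (S \ {w}) := by
        rw [← BI_upd (k := k) (w := w) (y := y) ⟨fun h => absurd rfl h.2, fun h => absurd h.1 hyS⟩]
        exact hS.diff hsB
      have h2 := hW.2.2 _ h1 ⟨x, ⟨hxS, hxW.2⟩, hxW.1⟩
      exact absurd (h2 hyW).1 hyS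
  have hcard : W.ncard = (W \ {w}).ncard + 1 := (Set.ncard_sdiff_singleton_add_one hw (Set.toFinite _)).symm
  have hp' : pl s' (W \ {w}) = (W \ {w}).ncard + 2 := by
    have hu : W = {w} ∪ (W \ {w}) := by
      rw [Set.union_sdiff_cancel]; simpa using hw
    have h1 : pl s' W = pl s' {w} + pl s' (W \ {w}) := by
      conv_lhs => rw [hu]
      exact pl_union hsB fun x hx => hx.2
    have h2 : pl s' {w} = 3 := by
      unfold pl bc cyc; rw [cls_singleton, cls_singleton, cls_singleton]
    have h3 := bc_upd_same hik hwy hw hyW (sc_bc (hi.trans hky.symm))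
    have h4 := bc_upd_same hjk hwy hw hyW (sc_bc (hj.trans hky.symm))
    have h5 := bc_upd_other (s := s) (W := W) (x := w) (y := y) hik hjk
    have h6 := pl_eq (s := s) (W := W) hij hik hjk
    have h7 := pl_eq (s := s') (W := W) hij hik hjk
    rw [← hs'] at h3 h4 h5
    omega
  obtain ⟨lab, l1, l2⟩ := IH s' τ _ (by omega) hW' hp' hM'
  refine ⟨fun u => if u = b then w else lab u, ?_, ?_⟩
  · intro x hx a
    have hxw : x ≠ w := by rintro rfl; exact hx hw
    have hxy : x ≠ y := by rintro rfl; exact hx hyW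
    have e1 : s a x ≠ b := fun h => hx ((hW.2.1 a i x w (h.trans hi.symm)).2 hw)
    have e2 : τ x ≠ b := fun h => hxw (τ.injective (h.trans hτ.symm))
    simp only [if_neg e1, if_neg e2]
    have := l1 x (fun h => hx h.1) a
    rwa [hs', upd_of_ne a hxw hxy] at this
  · intro v hv
    by_cases hvw : v = w
    · simp [hvw, hτ]
    · have e2 : τ v ≠ b := fun h => hvw (τ.injective (h.trans hτ.symm))
      simp only [if_neg e2]
      exact l2 v ⟨hv, hvw⟩

end
end PB

namespace PB
open Equiv

section
variable {V : Type*} [Finite V] [DecidableEq V] {s : Fin 3 → Perm V} {τ t : Perm V} {W : Set V}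
variable {i j k : Fin 3} {w1 w2 b1 b2 y1 y2 : V}

/-- a bicolored cycle of length four of colors `i, j` in a bubble -/
structure Quad {V : Type*} (s : Fin 3 → Perm V) (W : Set V) (i j k : Fin 3)
    (w1 w2 b1 b2 y1 y2 : V) : Prop where
  hij : i ≠ j
  hik : i ≠ k
  hjk : j ≠ k
  bub : Bub s W
  m1 : w1 ∈ W
  m2 : w2 ∈ W
  i1 : s i w1 = b1
  i2 : s i w2 = b2
  j1 : s j w1 = b2
  j2 : s j w2 = b1
  k1 : s k y1 = b1
  k2 : s k y2 = b2
  n : w1 ≠ w2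
  n11 : y1 ≠ w1
  n12 : y1 ≠ w2
  n21 : y2 ≠ w1
  n22 : y2 ≠ w2

/-- the twice modified bubble -/
def qs {V : Type*} [DecidableEq V] (s : Fin 3 → Perm V) (k : Fin 3) (w1 w2 y1 y2 : V) :
    Fin 3 → Perm V := upd (upd s k w1 y1) k w2 y2

namespace Quad

theorem flip (q : Quad s W i j k w1 w2 b1 b2 y1 y2) : Quad s W i j k w2 w1 b2 b1 y2 y1 :=
  ⟨q.hij, q.hik, q.hjk, q.bub, q.m2, q.m1, q.i2, q.i1, q.j2, q.j1, q.k2, q.k1, q.n.symm,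
    q.n22, q.n21, q.n12, q.n11⟩

theorem rot (q : Quad s W i j k w1 w2 b1 b2 y1 y2) : Quad s W j i k w1 w2 b2 b1 y2 y1 :=
  ⟨q.hij.symm, q.hjk, q.hik, q.bub, q.m1, q.m2, q.j1, q.j2, q.i1, q.i2, q.k2, q.k1, q.n,
    q.n21, q.n22, q.n11, q.n12⟩

theorem nb (q : Quad s W i j k w1 w2 b1 b2 y1 y2) : b1 ≠ b2 := by
  rw [← q.i1, ← q.i2]; exact fun h => q.n ((s i).injective h)

theorem ny (q : Quad s W i j k w1 w2 b1 b2 y1 y2) : y1 ≠ y2 := by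
  intro h; apply q.nb; rw [← q.k1, ← q.k2, h]

theorem my1 (q : Quad s W i j k w1 w2 b1 b2 y1 y2) : y1 ∈ W :=
  (q.bub.2.1 i k w1 y1 (q.i1.trans q.k1.symm)).1 q.m1

theorem my2 (q : Quad s W i j k w1 w2 b1 b2 y1 y2) : y2 ∈ W := q.flip.my1

theorem sk1 (q : Quad s W i j k w1 w2 b1 b2 y1 y2) : upd s k w1 y1 k w1 = b1 := by
  rw [upd_left, q.k1]

theorem sky2 (q : Quad s W i j k w1 w2 b1 b2 y1 y2) : upd s k w1 y1 k y2 = b2 := by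
  rw [upd_of_ne _ q.n21 q.ny.symm, q.k2]

theorem qk1 (q : Quad s W i j k w1 w2 b1 b2 y1 y2) : qs s k w1 w2 y1 y2 k w1 = b1 := by
  rw [qs, upd_of_ne _ q.n q.n21.symm, q.sk1]

theorem qk2 (q : Quad s W i j k w1 w2 b1 b2 y1 y2) : qs s k w1 w2 y1 y2 k w2 = b2 := by
  rw [qs, upd_left, q.sky2]

theorem qi (q : Quad s W i j k w1 w2 b1 b2 y1 y2) : qs s k w1 w2 y1 y2 i = s i := by
  rw [qs, upd_ne q.hik, upd_ne q.hik]

theorem qj (q : Quad s W i j k w1 w2 b1 b2 y1 y2) : qs s k w1 w2 y1 y2 j = s j := by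
  rw [qs, upd_ne q.hjk, upd_ne q.hjk]

theorem BI_pair (q : Quad s W i j k w1 w2 b1 b2 y1 y2) : BI (qs s k w1 w2 y1 y2) {w1, w2} := by
  have key : ∀ a z, qs s k w1 w2 y1 y2 a z = b1 ∨ qs s k w1 w2 y1 y2 a z = b2 ↔
      z ∈ ({w1, w2} : Set V) := by
    intro a z
    simp only [Set.mem_insert_iff, Set.mem_singleton_iff]
    rcases all3 q.hij q.hik q.hjk a with rfl | rfl | rfl
    · rw [q.qi]; nth_rw 1 [← q.i1]; rw [← q.i2]; simp
    · rw [q.qj]; nth_rw 1 [← q.j2]; rw [← q.j1]; simp [or_comm]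
    · constructor
      · rintro (h | h)
        · rw [← q.qk1] at h; exact Or.inl ((Equiv.injective _) h)
        · rw [← q.qk2] at h; exact Or.inr ((Equiv.injective _) h)
      · rintro (rfl | rfl)
        · exact Or.inl q.qk1
        · exact Or.inr q.qk2
  intro a c z u e
  rw [← key a, ← key c, e]

theorem CI_pair (q : Quad s W i j k w1 w2 b1 b2 y1 y2) (h1 : t w1 = b1) (h2 : t w2 = b2) :
    CI (qs s k w1 w2 y1 y2) t {w1, w2} := by
  rw [CI_iff]
  intro a
  apply mem_of_maps
  have e : ∀ z ∈ ({w1, w2} : Set V), ∃ z' ∈ ({w1, w2} : Set V), t z = qs s k w1 w2 y1 y2 i z' := by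
    rintro z (rfl | rfl)
    · exact ⟨z, Or.inl rfl, by rw [h1, q.qi, q.i1]⟩
    · exact ⟨z, Or.inr rfl, by rw [h2, q.qi, q.i2]⟩
  intro z hz
  obtain ⟨z', hz', e⟩ := e z hz
  exact (q.BI_pair a i _ z' (by rw [← e, s_rho])).2 hz'

theorem hF (q : Quad s W i j k w1 w2 b1 b2 y1 y2) (h1 : t w1 = b1) (h2 : t w2 = b2) :
    F (qs s k w1 w2 y1 y2) t = F s t + 2 := by
  rw [qs, F_ctr q.n22.symm (h2.trans q.sky2.symm), F_ctr q.n11.symm (h1.trans q.k1.symm)]; ring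

theorem y_notMem1 (q : Quad s W i j k w1 w2 b1 b2 y1 y2) : y1 ∉ ({w1, w2} : Set V) := by
  rintro (h | h)
  · exact q.n11 h
  · exact q.n12 h

theorem y_notMem2 (q : Quad s W i j k w1 w2 b1 b2 y1 y2) : y2 ∉ ({w1, w2} : Set V) := by
  rintro (h | h)
  · exact q.n21 h
  · exact q.n22 h

theorem N2 (q : Quad s W i j k w1 w2 b1 b2 y1 y2) (h1 : t w1 = b1) (h2 : t w2 = b2) :
    N (qs s k w1 w2 y1 y2) t = N (upd s k w1 y1) t + 1 :=
  N_ctr (h2.trans q.sky2.symm) fun hr =>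
    q.y_notMem2 ((hr _ (q.CI_pair h1 h2)).1 (Or.inr rfl))

theorem Ph_joined (q : Quad s W i j k w1 w2 b1 b2 y1 y2) (h1 : t w1 = b1) (h2 : t w2 = b2)
    (hr : Rl (CI (qs s k w1 w2 y1 y2) t) y1 y2) :
    Ph (qs s k w1 w2 y1 y2) t = Ph s t - 1 := by
  have e1 := q.hF h1 h2
  have e2 := q.N2 h1 h2
  have e3 : N (upd s k w1 y1) t = N s t := by
    apply N_ctr' (h1.trans q.k1.symm)
    intro S hS
    obtain ⟨c1, c2⟩ := (CI_ctr (h2.trans q.sky2.symm) S).1 hS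
    have c3 : w1 ∈ S ↔ w2 ∈ S := hS.BI i j w1 w2 (by
      rw [upd_ne q.hik, upd_ne q.hjk, q.i1, q.j2])
    rw [c3, c2]; exact (hr S c1).symm
  unfold Ph; rw [e1, e2, e3]; ring

theorem Ph_splitted (q : Quad s W i j k w1 w2 b1 b2 y1 y2) (h1 : t w1 = b1) (h2 : t w2 = b2)
    (hr : ¬ Rl (CI (qs s k w1 w2 y1 y2) t) y1 y2) :
    Ph (qs s k w1 w2 y1 y2) t = Ph s t - 4 := by
  have e1 := q.hF h1 h2
  have e2 := q.N2 h1 h2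
  have e3 : N (upd s k w1 y1) t = N s t + 1 := by
    apply N_ctr (h1.trans q.k1.symm)
    intro hr'
    set C := cl (CI (qs s k w1 w2 y1 y2) t) y1 with hC
    have hCI : CI (qs s k w1 w2 y1 y2) t C := (good_CI _ _).cl y1
    have n1 : w1 ∉ C := fun h => q.y_notMem1 ((h _ (q.CI_pair h1 h2)).2 (Or.inl rfl))
    have n2 : w2 ∉ C := fun h => q.y_notMem1 ((h _ (q.CI_pair h1 h2)).2 (Or.inr rfl))
    have n3 : y2 ∉ C := hr
    have : CI (upd s k w1 y1) t C := by
      rw [CI_ctr (h2.trans q.sky2.symm)]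
      exact ⟨hCI, fun h => absurd h n2, fun h => absurd h n3⟩
    exact n1 ((hr' C this).2 (Rl.refl _ _))
  unfold Ph; rw [e1, e2, e3]; ring

theorem good_two (q : Quad s W i j k w1 w2 b1 b2 y1 y2) (t : Perm V) :
    ∃ t', t' w1 = b1 ∧ t' w2 = b2 ∧ Ph (qs s k w1 w2 y1 y2) t ≤ Ph (qs s k w1 w2 y1 y2) t' ∧
      ∀ x, x ≠ w1 → x ≠ w2 → t x ≠ b1 → t x ≠ b2 → t' x = t x := by
  obtain ⟨t1, g1, l1, k1⟩ := make_good (s := qs s k w1 w2 y1 y2) q.hik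
    (by rw [q.qi]; exact q.i1) q.qk1 t
  obtain ⟨t2, g2, l2, k2⟩ := make_good (s := qs s k w1 w2 y1 y2) q.hik
    (by rw [q.qi]; exact q.i2) q.qk2 t1
  refine ⟨t2, ?_, g2, l1.trans l2, ?_⟩
  · rw [k2 w1 q.n (by rw [g1]; exact q.nb), g1]
  · intro x x1 x2 x3 x4
    have e := k1 x x1 x3
    rw [k2 x x2 (by rw [e]; exact x4), e]

theorem BI_W (q : Quad s W i j k w1 w2 b1 b2 y1 y2) : BI (qs s k w1 w2 y1 y2) W := by
  rw [qs, BI_upd ⟨fun _ => q.my2, fun _ => q.m2⟩, BI_upd ⟨fun _ => q.my1, fun _ => q.m1⟩]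
  exact q.bub.2.1

theorem pl_pair (q : Quad s W i j k w1 w2 b1 b2 y1 y2) : pl (qs s k w1 w2 y1 y2) {w1, w2} = 4 := by
  rw [pl_eq q.hij q.hik q.hjk]
  have h1 : bc (qs s k w1 w2 y1 y2) i j {w1, w2} = 1 :=
    cls_pair (sc_bc (by rw [q.qi, q.qj, q.i1, q.j2]))
  have h2 : bc (qs s k w1 w2 y1 y2) j k {w1, w2} = 1 :=
    cls_pair (sc_bc (by rw [q.qj, q.qk2, q.j1]))
  have h3 : bc (qs s k w1 w2 y1 y2) i k {w1, w2} = 2 := by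
    unfold bc
    rw [cyc_fixed, Set.ncard_pair q.n]
    rintro x (rfl | rfl)
    · rw [Perm.mul_apply, q.qk1, ← q.i1, q.qi]; simp
    · rw [Perm.mul_apply, q.qk2, ← q.i2, q.qi]; simp
  omega

theorem pl_W (q : Quad s W i j k w1 w2 b1 b2 y1 y2) :
    (sc ((s j)⁻¹ * s k) w1 y1 ∧ pl (qs s k w1 w2 y1 y2) W = pl s W + 4) ∨
    (¬ sc ((s j)⁻¹ * s k) w1 y1 ∧ pl (qs s k w1 w2 y1 y2) W = pl s W + 2) := by
  have e1 := pl_eq (s := s) (W := W) q.hij q.hik q.hjk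
  have e2 := pl_eq (s := qs s k w1 w2 y1 y2) (W := W) q.hij q.hik q.hjk
  have c1 : bc (qs s k w1 w2 y1 y2) i j W = bc s i j W := by
    rw [qs, bc_upd_other q.hik q.hjk, bc_upd_other q.hik q.hjk]
  have c2 : bc (qs s k w1 w2 y1 y2) i k W = bc s i k W + 2 := by
    rw [qs, bc_upd_same q.hik q.n22.symm q.m2 q.my2, bc_upd_same q.hik q.n11.symm q.m1 q.my1]
    · exact sc_bc (q.i1.trans q.k1.symm)
    · exact sc_bc (by rw [upd_ne q.hik, q.i2, q.sky2])
  have c3 : bc (qs s k w1 w2 y1 y2) j k W = bc (upd s k w1 y1) j k W + 1 := by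
    rw [qs, bc_upd_same q.hjk q.n22.symm q.m2 q.my2]
    have h1 : sc ((upd s k w1 y1 j)⁻¹ * upd s k w1 y1 k) w2 w1 :=
      sc_bc (by rw [upd_ne q.hjk, q.j2, q.sk1])
    have h2 : sc ((upd s k w1 y1 j)⁻¹ * upd s k w1 y1 k) w1 y2 :=
      sc_bc (by rw [upd_ne q.hjk, q.j1, q.sky2])
    exact h1.trans h2
  by_cases h : sc ((s j)⁻¹ * s k) w1 y1
  · left
    have c4 := bc_upd_same q.hjk q.n11.symm q.m1 q.my1 h
    exact ⟨h, by omega⟩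
  · right
    have c4 := bc_upd_not q.hjk q.m1 q.my1 h
    exact ⟨h, by omega⟩

theorem pair_sub (q : Quad s W i j k w1 w2 b1 b2 y1 y2) : {w1, w2} ⊆ W := by
  rintro x (rfl | rfl)
  · exact q.m1
  · exact q.m2

theorem pl_diff (q : Quad s W i j k w1 w2 b1 b2 y1 y2) :
    pl (qs s k w1 w2 y1 y2) W = 4 + pl (qs s k w1 w2 y1 y2) (W \ {w1, w2}) := by
  have hu : W = {w1, w2} ∪ (W \ {w1, w2}) := by
    rw [Set.union_sdiff_cancel q.pair_sub]
  conv_lhs => rw [hu]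
  rw [pl_union q.BI_pair fun x hx => hx.2, q.pl_pair]

theorem card_diff (q : Quad s W i j k w1 w2 b1 b2 y1 y2) :
    W.ncard = (W \ {w1, w2}).ncard + 2 := by
  have := Set.ncard_sdiff_add_ncard_of_subset q.pair_sub (Set.toFinite _)
  rw [Set.ncard_pair q.n] at this; exact this.symm

theorem BI_qs (q : Quad s W i j k w1 w2 b1 b2 y1 y2) {S : Set V} (h1 : w1 ∈ S ↔ y1 ∈ S)
    (h2 : w2 ∈ S ↔ y2 ∈ S) : BI (qs s k w1 w2 y1 y2) S ↔ BI s S := by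
  rw [qs, BI_upd h2, BI_upd h1]

theorem qs_out (q : Quad s W i j k w1 w2 b1 b2 y1 y2) {x : V} (hx : x ∉ W) (a : Fin 3) :
    qs s k w1 w2 y1 y2 a x = s a x := by
  rw [qs, upd_of_ne, upd_of_ne]
  · rintro rfl; exact hx q.m1
  · rintro rfl; exact hx q.my1
  · rintro rfl; exact hx q.m2
  · rintro rfl; exact hx q.my2

theorem out1 (q : Quad s W i j k w1 w2 b1 b2 y1 y2) {x : V} (hx : x ∉ W) (a : Fin 3) :
    s a x ≠ b1 := fun h => hx ((q.bub.2.1 a i x w1 (h.trans q.i1.symm)).2 q.m1)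

theorem caseI (q : Quad s W i j k w1 w2 b1 b2 y1 y2) (hp : pl s W = W.ncard + 2) (hM : Mx s τ)
    (h1 : τ w1 = b1) (h2 : τ w2 = b2) (IH : IHP (V := V) W.ncard)
    (hr : Rl (BI (qs s k w1 w2 y1 y2)) y1 y2) : PP s τ W := by
  set s' := qs s k w1 w2 y1 y2 with hs'
  have hM' : Mx s' τ := by
    intro t
    obtain ⟨t', g1, g2, l, -⟩ := q.good_two t
    have e1 := q.Ph_joined g1 g2 (BI_conn _ hr)
    have e2 := q.Ph_joined h1 h2 (BI_conn _ hr)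
    have := hM t'
    rw [← hs'] at l e1 e2
    omega
  have hW' : Bub s' (W \ {w1, w2}) := by
    refine ⟨⟨y1, q.my1, q.y_notMem1⟩, q.BI_W.diff q.BI_pair, ?_⟩
    rintro S hS ⟨x, hxS, hxW⟩
    by_cases hyS : y1 ∈ S
    · have hyS2 : y2 ∈ S := (hr S hS).1 hyS
      have h1 : BI s (S ∪ {w1, w2}) := by
        rw [← q.BI_qs ⟨fun _ => Or.inl hyS, fun _ => Or.inr (Or.inl rfl)⟩
          ⟨fun _ => Or.inl hyS2, fun _ => Or.inr (Or.inr rfl)⟩]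
        exact hS.union q.BI_pair
      have h2 := q.bub.2.2 _ h1 ⟨y1, Or.inl hyS, q.my1⟩
      rintro z ⟨hz, hz'⟩
      exact (h2 hz).resolve_right hz'
    · have hyS2 : y2 ∉ S := fun h => hyS ((hr S hS).2 h)
      have h1 : BI s (S \ {w1, w2}) := by
        rw [← q.BI_qs ⟨fun h => absurd (Or.inl rfl) h.2, fun h => absurd h.1 hyS⟩
          ⟨fun h => absurd (Or.inr rfl) h.2, fun h => absurd h.1 hyS2⟩]
        exact hS.diff q.BI_pair
      have h2 := q.bub.2.2 _ h1 ⟨x, ⟨hxS, hxW.2⟩, hxW.1⟩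
      exact absurd (h2 q.my1).1 hyS
  have hp' : pl s' (W \ {w1, w2}) = (W \ {w1, w2}).ncard + 2 := by
    have e1 := hW'.euler
    have e2 := q.pl_diff
    have e3 := q.card_diff
    rw [← hs'] at e2
    rcases q.pl_W with ⟨_, e4⟩ | ⟨_, e4⟩ <;> rw [← hs'] at e4 <;> omega
  obtain ⟨lab, l1, l2⟩ := IH s' τ _ (by have := q.card_diff; omega) hW' hp' hM'
  refine ⟨fun u => if u = b1 then w1 else if u = b2 then w2 else lab u, ?_, ?_⟩
  · intro x hx a
    have c1 : τ x ≠ b1 := fun h => hx (by rw [τ.injective (h.trans h1.symm)]; exact q.m1)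
    have c2 : τ x ≠ b2 := fun h => hx (by rw [τ.injective (h.trans h2.symm)]; exact q.m2)
    simp only [if_neg c1, if_neg c2, if_neg (q.out1 hx a), if_neg (q.flip.out1 hx a)]
    have := l1 x (fun h => hx h.1) a
    rwa [hs', q.qs_out hx] at this
  · intro v hv
    by_cases e1 : v = w1
    · simp [e1, h1]
    by_cases e2 : v = w2
    · simp [e2, h2, q.nb.symm]
    have c1 : τ v ≠ b1 := fun h => e1 (τ.injective (h.trans h1.symm))
    have c2 : τ v ≠ b2 := fun h => e2 (τ.injective (h.trans h2.symm))
    simp only [if_neg c1, if_neg c2]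
    exact l2 v ⟨hv, by rintro (h | h) <;> contradiction⟩

end Quad

theorem Bub_cl (x : V) : Bub s (cl (BI s) x) := by
  refine ⟨⟨x, Rl.refl _ _⟩, (good_BI s).cl x, ?_⟩
  rintro S hS ⟨z, hz, hz'⟩ u hu
  exact ((hz'.symm.trans hu) S hS).1 hz

namespace Quad

theorem caseII (q : Quad s W i j k w1 w2 b1 b2 y1 y2) (hp : pl s W = W.ncard + 2) (hM : Mx s τ)
    (h1 : τ w1 = b1) (h2 : τ w2 = b2) (IH : IHP (V := V) W.ncard)
    (hr : ¬ Rl (BI (qs s k w1 w2 y1 y2)) y1 y2) : PP s τ W := by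
  classical
  set s' := qs s k w1 w2 y1 y2 with hs'
  set W1 := cl (BI s') y1 with hW1
  set W2 := cl (BI s') y2 with hW2
  have B1 : Bub s' W1 := Bub_cl y1
  have B2 : Bub s' W2 := Bub_cl y2
  have y1m : y1 ∈ W1 := Rl.refl _ _
  have y2m : y2 ∈ W2 := Rl.refl _ _
  have sub1 : W1 ⊆ W := fun z hz => (hz W q.BI_W).1 q.my1
  have sub2 : W2 ⊆ W := fun z hz => (hz W q.BI_W).1 q.my2
  have d1 : ∀ z ∈ W1, z ∉ ({w1, w2} : Set V) := fun z hz h => q.y_notMem1 ((hz _ q.BI_pair).2 h)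
  have d2 : ∀ z ∈ W2, z ∉ ({w1, w2} : Set V) := fun z hz h => q.y_notMem2 ((hz _ q.BI_pair).2 h)
  have d12 : ∀ z ∈ W2, z ∉ W1 := fun z hz h => hr (h.trans (Rl.symm hz))
  have a1 : w1 ∉ W1 := fun h => d1 _ h (Or.inl rfl)
  have a2 : w2 ∉ W1 := fun h => d1 _ h (Or.inr rfl)
  have c1 : w1 ∉ W2 := fun h => d2 _ h (Or.inl rfl)
  have hun : W \ {w1, w2} = W1 ∪ W2 := by
    apply Set.Subset.antisymm
    · have hB : BI s ({w1, w2} ∪ (W1 ∪ W2)) := by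
        rw [← q.BI_qs]
        · exact q.BI_pair.union (B1.2.1.union B2.2.1)
        · exact ⟨fun _ => Or.inr (Or.inl y1m), fun _ => Or.inl (Or.inl rfl)⟩
        · exact ⟨fun _ => Or.inr (Or.inr y2m), fun _ => Or.inl (Or.inr rfl)⟩
      rintro z ⟨hz, hz'⟩
      exact (q.bub.2.2 _ hB ⟨w1, Or.inl (Or.inl rfl), q.m1⟩ hz).resolve_left hz'
    · rintro z (hz | hz)
      · exact ⟨sub1 hz, d1 z hz⟩
      · exact ⟨sub2 hz, d2 z hz⟩
  have hsc : sc ((s j)⁻¹ * s k) w1 y1 := by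
    by_contra hsc
    have e := sc_swap_of_not hsc
    rw [← upd_bc q.hjk] at e
    have e' := bc_rel e
    have hB : BI (upd s k w1 y1) W1 := by
      have := B1.2.1
      rw [hs', qs, BI_upd] at this
      · exact this
      · exact ⟨fun h => absurd h a2, fun h => absurd h (d12 _ y2m)⟩
    exact a1 ((e' W1 hB).2 y1m)
  have hcard : (W \ {w1, w2}).ncard = W1.ncard + W2.ncard := by
    rw [hun, Set.ncard_union_eq _ (Set.toFinite _) (Set.toFinite _)]
    exact Set.disjoint_right.2 d12
  have hpl : pl s' (W \ {w1, w2}) = pl s' W1 + pl s' W2 := by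
    rw [hun, pl_union B1.2.1 d12]
  have E1 := B1.euler
  have E2 := B2.euler
  have hps : pl s' W1 = W1.ncard + 2 ∧ pl s' W2 = W2.ncard + 2 := by
    have e2 := q.pl_diff
    have e3 := q.card_diff
    rw [← hs'] at e2
    rcases q.pl_W with ⟨_, e4⟩ | ⟨e4, _⟩
    · rw [← hs'] at e4; omega
    · exact absurd hsc e4
  have lt1 : W1.ncard < W.ncard := by have := q.card_diff; omega
  have lt2 : W2.ncard < W.ncard := by have := q.card_diff; omega
  -- the maximum of the modified functional
  obtain ⟨t0, ht0⟩ := Finite.exists_max (Ph s')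
  have hMt0 : Mx s' t0 := ht0
  obtain ⟨t1, hMt1, hcl⟩ := exists_closed B1 hMt0 (IH s' t0 W1 lt1 B1 hps.1 hMt0)
  obtain ⟨t2, g1, g2, l, hk⟩ := q.good_two t1
  rw [← hs'] at l
  have hcl2 : ∀ x ∈ W1, t2 x ∈ Bk s' W1 := by
    intro x hx
    rw [hk x]
    · exact hcl x hx
    · rintro rfl; exact a1 hx
    · rintro rfl; exact a2 hx
    · intro h
      have := hcl x hx
      rw [h, ← q.i1, ← q.qi, ← hs', mem_Bk B1.2.1] at this
      exact a1 this
    · intro h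
      have := hcl x hx
      rw [h, ← q.i2, ← q.qi, ← hs', mem_Bk B1.2.1] at this
      exact a2 this
  have hCI : CI s' t2 W1 := by
    rw [CI_iff]
    intro a
    apply mem_of_maps
    intro z hz
    rw [← mem_Bk B1.2.1 a, s_rho]; exact hcl2 z hz
  have hsplit2 : ¬ Rl (CI s' t2) y1 y2 := fun h => d12 _ y2m ((h _ hCI).1 y1m)
  have P2 := q.Ph_splitted g1 g2 hsplit2
  rw [← hs'] at P2
  have hmm : ∀ t, Ph s' t ≤ Ph s τ - 4 := by
    intro t
    have e1 := hMt1 t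
    have e2 := hM t2
    omega
  have hsplit : ¬ Rl (CI s' τ) y1 y2 := by
    intro h
    have e1 := q.Ph_joined h1 h2 h
    have e2 := hmm τ
    rw [← hs'] at e1
    omega
  have hM' : Mx s' τ := by
    intro t
    have := q.Ph_splitted h1 h2 hsplit
    rw [← hs'] at this
    rw [this]; exact hmm t
  obtain ⟨lab1, p1, p2⟩ := IH s' τ W1 lt1 B1 hps.1 hM'
  obtain ⟨lab2, r1, r2⟩ := IH s' τ W2 lt2 B2 hps.2 hM'
  set S := cl (CI s' τ) y1 with hS
  have hSC : CI s' τ S := (good_CI _ _).cl y1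
  refine ⟨fun u => if u = b1 then w1 else if u = b2 then w2 else
    if τ⁻¹ u ∈ S then lab1 u else lab2 u, ?_, ?_⟩
  · intro x hx a
    have c1 : τ x ≠ b1 := fun h => hx (by rw [τ.injective (h.trans h1.symm)]; exact q.m1)
    have c2 : τ x ≠ b2 := fun h => hx (by rw [τ.injective (h.trans h2.symm)]; exact q.m2)
    simp only [if_neg c1, if_neg c2, if_neg (q.out1 hx a), if_neg (q.flip.out1 hx a)]
    have o1 := p1 x (fun h => hx (sub1 h)) a
    have o2 := r1 x (fun h => hx (sub2 h)) a
    have o3 := CI_inv hSC a x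
    have o4 : τ⁻¹ (τ x) = x := by simp
    rw [hs', q.qs_out hx] at o1 o2 o3
    rw [o4, o1, o2]
    simp only [o3]
  · intro v hv
    by_cases e1 : v = w1
    · simp [e1, h1]
    by_cases e2 : v = w2
    · simp [e2, h2, q.nb.symm]
    have c1 : τ v ≠ b1 := fun h => e1 (τ.injective (h.trans h1.symm))
    have c2 : τ v ≠ b2 := fun h => e2 (τ.injective (h.trans h2.symm))
    have o4 : τ⁻¹ (τ v) = v := by simp
    simp only [if_neg c1, if_neg c2, o4]
    have hv2 : v ∈ W1 ∪ W2 := by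
      rw [← hun]; exact ⟨hv, by rintro (h | h) <;> contradiction⟩
    rcases hv2 with hv2 | hv2
    · have : v ∈ S := B1.conn τ y1m hv2
      rw [if_pos this]; exact p2 v hv2
    · have : v ∉ S := fun h => hsplit (h.trans (B2.conn τ hv2 y2m))
      rw [if_neg this]; exact r2 v hv2

theorem coreA (q : Quad s W i j k w1 w2 b1 b2 y1 y2) (hp : pl s W = W.ncard + 2) (hM : Mx s τ)
    (h1 : τ w1 = b1) (h2 : τ w2 = b2) (IH : IHP (V := V) W.ncard) : PP s τ W := by
  by_cases hr : Rl (BI (qs s k w1 w2 y1 y2)) y1 y2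
  · exact q.caseI hp hM h1 h2 IH hr
  · exact q.caseII hp hM h1 h2 IH hr

/-- one pair already matched -/
theorem caseA1 (q : Quad s W i j k w1 w2 b1 b2 y1 y2) (hp : pl s W = W.ncard + 2) (hM : Mx s τ)
    (h1 : τ w1 = b1) (IH : IHP (V := V) W.ncard) : PP s τ W := by
  by_cases h2 : τ w2 = b2
  · exact q.coreA hp hM h1 h2 IH
  set α := τ⁻¹ b2 with hα
  have htα : τ α = b2 := by simp [hα]
  have hwα : w2 ≠ α := by intro e; apply h2; rw [e, htα]
  have hi : sc (rho s τ i) w2 α := (sc_of_eq (rho_eq (q.i2.trans htα.symm))).symm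
  have hj : sc (rho s τ j) w2 α := by
    have e1 : sc (rho s τ j) w1 w2 := sc_of_eq (rho_eq (q.j2.trans h1.symm))
    have e2 : sc (rho s τ j) α w1 := sc_of_eq (rho_eq (q.j1.trans htα.symm))
    exact (e2.trans e1).symm
  obtain ⟨g1, g2⟩ := hM.two hwα q.hij hi hj
  apply unflip q.bub q.m2 g1
  apply q.coreA hp g2 _ _ IH
  · rw [Perm.mul_apply, swap_apply_of_ne_of_ne q.n, h1]
    intro e; rw [← e, h1] at htα; exact q.nb htα
  · rw [Perm.mul_apply, swap_apply_left, htα]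

end Quad
end
end PB

namespace PB
open Equiv

section
variable {V : Type*} [Finite V] [DecidableEq V] {s : Fin 3 → Perm V} {τ t : Perm V} {W : Set V}
variable {i j k : Fin 3} {w1 w2 b1 b2 y1 y2 : V}

theorem Ph_three {x y : V} (hxy : x ≠ y) (h : ∀ a, sc (rho s τ a) x y)
    (hc : Rl (CI s (τ * swap x y)) x y) : Ph s (τ * swap x y) = Ph s τ + 3 := by
  have hN := N_same (sc_conn (h 0)) hc
  unfold Ph
  rw [F_eq 0 1 2 (by decide) (by decide) (by decide),
    F_eq 0 1 2 (by decide) (by decide) (by decide), rho_cyc_same hxy (h 0), rho_cyc_same hxy (h 1),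
    rho_cyc_same hxy (h 2), hN]
  ring

theorem sc_mono {ρ : Perm V} {x y u v : V} (h : ¬ sc ρ x y) (huv : sc ρ u v) :
    sc (ρ * swap x y) u v := by
  intro S hS
  exact huv S ((I1_mul_swap (sc_swap_of_not h S hS)).1 hS)

theorem walk {lab : V → V} (h1 : ∀ x, x ∉ W → ∀ a, lab (s a x) = lab (τ x))
    (h2 : ∀ w ∈ W, lab (τ w) = w) (c : Fin 3) (α : V) :
    (lab (τ α) ∈ W ∧ sc (rho s τ c) α (lab (τ α))) ∨
      ∀ z, sc (rho s τ c) α z → z ∉ W ∧ lab (τ z) = lab (τ α) := by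
  by_cases hex : ∃ z, sc (rho s τ c) α z ∧ lab (τ z) = lab (τ α) ∧ z ∈ W
  · obtain ⟨z, hz, hz', hzW⟩ := hex
    left
    rw [← hz', h2 z hzW]; exact ⟨hzW, hz⟩
  · right
    set S : Set V := {z | sc (rho s τ c) α z ∧ lab (τ z) = lab (τ α)} with hS
    have hSW : ∀ z ∈ S, z ∉ W := fun z hz hzW => hex ⟨z, hz.1, hz.2, hzW⟩
    have hI : I1 (rho s τ c)⁻¹ S := by
      apply mem_of_maps
      intro z hz
      have hzz : rho s τ c ((rho s τ c)⁻¹ z) = z := by simp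
      have e : s c z = τ ((rho s τ c)⁻¹ z) := by rw [← s_rho s τ c, hzz]
      refine ⟨hz.1.trans (sc_of_eq hzz).symm, ?_⟩
      rw [← e, h1 z (hSW z hz)]; exact hz.2
    intro z hz
    have : z ∈ S := ((sc_inv.2 hz) S hI).1 ⟨Rl.refl _ _, rfl⟩
    exact ⟨hSW z this, this.2⟩

theorem cutset (hW : Bub s W) (hM : Mx s t) {α v : V} (hv : v ∈ W) (hjk : j ≠ k)
    (hj : sc (rho s t j) α v) (hk : sc (rho s t k) α v) :
    ∃ T : Set V, t α ∉ T ∧ (α ≠ v → t v ∈ T ∧ ∀ a, s a α ∈ T) ∧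
      ∀ x, x ≠ α → x ≠ v → ∀ a, (s a x ∈ T ↔ t x ∈ T) := by
  by_cases hα : α = v
  · exact ⟨∅, by simp, fun h => absurd hα h, by simp⟩
  obtain ⟨hs, -⟩ := hM.two hα hjk hj hk
  set t' := t * swap α v with ht'
  set S := cl (CI s t') α with hS
  have hSC : CI s t' S := (good_CI _ _).cl α
  have hαS : α ∈ S := Rl.refl _ _
  have hvS : v ∉ S := hs
  have hB := hSC.BI
  have key : ∀ x, t' x ∈ Bk s S ↔ x ∈ S := by
    intro x
    rw [← s_rho s t' 0, mem_Bk hB]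
    exact CI_iff.1 hSC 0 x
  refine ⟨Bk s S, ?_, fun _ => ⟨?_, fun a => (mem_Bk hB a α).2 hαS⟩, ?_⟩
  · have : t α = t' v := by rw [ht', Perm.mul_apply, swap_apply_right]
    rw [this, key]; exact hvS
  · have : t v = t' α := by rw [ht', Perm.mul_apply, swap_apply_left]
    rw [this, key]; exact hαS
  · intro x hx hx' a
    have : t x = t' x := by rw [ht', Perm.mul_apply, swap_apply_of_ne_of_ne hx hx']
    rw [this, key, mem_Bk hB]

namespace Quad

theorem caseA (q : Quad s W i j k w1 w2 b1 b2 y1 y2) (hp : pl s W = W.ncard + 2) (hM : Mx s τ)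
    (h : τ w1 = b1 ∨ τ w1 = b2 ∨ τ w2 = b1 ∨ τ w2 = b2) (IH : IHP (V := V) W.ncard) :
    PP s τ W := by
  rcases h with h | h | h | h
  · exact q.caseA1 hp hM h IH
  · exact q.rot.caseA1 hp hM h IH
  · exact q.flip.rot.caseA1 hp hM h IH
  · exact q.flip.caseA1 hp hM h IH

/-- relabelling at the end of case B -/
theorem relabel (q : Quad s W i j k w1 w2 b1 b2 y1 y2) {t : Perm V} {α1 α2 v1 v2 : V}
    {lab : V → V} (l1 : ∀ x, x ∉ W → ∀ a, lab (s a x) = lab (t x)) (l2 : ∀ w ∈ W, lab (t w) = w)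
    {T1 T2 : Set V} (t1 : t w1 = b1) (t2 : t w2 = b2)
    (p1 : τ α1 = b1) (p2 : τ α2 = b2) (p3 : τ w1 = t α1) (p4 : τ w2 = t α2)
    (p5 : ∀ x, x ≠ w1 → x ≠ w2 → x ≠ α1 → x ≠ α2 → τ x = t x)
    (n11 : α1 ≠ w1) (n12 : α1 ≠ w2) (n21 : α2 ≠ w1) (n22 : α2 ≠ w2)
    (e1 : lab (t α1) = v1) (e2 : lab (t α2) = v2) (m1 : v1 ∈ W) (m2 : v2 ∈ W)
    (c12 : v1 ≠ v2) (c1 : v1 ≠ α2) (c2 : v2 ≠ α1)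
    (d11 : v1 ≠ w1) (d12 : v1 ≠ w2) (d21 : v2 ≠ w1) (d22 : v2 ≠ w2)
    (f1 : t α1 ∉ T1) (g1 : α1 ≠ v1 → t v1 ∈ T1 ∧ ∀ a, s a α1 ∈ T1)
    (k1 : ∀ x, x ≠ α1 → x ≠ v1 → ∀ a, (s a x ∈ T1 ↔ t x ∈ T1))
    (f2 : t α2 ∉ T2) (g2 : α2 ≠ v2 → t v2 ∈ T2 ∧ ∀ a, s a α2 ∈ T2)
    (k2 : ∀ x, x ≠ α2 → x ≠ v2 → ∀ a, (s a x ∈ T2 ↔ t x ∈ T2)) : PP s τ W := by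
  classical
  have tb1 : ∀ x, x ≠ w1 → t x ≠ b1 := fun x hx h => hx (t.injective (h.trans t1.symm))
  have tb2 : ∀ x, x ≠ w2 → t x ≠ b2 := fun x hx h => hx (t.injective (h.trans t2.symm))
  refine ⟨fun u => if u = b1 then v1 else if u = b2 then v2 else
    if lab u = v1 then (if u ∈ T1 then v1 else w1) else
    if lab u = v2 then (if u ∈ T2 then v2 else w2) else lab u, ?_, ?_⟩
  · intro x hx a
    have sb1 : s a x ≠ b1 := q.out1 hx a
    have sb2 : s a x ≠ b2 := q.flip.out1 hx a
    have xv1 : x ≠ v1 := by rintro rfl; exact hx m1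
    have xv2 : x ≠ v2 := by rintro rfl; exact hx m2
    have xw1 : x ≠ w1 := by rintro rfl; exact hx q.m1
    have xw2 : x ≠ w2 := by rintro rfl; exact hx q.m2
    have hl := l1 x hx a
    simp only [if_neg sb1, if_neg sb2]
    by_cases h1 : x = α1
    · subst h1
      rw [e1] at hl
      simp [hl, p1, (g1 xv1).2 a]
    by_cases h2 : x = α2
    · subst h2
      rw [e2] at hl
      simp [hl, p2, (g2 xv2).2 a, c12.symm, q.nb.symm]
    rw [p5 x xw1 xw2 h1 h2]
    simp only [if_neg (tb1 x xw1), if_neg (tb2 x xw2), hl, k1 x h1 xv1 a, k2 x h2 xv2 a]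
  · intro v hv
    by_cases h1 : v = w1
    · subst h1
      rw [p3]
      simp [tb1 _ n11, tb2 _ n12, e1, f1]
    by_cases h2 : v = w2
    · subst h2
      rw [p4]
      simp [tb1 _ n21, tb2 _ n22, e2, f2, c12.symm]
    by_cases h3 : v = α1
    · have : v = v1 := by rw [← e1, ← h3, l2 v hv]
      simp [h3, p1, ← this]
    by_cases h4 : v = α2
    · have : v = v2 := by rw [← e2, ← h4, l2 v hv]
      simp [h4, p2, ← this, q.nb.symm]
    rw [p5 v h1 h2 h3 h4]
    simp only [if_neg (tb1 v h1), if_neg (tb2 v h2), l2 v hv]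
    by_cases h5 : v = v1
    · subst h5
      simp [(g1 (fun h => h3 h.symm)).1]
    by_cases h6 : v = v2
    · subst h6
      simp [(g2 (fun h => h4 h.symm)).1, h5]
    simp [h5, h6]

theorem split_case (q : Quad s W i j k w1 w2 b1 b2 y1 y2) (hp : pl s W = W.ncard + 2)
    (hM : Mx s τ) (IH : IHP (V := V) W.ncard) {w α b : V} (hw : w = w1 ∨ w = w2)
    (hb : b = b1 ∨ b = b2) (hα : τ α = b) (hs : ¬ Rl (CI s (τ * swap w α)) w α) : PP s τ W := by
  have hwW : w ∈ W := by
    rcases hw with rfl | rfl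
    · exact q.m1
    · exact q.m2
  apply unflip q.bub hwW hs
  apply q.caseA hp (hM.congr (Ph_split hs)) _ IH
  have : (τ * swap w α) w = b := by rw [Perm.mul_apply, swap_apply_left, hα]
  rcases hw with rfl | rfl <;> rcases hb with rfl | rfl
  · exact Or.inl this
  · exact Or.inr (Or.inl this)
  · exact Or.inr (Or.inr (Or.inl this))
  · exact Or.inr (Or.inr (Or.inr this))

theorem main (q : Quad s W i j k w1 w2 b1 b2 y1 y2) (hp : pl s W = W.ncard + 2)
    (hM : Mx s τ) (IH : IHP (V := V) W.ncard) : PP s τ W := by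
  by_cases hA : τ w1 = b1 ∨ τ w1 = b2 ∨ τ w2 = b1 ∨ τ w2 = b2
  · exact q.caseA hp hM hA IH
  push Not at hA
  obtain ⟨A11, A12, A21, A22⟩ := hA
  obtain ⟨α1, p1⟩ := τ.surjective b1
  obtain ⟨α2, p2⟩ := τ.surjective b2
  have n11 : α1 ≠ w1 := by rintro rfl; exact A11 p1
  have n12 : α1 ≠ w2 := by rintro rfl; exact A21 p1
  have n21 : α2 ≠ w1 := by rintro rfl; exact A12 p2
  have n22 : α2 ≠ w2 := by rintro rfl; exact A22 p2
  have nα : α1 ≠ α2 := by rintro rfl; exact q.nb (p1.symm.trans p2)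
  by_cases C11 : Rl (CI s (τ * swap w1 α1)) w1 α1
  swap; · exact q.split_case hp hM IH (Or.inl rfl) (Or.inl rfl) p1 C11
  by_cases C12 : Rl (CI s (τ * swap w1 α2)) w1 α2
  swap; · exact q.split_case hp hM IH (Or.inl rfl) (Or.inr rfl) p2 C12
  by_cases C21 : Rl (CI s (τ * swap w2 α1)) w2 α1
  swap; · exact q.split_case hp hM IH (Or.inr rfl) (Or.inl rfl) p1 C21
  by_cases C22 : Rl (CI s (τ * swap w2 α2)) w2 α2
  swap; · exact q.split_case hp hM IH (Or.inr rfl) (Or.inr rfl) p2 C22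
  have i11 : sc (rho s τ i) w1 α1 := (sc_of_eq (rho_eq (q.i1.trans p1.symm))).symm
  have i22 : sc (rho s τ i) w2 α2 := (sc_of_eq (rho_eq (q.i2.trans p2.symm))).symm
  have j12 : sc (rho s τ j) w1 α2 := (sc_of_eq (rho_eq (q.j1.trans p2.symm))).symm
  have j21 : sc (rho s τ j) w2 α1 := (sc_of_eq (rho_eq (q.j2.trans p1.symm))).symm
  obtain ⟨nj11, nk11, Ph11⟩ := hM.one n11.symm q.hij q.hik q.hjk i11 C11
  obtain ⟨nj22, nk22, Ph22⟩ := hM.one n22.symm q.hij q.hik q.hjk i22 C22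
  obtain ⟨ni12, nk12, -⟩ := hM.one n21.symm q.hij.symm q.hjk q.hik j12 C12
  obtain ⟨ni21, nk21, -⟩ := hM.one n12.symm q.hij.symm q.hjk q.hik j21 C21
  set t1 := τ * swap w1 α1 with ht1
  set t2 := τ * swap w2 α2 with ht2
  set t := t1 * swap w2 α2 with ht
  have ht' : t = t2 * swap w1 α1 := by
    rw [ht, ht1, ht2, mul_assoc, mul_assoc]
    congr 1
    have : (swap w1 α1).Disjoint (swap w2 α2) := by
      intro x
      by_cases h1 : x = w1
      · right; rw [h1, swap_apply_of_ne_of_ne q.n n21.symm]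
      by_cases h2 : x = α1
      · right; rw [h2, swap_apply_of_ne_of_ne n12 nα]
      left; exact swap_apply_of_ne_of_ne h1 h2
    exact this.commute
  have ht2' : t2 = t * swap w1 α1 := by rw [ht', swap_swap_cancel]
  have t1w1 : t1 w1 = b1 := by rw [ht1, Perm.mul_apply, swap_apply_left, p1]
  have t1α1 : t1 α1 = τ w1 := by rw [ht1, Perm.mul_apply, swap_apply_right]
  have t1o : ∀ x, x ≠ w1 → x ≠ α1 → t1 x = τ x := fun x h h' => by
    rw [ht1, Perm.mul_apply, swap_apply_of_ne_of_ne h h']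
  have tto : ∀ x, x ≠ w2 → x ≠ α2 → t x = t1 x := fun x h h' => by
    rw [ht, Perm.mul_apply, swap_apply_of_ne_of_ne h h']
  have tw1 : t w1 = b1 := by rw [tto _ q.n n21.symm, t1w1]
  have tw2 : t w2 = b2 := by rw [ht, Perm.mul_apply, swap_apply_left, t1o _ n21 nα.symm, p2]
  have tα1 : t α1 = τ w1 := by rw [tto _ n12 nα, t1α1]
  have tα2 : t α2 = τ w2 := by
    rw [ht, Perm.mul_apply, swap_apply_right, t1o _ q.n.symm n12.symm]
  have too : ∀ x, x ≠ w1 → x ≠ w2 → x ≠ α1 → x ≠ α2 → τ x = t x := fun x h1 h2 h3 h4 => by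
    rw [tto _ h2 h4, t1o _ h1 h3]
  -- in t1, the vertices w2 and α2 are in the same cycles of colors i and j
  have ti : sc (rho s t1 i) w2 α2 :=
    (sc_of_eq (rho_eq (q.i2.trans (by rw [t1o _ n21 nα.symm, p2])))).symm
  have tj : sc (rho s t1 j) w2 α2 := by
    have e1 : sc (rho s t1 j) α2 w1 :=
      sc_of_eq (rho_eq (q.j1.trans (by rw [t1o _ n21 nα.symm, p2])))
    have e2 : sc (rho s t1 j) w1 w2 := sc_of_eq (rho_eq (q.j2.trans t1w1.symm))
    exact (e1.trans e2).symm
  have hconn : Rl (CI s t) w2 α2 := by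
    by_contra hn
    set S := cl (CI s t) α2 with hS
    have hSC : CI s t S := (good_CI _ _).cl α2
    have hw2 : w2 ∉ S := fun h => hn (Rl.symm h)
    have hw1 : w1 ∉ S := fun h => hn (Rl.symm (Rl.trans h (q.bub.conn t q.m1 q.m2)))
    have hα2 : α2 ∈ S := Rl.refl _ _
    have hα1 : α1 ∈ S := by
      by_contra hα1
      have : CI s t2 S := by
        rw [ht2', CI_swap ⟨fun h => absurd h hw1, fun h => absurd h hα1⟩]; exact hSC
      exact hw2 ((C22 S this).2 hα2)
    set S0 := S ∩ cl (I1 (rho s τ k)) w1 with hS0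
    have hI : I1 (rho s τ k) S0 := by
      apply mem_of_maps
      rintro z ⟨hz, hz'⟩
      have z1 : z ≠ w1 := by rintro rfl; exact hw1 hz
      have z2 : z ≠ w2 := by rintro rfl; exact hw2 hz
      have z3 : z ≠ α1 := by rintro rfl; exact nk11 hz'
      have z4 : z ≠ α2 := by rintro rfl; exact nk12 hz'
      refine ⟨?_, Rl.trans hz' (sc_apply _ _)⟩
      have : rho s τ k z = rho s t k z := by
        rw [Perm.mul_apply, Perm.mul_apply, too z z1 z2 z3 z4]
      rw [this]
      exact (CI_iff.1 hSC k z).2 hz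
    have hz1 : rho s τ k w1 ∈ S0 := by
      refine ⟨?_, sc_apply _ _⟩
      have : rho s τ k w1 = rho s t k α1 := by
        rw [Perm.mul_apply, Perm.mul_apply, tα1]
      rw [this]
      exact (CI_iff.1 hSC k α1).2 hα1
    exact hw1 ((hI w1).1 hz1).1
  have hlt : Ph s t1 < Ph s t := by
    rcases Ph_two n22.symm q.hij ti tj with h | h
    · exact absurd hconn h.1
    · exact h.2
  have hPt : Ph s t = Ph s τ := by
    have := hM t
    omega
  have hMt : Mx s t := hM.congr hPt
  have tk : ¬ sc (rho s t1 k) w2 α2 := by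
    intro tk
    have := Ph_three (s := s) n22.symm (fun a => by
      rcases all3 q.hij q.hik q.hjk a with rfl | rfl | rfl
      · exact ti
      · exact tj
      · exact tk) hconn
    rw [← ht] at this; omega
  obtain ⟨lab, l1, l2⟩ := q.coreA hp hMt tw1 tw2 IH
  have f3b : sc (rho s t k) α2 w2 := by
    have := sc_swap_of_not tk
    rw [← rho_swap] at this; exact this.symm
  have f3a : sc (rho s t k) α1 w1 := by
    have h1 := sc_swap_of_not nk11
    rw [← rho_swap] at h1
    have h2 := sc_mono tk h1
    rw [← rho_swap] at h2; exact h2.symm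
  have hpair : I1 (rho s t j) {w1, w2} := by
    apply mem_of_maps
    rintro z (rfl | rfl)
    · right; exact rho_eq (q.j2.trans tw1.symm)
    · left; exact rho_eq (q.j1.trans tw2.symm)
  have np1 : α1 ∉ ({w1, w2} : Set V) := by
    rintro (h | h)
    · exact n11 h
    · exact n12 h
  have np2 : α2 ∉ ({w1, w2} : Set V) := by
    rintro (h | h)
    · exact n21 h
    · exact n22 h
  have f2 : sc (rho s t j) α1 α2 := by
    by_contra hn
    set C := cl (I1 (rho s t j)) α2 with hC
    have hCI : I1 (rho s t j) C := (good_I1 _).cl α2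
    have h1 : α1 ∉ C := fun h => hn (Rl.symm h)
    have h2 : w1 ∉ C := fun h => np2 ((h _ hpair).2 (Or.inl rfl))
    have h3 : w2 ∉ C := fun h => np2 ((h _ hpair).2 (Or.inr rfl))
    have h4 : I1 (rho s t2 j) C := by
      rw [ht2', rho_swap, I1_mul_swap ⟨fun h => absurd h h2, fun h => absurd h h1⟩]
      exact hCI
    have h5 := sc_swap_of_not nj22
    rw [← rho_swap] at h5
    exact h3 ((h5 C h4).2 (Rl.refl _ _))
  have f1 : ¬ sc (rho s t i) α1 α2 := by
    intro hn
    set C := cl (I1 (rho s τ i)) α2 with hC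
    have hCI : I1 (rho s τ i) C := (good_I1 _).cl α2
    have h1 : w2 ∈ C := i22.symm
    have h2 : w1 ∉ C := fun h => ni12 (Rl.symm h)
    have h3 : α1 ∉ C := fun h => h2 (Rl.trans h i11.symm)
    have h4 : I1 (rho s t i) C := by
      rw [ht, rho_swap, I1_mul_swap ⟨fun _ => Rl.refl _ _, fun _ => h1⟩, ht1, rho_swap,
        I1_mul_swap ⟨fun h => absurd h h2, fun h => absurd h h3⟩]
      exact hCI
    exact h3 ((hn C h4).2 (Rl.refl _ _))
  have f3 : ¬ sc (rho s t k) α1 α2 := fun h =>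
    f1 (sc_of_split (hMt.two nα q.hjk f2 h).1 i)
  have wk1 := (walk l1 l2 k α1).resolve_right fun h => (h w1 f3a).1 q.m1
  have wk2 := (walk l1 l2 k α2).resolve_right fun h => (h w2 f3b).1 q.m2
  have c12 : lab (t α1) ≠ lab (t α2) := fun h => f3 (by
    have := wk1.2
    rw [h] at this
    exact this.trans wk2.2.symm)
  have wj1 := (walk l1 l2 j α1).resolve_right fun h => c12 (h α2 f2).2.symm
  have wj2 := (walk l1 l2 j α2).resolve_right fun h => c12 (h α1 f2.symm).2
  obtain ⟨T1, T1a, T1b, T1c⟩ := cutset q.bub hMt wk1.1 q.hjk wj1.2 wk1.2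
  obtain ⟨T2, T2a, T2b, T2c⟩ := cutset q.bub hMt wk2.1 q.hjk wj2.2 wk2.2
  refine q.relabel l1 l2 tw1 tw2 p1 p2 tα1.symm tα2.symm too n11 n12 n21 n22 rfl rfl wk1.1 wk2.1
    c12 ?_ ?_ ?_ ?_ ?_ ?_ T1a T1b T1c T2a T2b T2c
  · intro h; have := wk1.2; rw [h] at this; exact f3 this
  · intro h; have := wk2.2; rw [h] at this; exact f3 this.symm
  · intro h; exact np1 ((wj1.2 _ hpair).2 (Or.inl h))
  · intro h; exact np1 ((wj1.2 _ hpair).2 (Or.inr h))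
  · intro h; exact np2 ((wj2.2 _ hpair).2 (Or.inl h))
  · intro h; exact np2 ((wj2.2 _ hpair).2 (Or.inr h))

end Quad

theorem main_ind (n : ℕ) : IHP (V := V) n := by
  induction n with
  | zero => intro s τ W h; omega
  | succ n ih =>
  intro s τ W hlt hW hp hM
  have IH : IHP (V := V) W.ncard := fun s τ W' h => ih s τ W' (by omega)
  by_cases hd : ∃ i j : Fin 3, i ≠ j ∧ ∃ w ∈ W, s i w = s j w
  · obtain ⟨i, j, hij, w, hw, e⟩ := hd
    obtain ⟨k, hik, hjk⟩ := other3 hij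
    exact dipole hW hp hM hij hik hjk hw e rfl IH
  push Not at hd
  obtain ⟨i, j, hij, w, hw, e⟩ := exists_short hW hp
  obtain ⟨k, hik, hjk⟩ := other3 hij
  set w2 := ((s i)⁻¹ * s j) w with hw2
  have e1 : s i w2 = s j w := by rw [hw2, Perm.mul_apply]; simp
  have e2 : s i w = s j w2 := by
    nth_rw 1 [← e]; rw [Perm.mul_apply]; simp
  have m2 : w2 ∈ W := (hW.2.1.I1 i j w).2 hw
  obtain ⟨y1, k1⟩ := (s k).surjective (s i w)
  obtain ⟨y2, k2⟩ := (s k).surjective (s i w2)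
  have q : Quad s W i j k w w2 (s i w) (s i w2) y1 y2 :=
    { hij := hij, hik := hik, hjk := hjk, bub := hW, m1 := hw, m2 := m2, i1 := rfl, i2 := rfl,
      j1 := e1.symm, j2 := e2.symm, k1 := k1, k2 := k2
      n := fun h => hd i j hij w hw (by rw [← e1, ← h])
      n11 := by rintro rfl; exact hd k i hik.symm _ hw k1
      n12 := fun h => by
        rw [h, e2] at k1
        exact hd k j hjk.symm _ m2 k1
      n21 := fun h => by
        rw [h, e1] at k2
        exact hd k j hjk.symm _ hw k2
      n22 := fun h => by
        rw [h] at k2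
        exact hd k i hik.symm _ m2 k2 }
  exact q.main hp hM IH

theorem main_PP (hW : Bub s W) (hp : pl s W = W.ncard + 2) (hM : Mx s τ) : PP s τ W :=
  main_ind (W.ncard + 1) s τ W (by omega) hW hp hM

end
end PB

namespace PB
open Equiv

theorem numCycles_eq {α V : Type*} [Finite α] [Finite V] (p : Perm α) (ρ : Perm V) (W : Set V)
    (e : α → V) (he : Function.Injective e) (hr : Set.range e = W)
    (h : ∀ x, ρ (e x) = e (p x)) : numCycles p = cyc ρ W := by
  have wd : ∀ x y, p.SameCycle x y → cl (I1 ρ) (e x) = cl (I1 ρ) (e y) := by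
    intro x y hxy
    rw [cl_eq_iff]
    intro T hT
    refine (sc_sameCycle.2 hxy) (e ⁻¹' T) ?_
    intro z
    show e (p z) ∈ T ↔ e z ∈ T
    rw [← h]; exact hT _
  let f : Quotient (permSetoid p) → Set V := Quotient.lift (fun x => cl (I1 ρ) (e x)) wd
  have fi : Function.Injective f := by
    intro a b
    induction a using Quotient.inductionOn with | _ x
    induction b using Quotient.inductionOn with | _ y
    intro hab
    have hab' : cl (I1 ρ) (e x) = cl (I1 ρ) (e y) := hab
    rw [cl_eq_iff] at hab'
    apply Quotient.sound
    show p.SameCycle x y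
    have hS : I1 ρ (e '' {z | p.SameCycle x z}) := by
      apply mem_of_maps
      rintro _ ⟨z, hz, rfl⟩
      exact ⟨p z, Perm.sameCycle_apply_right.2 hz, (h z).symm⟩
    obtain ⟨z, hz, hz'⟩ := (hab' _ hS).1 ⟨x, Perm.SameCycle.refl p x, rfl⟩
    rw [← he hz']; exact hz
  have fr : Set.range f = cl (I1 ρ) '' W := by
    rw [← hr]
    ext S
    constructor
    · rintro ⟨q, rfl⟩
      induction q using Quotient.inductionOn with | _ x
      exact ⟨e x, ⟨x, rfl⟩, rfl⟩
    · rintro ⟨_, ⟨x, rfl⟩, rfl⟩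
      exact ⟨Quotient.mk _ x, rfl⟩
  rw [numCycles, cyc, cls_eq, ← fr, ← Nat.card_coe_set_eq, Nat.card_range_of_injective fi]

theorem orbitsIn_eq {n : ℕ} (ρ : Perm (Fin n)) (W : Set (Fin n)) (hW : I1 ρ W) :
    orbitsIn ρ W = cyc ρ W := by
  have wd : ∀ x y, ρ.SameCycle x y → cl (I1 ρ) x = cl (I1 ρ) y := by
    intro x y hxy
    rw [cl_eq_iff]
    exact sc_sameCycle.2 hxy
  let g : Quotient (permSetoid ρ) → Set (Fin n) := Quotient.lift (fun x => cl (I1 ρ) x) wd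
  have gi : Function.Injective g := by
    intro a b
    induction a using Quotient.inductionOn with | _ x
    induction b using Quotient.inductionOn with | _ y
    intro hab
    have hab' : cl (I1 ρ) x = cl (I1 ρ) y := hab
    rw [cl_eq_iff] at hab'
    exact Quotient.sound (sc_sameCycle.1 hab')
  let f : {q : Quotient (permSetoid ρ) //
    ∀ x : Fin n, Quotient.mk (permSetoid ρ) x = q → x ∈ W} → Set (Fin n) := fun q => g q.1
  have fi : Function.Injective f := fun a b hab => Subtype.ext (gi hab)
  have fr : Set.range f = cl (I1 ρ) '' W := by
    ext S
    constructor
    · rintro ⟨⟨q, hq⟩, rfl⟩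
      induction q using Quotient.inductionOn with | _ x
      exact ⟨x, hq x rfl, rfl⟩
    · rintro ⟨x, hx, rfl⟩
      refine ⟨⟨Quotient.mk _ x, ?_⟩, rfl⟩
      intro y hy
      have : ρ.SameCycle y x := Quotient.exact hy
      exact ((sc_sameCycle.2 this) W hW).2 hx
  rw [orbitsIn, cyc, cls_eq, ← fr, ← Nat.card_coe_set_eq, Nat.card_range_of_injective fi]

theorem CI_of_maps {V : Type*} [Finite V] {s : Fin 3 → Perm V} {τ : Perm V} {S : Set V}
    (h : ∀ a, ∀ z ∈ S, (s a)⁻¹ (τ z) ∈ S) : CI s τ S :=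
  CI_iff.2 fun a => mem_of_maps fun z hz => h a z hz

theorem CI_color {n : ℕ} {σ : Fin 4 → Perm (Fin n)} {S : Set (Fin n)}
    (hS : CI (fun i => σ i.succ) (σ 0) S) (a b : Fin 4) (z t : Fin n) (e : σ a z = σ b t) :
    z ∈ S ↔ t ∈ S := by
  induction a using Fin.cases with
  | zero =>
    induction b using Fin.cases with
    | zero => rw [(σ 0).injective e]
    | succ b => exact (hS b t z e.symm).symm
  | succ a =>
    induction b using Fin.cases with
    | zero => exact hS a z t e
    | succ b => exact hS.BI a b z t e

theorem conn_iff {n : ℕ} (σ : Fin 4 → Perm (Fin n)) :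
    ColoredConnected σ ↔ ∀ x y, Rl (CI (fun i => σ i.succ) (σ 0)) x y := by
  constructor
  · intro h x y S hS
    obtain ⟨g, hg, rfl⟩ := h x y
    have key : ∀ z, z ∈ S ↔ g z ∈ S := by
      induction hg using Subgroup.closure_induction with
      | mem g hg =>
        obtain ⟨a, b, rfl⟩ := hg
        intro z
        exact (CI_color hS a b _ _ (by simp)).symm
      | one => intro z; rfl
      | mul g k _ _ h1 h2 => intro z; rw [h2 z, h1]; rfl
      | inv g _ h1 => intro z; rw [h1 (g⁻¹ z)]; simp
    exact key x
  · intro h x y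
    refine (h x y {z | ∃ g ∈ Subgroup.closure {g : Perm (Fin n) | ∃ a b : Fin 4,
      g = (σ a)⁻¹ * σ b}, g x = z} ?_).1 ⟨1, one_mem _, rfl⟩
    apply CI_of_maps
    rintro a _ ⟨g, hg, rfl⟩
    exact ⟨(σ a.succ)⁻¹ * σ 0 * g, mul_mem (Subgroup.subset_closure ⟨_, _, rfl⟩) hg, rfl⟩

theorem C0_eq {n : ℕ} (σ : Fin 4 → Perm (Fin n)) :
    (C0 σ : ℤ) = F (fun i => σ i.succ) (σ 0) := by
  have h : ∀ p : Perm (Fin n), numCycles p = cyc p Set.univ := fun p =>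
    numCycles_eq p p Set.univ id Function.injective_id (by simp) (fun _ => rfl)
  rw [F, Fin.sum_univ_three, C0, h, h, h]
  push_cast
  rfl

section
variable {V : Type*} [Finite V] [DecidableEq V] {s : Fin 3 → Perm V} {W : Set V}

theorem join_all (m : ℕ) : ∀ τ : Perm V, N s τ = m →
    ∃ τ', Ph s τ' = Ph s τ ∧ ∀ x y, Rl (CI s τ') x y := by
  induction m with
  | zero =>
    intro τ h
    refine ⟨τ, rfl, ?_⟩
    intro x y
    by_contra hxy
    have := N_join hxy
    have : 0 ≤ N s (τ * swap x y) := by unfold N; positivity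
    push_cast at h
    omega
  | succ m ih =>
    intro τ h
    by_cases hc : ∀ x y, Rl (CI s τ) x y
    · exact ⟨τ, rfl, hc⟩
    · push Not at hc
      obtain ⟨x, y, hxy⟩ := hc
      obtain ⟨τ', h1, h2⟩ := ih (τ * swap x y) (by have := N_join hxy; push_cast at h; omega)
      exact ⟨τ', h1.trans (Ph_join hxy), h2⟩

theorem N_one [Nonempty V] {τ : Perm V} (h : ∀ x y, Rl (CI s τ) x y) : N s τ = 1 := by
  obtain ⟨x⟩ := ‹Nonempty V›
  rw [N, cls_one (Set.mem_univ x) (fun y _ => h x y)]; rfl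

theorem Rl_out {τ τ' : Perm V} (h1 : CI s τ W) (ho : ∀ x ∉ W, τ' x = τ x)
    {x y : V} (hx : x ∉ W) (h : Rl (CI s τ) x y) : Rl (CI s τ') x y := by
  intro S hS
  have hy : y ∉ W := fun hy => hx ((h W h1).2 hy)
  have := h (S \ W) (by
    intro a z t e
    have hzt := h1 a z t e
    by_cases ht : t ∈ W
    · simp [ht, hzt.2 ht]
    · have hz : z ∉ W := fun hz => ht (hzt.1 hz)
      simp only [Set.mem_sdiff, ht, hz, not_false_eq_true, and_true]
      exact hS a z t (by rw [ho t ht]; exact e))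
  simpa [hx, hy] using this

theorem cls_split {I : Set V → Prop} (hI : I W) :
    cls I Set.univ = cls I W + cls I Wᶜ := by
  rw [← cls_union, Set.union_compl_self]
  intro x hx y hy h
  exact hy ((h W hI).1 hx)

theorem replace_le (hW : Bub s W) {τ τ' : Perm V} (h1 : CI s τ W) (h2 : CI s τ' W)
    (ho : ∀ x ∉ W, τ' x = τ x) (hM : Mx s τ) :
    ∑ a, cyc (rho s τ' a) W ≤ ∑ a, cyc (rho s τ a) W := by
  obtain ⟨x, hx⟩ := hW.1
  have hN : N s τ' = N s τ := by
    rw [N, N, cls_split h1, cls_split h2, cls_one hx (fun y hy => hW.conn τ hx hy),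
      cls_one hx (fun y hy => hW.conn τ' hx hy)]
    congr 2
    apply cls_congr
    intro x hx y
    exact ⟨Rl_out h2 (fun x hx => (ho x hx).symm) hx, Rl_out h1 ho hx⟩
  have hs : ∀ τ, CI s τ W → F s τ = ((∑ a, cyc (rho s τ a) W : ℕ) : ℤ) +
      ∑ a, (cyc (rho s τ a) Wᶜ : ℤ) := by
    intro τ h
    rw [F]
    push_cast
    rw [← Finset.sum_add_distrib]
    apply Finset.sum_congr rfl
    intro a _
    rw [cyc, cls_split (CI_iff.1 h a)]
    push_cast
    rfl
  have hc : ∀ a, cyc (rho s τ' a) Wᶜ = cyc (rho s τ a) Wᶜ := by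
    intro a
    apply cyc_congr
    · intro z
      exact not_congr (CI_iff.1 h2 a z)
    · intro z hz
      rw [Perm.mul_apply, Perm.mul_apply, ho z hz]
  have := hM τ'
  rw [Ph, Ph, hN, hs τ h1, hs τ' h2] at this
  simp only [hc] at this
  omega

end

theorem minus_one {n : ℕ} (σ : Fin 4 → Perm (Fin n)) (hc : ColoredConnected σ)
    (E : Set (Fin n × Fin 4)) (v : Fin n) (hE : E ⊆ {(v, 0)}) : minusConnected σ E := by
  rw [conn_iff] at hc
  intro x
  set R := Relation.EqvGen (fun p q : Fin n ⊕ Fin n => ∃ (i : Fin n) (c : Fin 4),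
        (i, c) ∉ E ∧ p = Sum.inl i ∧ q = Sum.inr (σ c i)) with hR
  have step : ∀ i c, (i, c) ∉ E → (R x (Sum.inl i) ↔ R x (Sum.inr (σ c i))) := by
    intro i c hi
    have h : R (Sum.inl i) (Sum.inr (σ c i)) := Relation.EqvGen.rel _ _ ⟨i, c, hi, rfl, rfl⟩
    exact ⟨fun h' => h'.trans _ _ _ h, fun h' => h'.trans _ _ _ (h.symm _ _)⟩
  have step' : ∀ i (a : Fin 3), R x (Sum.inl i) ↔ R x (Sum.inr (σ a.succ i)) := by
    intro i a
    apply step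
    intro h
    have := hE h
    simp at this
  let A : Set (Fin n) := {z | R x (Sum.inl z)}
  have hA : ∀ a : Fin 3, ∀ z, z ≠ v → ((σ a.succ)⁻¹ (σ 0 z) ∈ A ↔ z ∈ A) := by
    intro a z hz
    show R x _ ↔ R x _
    rw [step' _ a, step z 0 (fun h => hz (by simpa using hE h))]
    simp
  have hCI : CI (fun i => σ i.succ) (σ 0) A := by
    by_cases hv : v ∈ A
    · have : CI (fun i => σ i.succ) (σ 0) Aᶜ := by
        apply CI_of_maps
        intro a z hz h
        exact hz ((hA a z (fun e => hz (e ▸ hv))).1 h)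
      intro a z t e
      exact not_iff_not.1 (this a z t e)
    · apply CI_of_maps
      intro a z hz
      exact (hA a z (fun e => hv (e ▸ hz))).2 hz
  have hne : ∃ z, z ∈ A := by
    rcases x with z | u
    · exact ⟨z, Relation.EqvGen.refl _⟩
    · refine ⟨(σ (0 : Fin 3).succ)⁻¹ u, (step' _ 0).2 ?_⟩
      have e : σ (0 : Fin 3).succ ((σ (0 : Fin 3).succ)⁻¹ u) = u := by simp
      rw [e]
      exact Relation.EqvGen.refl _
  obtain ⟨z0, hz0⟩ := hne
  have hall : ∀ z, R x (Sum.inl z) := fun z => (hc z0 z A hCI).1 hz0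
  intro y
  rcases y with z | u
  · exact hall z
  · have := (step' ((σ (0 : Fin 3).succ)⁻¹ u) 0).1 (hall _)
    have e : σ (0 : Fin 3).succ ((σ (0 : Fin 3).succ)⁻¹ u) = u := by simp
    rw [e] at this
    exact this

theorem edge_cut {n : ℕ} (σ : Fin 4 → Perm (Fin n)) (hc : ColoredConnected σ)
    {W : Set (Fin n)} (hB : BI (fun i => σ i.succ) W) {lab : Fin n → Fin n}
    (h1 : ∀ x ∉ W, ∀ a : Fin 3, lab (σ a.succ x) = lab (σ 0 x))
    (h2 : ∀ w ∈ W, lab (σ 0 w) = w) {w b : Fin n} (hw : w ∈ W)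
    (hb : lab b = w) (hu : ∀ u ∈ Bk (fun i => σ i.succ) W, lab u = w → u = b)
    (hne : σ 0 w ≠ b) : IsEdgeCut σ {(w, 0), ((σ 0)⁻¹ b, 0)} := by
  set α := (σ 0)⁻¹ b with hα
  have hαb : σ 0 α = b := by simp [hα]
  have hαw : α ≠ w := fun h => hne (by rw [← h, hαb])
  have hαW : α ∉ W := fun h => hαw (by rw [← h2 α h, hαb, hb])
  constructor
  · intro hm
    let P : Fin n ⊕ Fin n → Prop := fun p => Sum.elim (fun x => x ∉ W ∧ lab (σ 0 x) = w)
      (fun u => u ∉ Bk (fun i => σ i.succ) W ∧ lab u = w) p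
    have key : ∀ p q, Relation.EqvGen
      (fun p q => ∃ (i : Fin n) (c : Fin 4),
        (i, c) ∉ ({(w, 0), (α, 0)} : Set (Fin n × Fin 4)) ∧ p = Sum.inl i ∧
          q = Sum.inr (σ c i)) p q → (P p ↔ P q) := by
      intro p q h
      induction h with
      | rel p q h =>
        obtain ⟨i, c, hi, rfl, rfl⟩ := h
        show (i ∉ W ∧ lab (σ 0 i) = w) ↔ (σ c i ∉ Bk (fun i => σ i.succ) W ∧ lab (σ c i) = w)
        induction c using Fin.cases with
        | zero =>
          have hiw : i ≠ w := fun e => hi (by simp [e])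
          have hiα : i ≠ α := fun e => hi (by simp [e])
          refine and_congr_left fun hl => ?_
          refine ⟨fun _ hk => hiα ?_, fun _ hk => hiw ?_⟩
          · have := hu _ hk hl
            rw [← this] at hα; rw [hα]; simp
          · rw [← h2 i hk, hl]
        | succ a =>
          rw [mem_Bk hB a i]
          refine and_congr_right fun hl => ?_
          rw [h1 i hl a]
      | refl => rfl
      | symm _ _ _ ih => exact ih.symm
      | trans _ _ _ _ _ ih1 ih2 => exact ih1.trans ih2
    have := (key _ _ (hm (Sum.inl α) (Sum.inl w))).1 ⟨hαW, by rw [hαb, hb]⟩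
    exact this.1 hw
  · intro E' hE'
    obtain ⟨hsub, hns⟩ := hE'
    rw [Set.not_subset] at hns
    obtain ⟨e, he, hne⟩ := hns
    rcases he with rfl | he
    · apply minus_one σ hc E' α
      intro x hx
      rcases hsub hx with rfl | h
      · exact absurd hx hne
      · exact h
    · apply minus_one σ hc E' w
      intro x hx
      rcases hsub hx with rfl | h
      · rfl
      · rw [Set.mem_singleton_iff] at h he
        rw [h, ← he] at hx; exact absurd hx hne

theorem bub_of_orbit {n : ℕ} (σ : Fin 4 → Perm (Fin n)) (w₀ : Fin n) :
    Bub (fun i => σ i.succ) (MulAction.orbit (bubbleSubgroup σ) w₀) := by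
  have hmem : ∀ a b : Fin 3, (σ a.succ)⁻¹ * σ b.succ ∈ bubbleSubgroup σ := fun a b =>
    Subgroup.subset_closure ⟨_, _, Fin.succ_ne_zero _, Fin.succ_ne_zero _, rfl⟩
  refine ⟨⟨w₀, MulAction.mem_orbit_self _⟩, ?_, ?_⟩
  · have : ∀ (a b : Fin 3) (z t : Fin n), σ a.succ z = σ b.succ t →
      t ∈ MulAction.orbit (bubbleSubgroup σ) w₀ → z ∈ MulAction.orbit (bubbleSubgroup σ) w₀ := by
      intro a b z t e ht
      have hz : z = (⟨_, hmem a b⟩ : bubbleSubgroup σ) • t := by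
        show z = (σ a.succ)⁻¹ (σ b.succ t)
        rw [← e]; simp
      rw [hz]
      exact MulAction.mem_orbit_of_mem_orbit _ ht
    exact fun a b z t e => ⟨this b a t z e.symm, this a b z t e⟩
  · intro S hS ⟨x, hxS, hx⟩ y hy
    have hxy : y ∈ MulAction.orbit (bubbleSubgroup σ) x := by
      rw [MulAction.orbit_eq_iff.2 hx]; exact hy
    obtain ⟨⟨g, hg⟩, rfl⟩ := hxy
    have key : ∀ z, z ∈ S ↔ g z ∈ S := by
      clear hy
      unfold bubbleSubgroup at hg
      induction hg using Subgroup.closure_induction with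
      | mem g hg =>
        obtain ⟨a, b, ha, hb, rfl⟩ := hg
        intro z
        obtain ⟨a, rfl⟩ := Fin.exists_succ_eq.2 ha
        obtain ⟨b, rfl⟩ := Fin.exists_succ_eq.2 hb
        exact (hS a b _ _ (by simp)).symm
      | one => intro z; rfl
      | mul g k _ _ h1 h2 => intro z; rw [h2 z, h1]; rfl
      | inv g _ h1 => intro z; rw [h1 (g⁻¹ z)]; simp
    exact (key x).1 hxS

theorem Mx_of_hmax {n : ℕ} [Nonempty (Fin n)]
    (σ : Fin 4 → Equiv.Perm (Fin n)) (hconn : ColoredConnected σ)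
    (hmax : ∀ τ₀ : Equiv.Perm (Fin n), ColoredConnected (Function.update σ 0 τ₀) →
      C0 (Function.update σ 0 τ₀) ≤ C0 σ) : Mx (fun i => σ i.succ) (σ 0) := by
  intro τ
  obtain ⟨τ', e, hc⟩ := join_all (s := fun i => σ i.succ) _ τ rfl
  have es : (fun i : Fin 3 => Function.update σ 0 τ' i.succ) = fun i => σ i.succ := by
    funext i; simp
  have e0 : Function.update σ 0 τ' 0 = τ' := by simp
  have := hmax τ' (by rw [conn_iff, es, e0]; exact hc)
  have : (C0 (Function.update σ 0 τ') : ℤ) ≤ C0 σ := by exact_mod_cast this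
  rw [C0_eq, C0_eq, es, e0] at this
  rw [← e, Ph, Ph, N_one hc, N_one ((conn_iff σ).1 hconn)]
  omega

end PB

open PB
theorem planar_bubble_max_two_cut {n : ℕ}
    (σ : Fin 4 → Equiv.Perm (Fin n)) (hconn : ColoredConnected σ)
    (hmax : ∀ τ₀ : Equiv.Perm (Fin n), ColoredConnected (Function.update σ 0 τ₀) →
      C0 (Function.update σ 0 τ₀) ≤ C0 σ)
    (W : Set (Fin n)) (hW : ∃ w₀ : Fin n, W = MulAction.orbit (bubbleSubgroup σ) w₀)
    (BW : Set (Fin n)) (hBW : BW = ⇑(σ 1) '' W)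
    (r : Fin 3 → (W ≃ BW))
    (hr : ∀ (i : Fin 3) (x : W), (r i x : Fin n) = σ i.succ (x : Fin n))
    (hplanar : orbitsIn ((σ 1)⁻¹ * σ 2) W + orbitsIn ((σ 1)⁻¹ * σ 3) W +
      orbitsIn ((σ 2)⁻¹ * σ 3) W = W.ncard + 2) :
    MaxTwoCut σ W BW r := by
  obtain ⟨w₀, hw₀⟩ := hW
  have hne : Nonempty (Fin n) := ⟨w₀⟩
  have hb : Bub (fun i => σ i.succ) W := by rw [hw₀]; exact bub_of_orbit σ w₀
  have hBI := hb.2.1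
  have hM := Mx_of_hmax σ hconn hmax
  have hp : pl (fun i => σ i.succ) W = W.ncard + 2 := by
    rw [orbitsIn_eq ((σ 1)⁻¹ * σ 2) W (hBI.I1 0 1), orbitsIn_eq ((σ 1)⁻¹ * σ 3) W (hBI.I1 0 2),
      orbitsIn_eq ((σ 2)⁻¹ * σ 3) W (hBI.I1 1 2)] at hplanar
    exact hplanar
  obtain ⟨lab, h1, h2⟩ := main_PP hb hp hM
  have hBk : BW = Bk (fun i => σ i.succ) W := by
    rw [hBW]
    ext u
    constructor
    · rintro ⟨x, hx, rfl⟩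
      exact (mem_Bk hBI 0 x).2 hx
    · intro hu
      exact ⟨_, hu, by simp⟩
  have hex : ∀ w, ∃ b, w ∈ W → b ∈ Bk (fun i => σ i.succ) W ∧ lab b = w ∧
      ∀ u ∈ Bk (fun i => σ i.succ) W, lab u = w → u = b := by
    intro w
    by_cases hw : w ∈ W
    · obtain ⟨b, hb1, hb2, hb3⟩ := lab_unique hBI h1 h2 hw
      exact ⟨b, fun _ => ⟨hb1, hb2, hb3⟩⟩
    · exact ⟨w, fun h => absurd h hw⟩
  choose p hp using hex
  obtain ⟨t, htM, ht⟩ := closing hb hp _ (σ 0) rfl h1 h2 hM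
  have ciW : ∀ t : Equiv.Perm (Fin n), (∀ w ∈ W, t w ∈ Bk (fun i => σ i.succ) W) →
      CI (fun i => σ i.succ) t W := by
    intro t h
    apply CI_of_maps
    intro a z hz
    rw [← mem_Bk hBI a]
    simpa using h z hz
  have htW : CI (fun i => σ i.succ) t W := ciW t fun w hw => by rw [ht w hw]; exact (hp w hw).1
  have htB : ∀ x, t x ∈ Bk (fun i => σ i.succ) W → x ∈ W := by
    intro x hx
    have := htW 0 ((σ 1)⁻¹ (t x)) x (by simp)
    exact this.1 hx
  let π0 : W → BW := fun w => ⟨p w, by rw [hBk]; exact (hp w w.2).1⟩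
  have hπ0 : Function.Bijective π0 := by
    constructor
    · intro a b hab
      have : p a = p b := congrArg Subtype.val hab
      apply Subtype.ext
      rw [← (hp a a.2).2.1, this, (hp b b.2).2.1]
    · rintro ⟨u, hu⟩
      rw [hBk] at hu
      have hx : t⁻¹ u ∈ W := htB _ (by simpa using hu)
      refine ⟨⟨t⁻¹ u, hx⟩, Subtype.ext ?_⟩
      show p (t⁻¹ u) = u
      rw [← ht _ hx]; simp
  have count : ∀ (π' : W ≃ BW) (t' : Equiv.Perm (Fin n)), (∀ w : W, t' w = π' w) →
      ∀ i, numCycles (π'.trans (r i).symm) = cyc (rho (fun i => σ i.succ) t' i) W := by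
    intro π' t' h i
    apply numCycles_eq (π'.trans (r i).symm) _ W Subtype.val Subtype.val_injective
      Subtype.range_coe
    intro x
    apply rho_eq
    show σ i.succ _ = _
    rw [← hr i, h x]
    simp
  refine ⟨Equiv.ofBijective π0 hπ0, ?_, ?_⟩
  · intro π'
    classical
    let f : Fin n → Fin n := fun x => if h : x ∈ W then π' ⟨x, h⟩ else t x
    have fW : ∀ x (h : x ∈ W), f x = π' ⟨x, h⟩ := fun x h => dif_pos h
    have fo : ∀ x, x ∉ W → f x = t x := fun x h => dif_neg h
    have fB : ∀ x, x ∈ W → f x ∈ Bk (fun i => σ i.succ) W := by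
      intro x h
      rw [fW x h, ← hBk]; exact (π' _).2
    have fi : Function.Injective f := by
      intro x y hxy
      by_cases hx : x ∈ W <;> by_cases hy : y ∈ W
      · rw [fW x hx, fW y hy] at hxy
        exact congrArg Subtype.val (π'.injective (Subtype.ext hxy))
      · exact absurd (htB y (by rw [← fo y hy, ← hxy]; exact fB x hx)) hy
      · exact absurd (htB x (by rw [← fo x hx, hxy]; exact fB y hy)) hx
      · rw [fo x hx, fo y hy] at hxy
        exact t.injective hxy
    let t' : Equiv.Perm (Fin n) := Equiv.ofBijective f (Finite.injective_iff_bijective.1 fi)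
    have := replace_le hb htW (ciW t' fB) (fun x hx => fo x hx) htM
    rw [Finset.sum_congr rfl (fun i _ => count π' t' (fun w => fW w w.2) i),
      Finset.sum_congr rfl (fun i _ => count (Equiv.ofBijective π0 hπ0) t
        (fun w => ht w w.2) i)]
    exact this
  · intro w
    show σ 0 w = p w ∨ ((({((w : Fin n), (0 : Fin 4)), ((σ 0)⁻¹ (p w), (0 : Fin 4))} :
          Set (Fin n × Fin 4)).ncard = 2) ∧
        IsEdgeCut σ {((w : Fin n), (0 : Fin 4)), ((σ 0)⁻¹ (p w), (0 : Fin 4))})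
    by_cases hw : σ 0 w = p w
    · exact Or.inl hw
    · right
      refine ⟨Set.ncard_pair ?_, edge_cut σ hconn hBI h1 h2 w.2 (hp w w.2).2.1
        (hp w w.2).2.2 hw⟩
      intro e
      apply hw
      have : (w : Fin n) = (σ 0)⁻¹ (p w) := congrArg Prod.fst e
      conv_lhs => rw [this]
      simp
end
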